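/- arXiv:1011.0517 — 2 statements merged into one kernel-verified Lean document; each statement's English description precedes it below -/
import Mathlib

section
/- Let S be a finite planar point set in general position whose convex hull is a triangle (exactly 3 points of S are vertices of the convex hull) and which has at least 5 points of S in the interior of its convex hull. Then some 7 points of S form a 7-pseudo-triangle whose interior contains no point of S. -/
open Set

noncomputable section

/-- Points of the plane. -/
abbrev Pt : Type := ℝ × ℝ

/-- Two-dimensional cross product. -/
def cross2 (u w : Pt) : ℝ := u.1 * w.2 - u.2 * w.1

/-- A set of points is in general position if no three of its points are collinear. -/
def GenPos (S : Set Pt) : Prop :=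
  ∀ p ∈ S, ∀ q ∈ S, ∀ r ∈ S, p ≠ q → p ≠ r → q ≠ r →
    ¬ Collinear ℝ ({p, q, r} : Set Pt)

/-- `v : ZMod n → Pt` lists the vertices (in cyclic order) of a simple polygon:
vertices are pairwise distinct, non-adjacent edges are disjoint, and adjacent
edges meet exactly in their common vertex. -/
structure IsSimplePolygon (n : ℕ) (v : ZMod n → Pt) : Prop where
  three_le : 3 ≤ n
  inj : Function.Injective v
  nonadj : ∀ i j : ZMod n, i ≠ j → i ≠ j + 1 → j ≠ i + 1 →
    segment ℝ (v i) (v (i + 1)) ∩ segment ℝ (v j) (v (j + 1)) = ∅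
  adj : ∀ i : ZMod n,
    segment ℝ (v i) (v (i + 1)) ∩ segment ℝ (v (i + 1)) (v (i + 2)) = {v (i + 1)}

/-- Twice the signed area of a polygon. -/
def signedArea (n : ℕ) (v : ZMod n → Pt) : ℝ :=
  if h : n = 0 then 0 else
    haveI : NeZero n := ⟨h⟩
    ∑ i : ZMod n, cross2 (v i) (v (i + 1))

/-- The turning cross product at vertex `i`. -/
def vtxCross (n : ℕ) (v : ZMod n → Pt) (i : ZMod n) : ℝ :=
  cross2 (v i - v (i - 1)) (v (i + 1) - v i)

/-- Vertex `i` of a simple polygon is convex (interior angle `< π`) iff the turn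
at `i` has the same (strict) sign as the orientation of the polygon. -/
def IsConvexVtx (n : ℕ) (v : ZMod n → Pt) (i : ZMod n) : Prop :=
  0 < vtxCross n v i * signedArea n v

/-- A pseudo-triangle: a simple polygon in which every vertex is strictly convex or
strictly reflex, with exactly three convex vertices. -/
def IsPseudoTriangle (n : ℕ) (v : ZMod n → Pt) : Prop :=
  IsSimplePolygon n v ∧ (∀ i : ZMod n, vtxCross n v i ≠ 0) ∧
    {i : ZMod n | IsConvexVtx n v i}.ncard = 3

/-- A standard pseudo-triangle: each of the three side chains has at least two
edges, i.e. no two convex vertices are cyclically adjacent. -/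
def IsStandardPseudoTriangle (n : ℕ) (v : ZMod n → Pt) : Prop :=
  IsPseudoTriangle n v ∧
    ∀ i : ZMod n, IsConvexVtx n v i → ¬ IsConvexVtx n v (i + 1)

/-- A mountain: a pseudo-triangle in which exactly one side chain consists of a
single edge (i.e. exactly one cyclically adjacent pair of convex vertices);
a 3-mountain is a triangle. -/
def IsMountain (n : ℕ) (v : ZMod n → Pt) : Prop :=
  IsPseudoTriangle n v ∧
    (n = 3 ∨ {i : ZMod n | IsConvexVtx n v i ∧ IsConvexVtx n v (i + 1)}.ncard = 1)

/-- The boundary of a polygon: the union of its edges. -/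
def polyBoundary (n : ℕ) (v : ZMod n → Pt) : Set Pt :=
  ⋃ i : ZMod n, segment ℝ (v i) (v (i + 1))

/-- The interior of a simple polygon: the union of the bounded connected
components of the complement of its boundary. -/
def polyInterior (n : ℕ) (v : ZMod n → Pt) : Set Pt :=
  {x : Pt | x ∉ polyBoundary n v ∧
    Bornology.IsBounded (connectedComponentIn (polyBoundary n v)ᶜ x)}

/-- A polygon is empty in `S` if its interior contains no point of `S`. -/
def EmptyIn (n : ℕ) (v : ZMod n → Pt) (S : Set Pt) : Prop :=
  polyInterior n v ∩ S = ∅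

/-- `S` contains an empty `ℓ`-pseudo-triangle. -/
def HasEmptyPseudoTriangle (ℓ : ℕ) (S : Set Pt) : Prop :=
  ∃ v : ZMod ℓ → Pt, Set.range v ⊆ S ∧ IsPseudoTriangle ℓ v ∧ EmptyIn ℓ v S

/-- A set of points is in convex position if each of them is a vertex of their
convex hull. -/
def ConvexPos (H : Set Pt) : Prop := ∀ p ∈ H, p ∉ convexHull ℝ (H \ {p})

/-- `H` is a `k`-hole in `S`: `k` points of `S` in convex position whose convex
hull contains no other point of `S` in its interior. -/
def IsHole (k : ℕ) (S H : Set Pt) : Prop :=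
  H ⊆ S ∧ H.ncard = k ∧ ConvexPos H ∧
    ∀ p ∈ S, p ∈ interior (convexHull ℝ H) → p ∈ H

/-- `S` contains a `k`-hole. -/
def HasHole (k : ℕ) (S : Set Pt) : Prop := ∃ H : Set Pt, IsHole k S H

/-- The points of `S` that are vertices of the convex hull of `S`. -/
def hullVertices (S : Set Pt) : Set Pt := {p ∈ S | p ∉ convexHull ℝ (S \ {p})}

/-- The points of `S` lying in the interior of the convex hull of `S`. -/
def interiorPts (S : Set Pt) : Set Pt := {p ∈ S | p ∈ interior (convexHull ℝ S)}

/-- `S` is `λ`-convex: every triangle with vertices in `S` contains at most `λ`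
points of `S` in its interior. -/
def LambdaConvex (lam : ℕ) (S : Set Pt) : Prop :=
  ∀ p ∈ S, ∀ q ∈ S, ∀ r ∈ S,
    (S ∩ interior (convexHull ℝ ({p, q, r} : Set Pt))).ncard ≤ lam

namespace PT
/-- bit, c, a, b masks, and sizes of a, b -/
structure CRow where
  bit : Nat
  c : Nat
  a : Nat
  b : Nat
  na : Nat
  nb : Nat

def CRow.rot (r : CRow) : CRow := ⟨r.bit, r.a, r.b, r.c, r.na, r.nb⟩

def anyR {α : Type} (f : α → Bool) (l : List α) : Bool :=
  List.rec (motive := fun _ => Bool) false (fun x _ ih => Bool.rec ih true (f x)) l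
def allR {α : Type} (f : α → Bool) (l : List α) : Bool :=
  List.rec (motive := fun _ => Bool) true (fun x _ ih => Bool.rec false ih (f x)) l
def mapR {α β : Type} (f : α → β) (l : List α) : List β :=
  List.rec (motive := fun _ => List β) [] (fun x _ ih => f x :: ih) l
def appR {α : Type} (l : List α) (l2 : List α) : List α :=
  List.rec (motive := fun _ => List α) l2 (fun x _ ih => x :: ih) l
def filterR {α : Type} (f : α → Bool) (l : List α) : List α :=
  List.rec (motive := fun _ => List α) [] (fun x _ ih => Bool.rec ih (x :: ih) (f x)) l
def lenR {α : Type} (l : List α) : Nat :=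
  List.rec (motive := fun _ => Nat) 0 (fun _ _ ih => Nat.add ih 1) l

def andB (a b : Bool) : Bool := Bool.rec false b a
def orB (a b : Bool) : Bool := Bool.rec b true a
def notB (a : Bool) : Bool := Bool.rec true false a
def iteB (a b c : Bool) : Bool := Bool.rec c b a

def hit (x y : Nat) : Bool := notB (Nat.beq (Nat.land x y) 0)

def unionA (R : Nat) (l : List CRow) : Nat :=
  List.rec (motive := fun _ => Nat) 0 (fun q _ ih => Bool.rec ih (Nat.lor q.a ih) (hit q.bit R)) l

def fin4 (full : Nat) (x z y1 y2 : CRow) : Bool :=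
  Nat.beq (Nat.lor (Nat.lor x.c z.b) (Nat.lor y1.a y2.a))
    (Nat.xor full (Nat.lor (Nat.lor x.bit z.bit) (Nat.lor y1.bit y2.bit)))

def dist4 (x z y1 y2 : Nat) : Bool :=
  andB (andB (notB (Nat.beq x z)) (notB (Nat.beq x y1))) (andB (andB (notB (Nat.beq x y2)) (notB (Nat.beq z y1)))
    (andB (notB (Nat.beq z y2)) (notB (Nat.beq y1 y2))))

def sel2 (full : Nat) (x z : CRow) (k : CRow → CRow → Bool) (l : List CRow) : Bool :=
  List.rec false (fun y1 l1 _ => List.rec false (fun y2 l2 _ => List.rec (andB (andB (fin4 full x z y1 y2) (dist4 x.bit z.bit y1.bit y2.bit)) (k y1 y2)) (fun _ _ _ => false) l2) l1) l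

def goodXZ (full : Nat) (rows : List CRow) (x z : CRow) (k : CRow → CRow → Bool) : Bool :=
  iteB (hit x.c z.bit) false (iteB (hit z.b x.bit) false (
  iteB (Nat.beq x.bit z.bit) false (
  (fun R => (fun U => 
  iteB (hit U (Nat.lor x.bit z.bit)) false (
  sel2 full x z k (filterR (fun q => andB (hit q.bit R) (notB (hit q.bit U))) rows))) (unionA R rows)) (Nat.xor full (Nat.lor (Nat.lor x.c z.b) (Nat.lor x.bit z.bit))))))

def good1 (full : Nat) (rows : List CRow) (k : CRow → CRow → CRow → CRow → Bool) : Bool :=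
  anyR (fun x => anyR (fun z => goodXZ full rows x z (k x z)) rows) rows

def good (full : Nat) (rows : List CRow) (k : Nat → Nat → Bool) : Bool :=
  orB (good1 full rows (fun _ z y1 y2 => k (Nat.lor y1.bit y2.bit) z.bit)) (orB
  (good1 full (mapR CRow.rot rows) (fun x _ y1 y2 => k x.bit (Nat.lor y1.bit y2.bit)))
  (good1 full (mapR CRow.rot (mapR CRow.rot rows)) (fun x z _ _ => k z.bit x.bit)))

def pat1 (rows : List CRow) : Bool :=
  rows.any fun p => rows.any fun u => hit u.bit p.c && rows.any fun v => hit v.bit p.c && !(hit u.bit v.c) && !(hit v.bit u.c) && 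
   !(Nat.beq u.bit v.bit) &&
   rows.any fun w1 => hit w1.bit p.c && hit u.bit w1.c && hit v.bit w1.c && 
   rows.any fun w2 => !(Nat.beq w1.bit w2.bit) && hit u.bit w2.c && hit v.bit w2.c &&
     Nat.beq p.c (Nat.lor (Nat.lor u.bit v.bit) (Nat.lor w1.bit w2.bit))

def pat (rows : List CRow) : Bool :=
  pat1 rows || (pat1 (rows.map CRow.rot) || pat1 ((rows.map CRow.rot).map CRow.rot))

def addA (nb : Nat) (r : CRow) : CRow := ⟨r.bit, r.c, Nat.add r.a nb, r.b, Nat.succ r.na, r.nb⟩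
def addB (nb : Nat) (r : CRow) : CRow := ⟨r.bit, r.c, r.a, Nat.add r.b nb, r.na, Nat.succ r.nb⟩

def loopG (lo nb : Nat) (nrow : CRow) (k : Nat → List CRow → Bool) (l : List CRow) : List CRow → Nat → Bool :=
  List.rec (motive := fun _ => List CRow → Nat → Bool) 
    (fun pre lg => k lg (appR pre [nrow]))
    (fun r rest ih pre lg => 
     andB (iteB (allR (fun r => Nat.ble r.nb 3) (r :: rest)) (k lg (appR pre (nrow :: mapR (addB nb) (r :: rest)))) true)
     (iteB (andB (Nat.ble r.na 3) (hit r.bit lo)) (ih (appR pre [addA nb r]) (Nat.add lg r.bit)) true)) l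

def loopB (nb : Nat) (k : Nat → Nat → List Nat → Bool) (l : List Nat) : List Nat → Nat → Bool :=
  List.rec (motive := fun _ => List Nat → Nat → Bool)
   (fun pre lo => k lo 0 (appR pre [nb]))
   (fun r rest ih pre lo => andB (k lo (lenR (r :: rest)) (appR pre (nb :: r :: rest)))
     (ih (appR pre [r]) (Nat.add lo r))) l

def search (n : Nat) : Nat → List Nat → List CRow → Nat → Nat → Bool → Bool :=
  Nat.rec (motive := fun _ => Nat → List Nat → List CRow → Nat → Nat → Bool → Bool)
   (fun _ _ _ _ _ _ => true)
   (fun _ ih m LB LG P Q kept =>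
    (fun nb => (fun full => (fun expand => 
      iteB kept (expand P Q) (
      iteB (Nat.ble m 3) (expand 0 0) (
      orB (good full LG expand) (orB (pat LG) (andB (Nat.ble m 4) (expand 0 0))))))
      (fun P Q => loopB nb (fun lo n2 LB' => 
       iteB (andB (Nat.ble n2 4) (Nat.ble (Nat.sub m n2) 4))
         (loopG lo nb ⟨nb, lo, Nat.sub full lo, 0, n2, 0⟩ (fun lg LG' => 
           ih (Nat.add m 1) LB' LG' P Q (orB (hit P lg) (hit Q (Nat.sub full lg)))) LG [] 0)
        true) LB [] 0)) (Nat.sub nb 1)) (Nat.pow 2 m)) n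

set_option maxRecDepth 100000 in
theorem search_true : search 10 0 [] [] 0 0 false = true := by decide +kernel
end PT
namespace PT
open Finset

theorem andB_eq {a b : Bool} : andB a b = true ↔ a = true ∧ b = true := by
  cases a <;> cases b <;> simp [andB]
theorem orB_eq {a b : Bool} : orB a b = true ↔ a = true ∨ b = true := by
  cases a <;> cases b <;> simp [orB]
theorem notB_eq {a : Bool} : notB a = true ↔ a = false := by
  cases a <;> simp [notB]
theorem iteB_eq {a b c : Bool} : iteB a b c = true ↔ (a = true ∧ b = true) ∨ (a = false ∧ c = true) := by
  cases a <;> simp [iteB]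
theorem beq_iff {a b : Nat} : Nat.beq a b = true ↔ a = b := by rw [Nat.beq_eq]
theorem ble_iff {a b : Nat} : Nat.ble a b = true ↔ a ≤ b := by rw [Nat.ble_eq]
theorem beq_false {a b : Nat} : Nat.beq a b = false ↔ a ≠ b := by
  rw [← Bool.not_eq_true, Nat.beq_eq]
theorem hit_iff {a b : Nat} : hit a b = true ↔ a &&& b ≠ 0 := by
  unfold hit; rw [notB_eq, beq_false]; rfl

theorem anyR_iff {α : Type} (f : α → Bool) (l : List α) : anyR f l = true ↔ ∃ x ∈ l, f x = true := by
  induction l with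
  | nil => simp [anyR]
  | cons x l ih =>
    have : anyR f (x :: l) = orB (f x) (anyR f l) := rfl
    rw [this, orB_eq, ih]; simp
theorem allR_iff {α : Type} (f : α → Bool) (l : List α) : allR f l = true ↔ ∀ x ∈ l, f x = true := by
  induction l with
  | nil => simp [allR]
  | cons x l ih =>
    have : allR f (x :: l) = andB (f x) (allR f l) := rfl
    rw [this, andB_eq, ih]; simp
theorem mapR_eq {α β : Type} (f : α → β) (l : List α) : mapR f l = l.map f := by
  induction l with
  | nil => rfl
  | cons x l ih =>
    have : mapR f (x :: l) = f x :: mapR f l := rfl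
    rw [this, ih]; rfl
theorem appR_eq {α : Type} (l l2 : List α) : appR l l2 = l ++ l2 := by
  induction l with
  | nil => rfl
  | cons x l ih =>
    have : appR (x :: l) l2 = x :: appR l l2 := rfl
    rw [this, ih]; rfl
theorem lenR_eq {α : Type} (l : List α) : lenR l = l.length := by
  induction l with
  | nil => rfl
  | cons x l ih =>
    have : lenR (x :: l) = lenR l + 1 := rfl
    rw [this, ih]; rfl
theorem filterR_sub {α : Type} (f : α → Bool) (l : List α) (x : α) (h : x ∈ filterR f l) : x ∈ l := by
  induction l with
  | nil => exact h
  | cons y l ih =>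
    have e : filterR f (y :: l) = Bool.rec (filterR f l) (y :: filterR f l) (f y) := rfl
    rw [e] at h
    cases hf : f y
    · rw [hf] at h; exact List.mem_cons_of_mem _ (ih h)
    · rw [hf] at h
      rcases List.mem_cons.1 h with h | h
      · simp [h]
      · exact List.mem_cons_of_mem _ (ih h)

theorem loopB_spec (nb : Nat) (k : Nat → Nat → List Nat → Bool) (l : List Nat) :
    ∀ (pre : List Nat) (lo : Nat), loopB nb k l pre lo = true →
    ∀ s1 s2, l = s1 ++ s2 → k (lo + s1.sum) s2.length (pre ++ (s1 ++ nb :: s2)) = true := by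
  induction l with
  | nil =>
    intro pre lo h s1 s2 hs
    obtain ⟨h1, h2⟩ := List.append_eq_nil_iff.1 hs.symm
    subst h1; subst h2
    have h' : k lo 0 (appR pre [nb]) = true := h
    rw [appR_eq] at h'
    simpa using h'
  | cons r rest ih =>
    intro pre lo h s1 s2 hs
    have h' : andB (k lo (lenR (r :: rest)) (appR pre (nb :: r :: rest)))
      (loopB nb k rest (appR pre [r]) (Nat.add lo r)) = true := h
    rw [andB_eq, lenR_eq, appR_eq, appR_eq] at h'
    cases s1 with
    | nil => 
      simp only [List.nil_append] at hs
      subst hs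
      simpa using h'.1
    | cons a s1 =>
      simp only [List.cons_append, List.cons.injEq] at hs
      obtain ⟨rfl, hs⟩ := hs
      have := ih _ _ h'.2 s1 s2 hs
      have e : lo + (r :: s1).sum = Nat.add lo r + s1.sum := by
        rw [List.sum_cons, ← add_assoc]; rfl
      rw [e]
      simpa only [List.append_assoc, List.cons_append, List.nil_append] using this

theorem loopG_spec (lo nb : Nat) (nrow : CRow) (k : Nat → List CRow → Bool) (l : List CRow) :
    ∀ (pre : List CRow) (lg : Nat), loopG lo nb nrow k l pre lg = true →
    ∀ t1 t2, l = t1 ++ t2 → (∀ r ∈ t1, r.na ≤ 3 ∧ hit r.bit lo = true) → (∀ r ∈ t2, r.nb ≤ 3) →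
    k (lg + (t1.map CRow.bit).sum) (pre ++ (t1.map (addA nb) ++ nrow :: t2.map (addB nb))) = true := by
  induction l with
  | nil =>
    intro pre lo h s1 s2 hs _ _
    obtain ⟨h1, h2⟩ := List.append_eq_nil_iff.1 hs.symm
    subst h1; subst h2
    have h' : k _ (appR pre [nrow]) = true := h
    rw [appR_eq] at h'
    simpa using h'
  | cons r rest ih =>
    intro pre lg h t1 t2 hs H1 H2
    have h' : andB (iteB (allR (fun r => Nat.ble r.nb 3) (r :: rest)) (k lg (appR pre (nrow :: mapR (addB nb) (r :: rest)))) true)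
     (iteB (andB (Nat.ble r.na 3) (hit r.bit lo)) (loopG lo nb nrow k rest (appR pre [addA nb r]) (Nat.add lg r.bit)) true) = true := h
    rw [andB_eq, appR_eq, appR_eq, mapR_eq] at h'
    cases t1 with
    | nil => 
      simp only [List.nil_append] at hs
      have : allR (fun r => Nat.ble r.nb 3) (r :: rest) = true := by
        rw [allR_iff]; intro x hx; rw [ble_iff]; rw [hs] at hx; exact H2 x hx
      have h1 := h'.1
      rw [this] at h1
      rw [← hs]
      simpa [iteB] using h1
    | cons a t1 =>
      simp only [List.cons_append, List.cons.injEq] at hs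
      obtain ⟨rfl, hs⟩ := hs
      have h2 := h'.2
      have : andB (Nat.ble r.na 3) (hit r.bit lo) = true := by
        rw [andB_eq, ble_iff]; exact H1 r (by simp)
      rw [this] at h2
      have := ih _ _ h2 t1 t2 hs (fun x hx => H1 x (List.mem_cons_of_mem _ hx)) H2
      have e : lg + ((r :: t1).map CRow.bit).sum = Nat.add lg r.bit + (t1.map CRow.bit).sum := by
        rw [List.map_cons, List.sum_cons, ← add_assoc]; rfl
      rw [e, List.map_cons]
      simpa only [List.append_assoc, List.cons_append, List.nil_append] using this

/-! masks -/
open Classical in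
def maskOf (m : ℕ) (P : ℕ → Prop) : ℕ := ∑ i ∈ Finset.range m, if P i then 2 ^ i else 0
open Classical in
def cnt (m : ℕ) (P : ℕ → Prop) : ℕ := ((Finset.range m).filter P).card

theorem maskOf_succ (m : ℕ) (P : ℕ → Prop) [Decidable (P m)] :
    maskOf (m+1) P = maskOf m P + if P m then 2 ^ m else 0 := by
  unfold maskOf; rw [Finset.sum_range_succ]; congr

theorem cnt_succ (m : ℕ) (P : ℕ → Prop) [Decidable (P m)] :
    cnt (m+1) P = cnt m P + if P m then 1 else 0 := by
  unfold cnt; rw [Finset.range_add_one, Finset.filter_insert]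
  split_ifs with h <;> simp

theorem maskOf_lt (m : ℕ) (P : ℕ → Prop) : maskOf m P < 2 ^ m := by
  classical
  induction m with
  | zero => simp [maskOf]
  | succ m ih => rw [maskOf_succ, pow_succ]; split_ifs <;> omega

theorem testBit_maskOf (m : ℕ) (P : ℕ → Prop) (r : ℕ) : (maskOf m P).testBit r = true ↔ r < m ∧ P r := by
  classical
  induction m with
  | zero => simp [maskOf]
  | succ m ih =>
    rw [maskOf_succ]
    split_ifs with h
    · rw [add_comm, show 2 ^ m + maskOf m P = 2 ^ m ||| maskOf m P by
          simpa using Nat.two_pow_add_eq_or_of_lt (maskOf_lt m P) 1, Nat.testBit_or, Bool.or_eq_true, ih,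
        Nat.testBit_two_pow]
      simp only [decide_eq_true_eq]
      constructor
      · rintro (rfl | h') 
        · exact ⟨by omega, h⟩
        · exact ⟨by omega, h'.2⟩
      · rintro ⟨h1, h2⟩
        by_cases hr : m = r
        · exact Or.inl hr
        · exact Or.inr ⟨by omega, h2⟩
    · rw [add_zero, ih]
      constructor
      · rintro ⟨h1, h2⟩; exact ⟨by omega, h2⟩
      · rintro ⟨h1, h2⟩
        refine ⟨?_, h2⟩
        rcases Nat.lt_succ_iff_lt_or_eq.1 h1 with h1 | rfl
        · exact h1
        · exact absurd h2 h

theorem maskOf_congr {m : ℕ} {P Q : ℕ → Prop} (h : ∀ r < m, P r ↔ Q r) : maskOf m P = maskOf m Q := by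
  apply Nat.eq_of_testBit_eq; intro r
  rw [Bool.eq_iff_iff, testBit_maskOf, testBit_maskOf]
  constructor
  · rintro ⟨h1, h2⟩; exact ⟨h1, (h r h1).1 h2⟩
  · rintro ⟨h1, h2⟩; exact ⟨h1, (h r h1).2 h2⟩

theorem cnt_congr {m : ℕ} {P Q : ℕ → Prop} (h : ∀ r < m, P r ↔ Q r) : cnt m P = cnt m Q := by
  classical
  unfold cnt; congr 1; apply Finset.filter_congr; intro r hr
  exact h r (Finset.mem_range.1 hr)

theorem maskOf_not (m : ℕ) (P : ℕ → Prop) : maskOf m P + maskOf m (fun r => ¬ P r) = 2 ^ m - 1 := by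
  classical
  induction m with
  | zero => simp [maskOf]
  | succ m ih =>
    rw [maskOf_succ, maskOf_succ, pow_succ]
    have : 0 < 2 ^ m := by positivity
    split_ifs <;> omega
theorem cnt_not (m : ℕ) (P : ℕ → Prop) : cnt m P + cnt m (fun r => ¬ P r) = m := by
  classical
  induction m with
  | zero => simp [cnt]
  | succ m ih =>
    rw [cnt_succ, cnt_succ]
    split_ifs <;> omega

theorem cnt_mono {m n : ℕ} (h : m ≤ n) (P : ℕ → Prop) : cnt m P ≤ cnt n P := by
  classical
  unfold cnt
  apply Finset.card_le_card
  intro x; simp only [Finset.mem_filter, Finset.mem_range]; rintro ⟨h1, h2⟩; exact ⟨by omega, h2⟩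

theorem list_mask {m : ℕ} {P : ℕ → Prop} {s : List ℕ} (hn : s.Nodup) (h : ∀ r, r ∈ s ↔ r < m ∧ P r) :
    (s.map (2 ^ ·)).sum = maskOf m P := by
  classical
  unfold maskOf
  rw [← Finset.sum_filter, ← List.sum_toFinset _ hn]
  apply Finset.sum_congr _ (fun _ _ => rfl)
  ext r; simp [h]

theorem list_cnt {m : ℕ} {P : ℕ → Prop} {s : List ℕ} (hn : s.Nodup) (h : ∀ r, r ∈ s ↔ r < m ∧ P r) :
    s.length = cnt m P := by
  classical
  unfold cnt
  rw [← List.toFinset_card_of_nodup hn]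
  congr 1
  ext r; simp [h]

theorem hit_two_pow (i M : ℕ) : hit (2 ^ i) M = true ↔ M.testBit i = true := by
  rw [hit_iff]
  constructor
  · intro h
    by_contra hc
    apply h
    apply Nat.eq_of_testBit_eq; intro r
    rw [Nat.testBit_and, Nat.testBit_two_pow]
    by_cases hr : i = r
    · subst hr; simp at hc; simp [hc]
    · simp [hr]
  · intro h h0
    have : (2 ^ i &&& M).testBit i = true := by
      rw [Nat.testBit_and, Nat.testBit_two_pow, h]; simp
    rw [h0] at this; simp at this
theorem hit_or (a b M : ℕ) : hit (a ||| b) M = true ↔ hit a M = true ∨ hit b M = true := by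
  simp only [hit_iff]
  rw [Nat.and_or_distrib_right]
  constructor
  · intro h; by_contra hc; push Not at hc; apply h; simp [hc.1, hc.2]
  · rintro h h0
    have := Nat.or_eq_zero_iff.1 h0
    rcases h with h | h
    · exact h this.1
    · exact h this.2
theorem hit_zero (M : ℕ) : hit 0 M = false := by
  rw [← Bool.not_eq_true, hit_iff]; simp

/-! rows -/
def Rel := ℕ → ℕ → Prop

structure IsRow (C A B : ℕ → ℕ → Prop) (m : ℕ) (i : ℕ) (r : CRow) : Prop where
  lt : i < m
  bit : r.bit = 2 ^ i
  c : r.c = maskOf m (C i)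
  a : r.a = maskOf m (A i)
  b : r.b = maskOf m (B i)

theorem IsRow.rot {C A B m i r} (h : IsRow C A B m i r) : IsRow A B C m i r.rot :=
  ⟨h.lt, h.bit, h.a, h.b, h.c⟩

/-- good tuple on the first `m` points -/
structure Good (C A B : ℕ → ℕ → Prop) (m : ℕ) (x z y1 y2 : ℕ) : Prop where
  hx : x < m
  hz : z < m
  hy1 : y1 < m
  hy2 : y2 < m
  xz : x ≠ z
  xy1 : x ≠ y1
  xy2 : x ≠ y2
  zy1 : z ≠ y1
  zy2 : z ≠ y2
  yy : y1 ≠ y2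
  cov : ∀ q < m, (C x q ∨ B z q ∨ A y1 q ∨ A y2 q) ↔ (q ≠ x ∧ q ≠ z ∧ q ≠ y1 ∧ q ≠ y2)

structure Pat (C : ℕ → ℕ → Prop) (m : ℕ) (p u v w1 w2 : ℕ) : Prop where
  hp : p < m
  hu : u < m
  hv : v < m
  hw1 : w1 < m
  hw2 : w2 < m
  uv : u ≠ v
  ww : w1 ≠ w2
  nuv : ¬ C u v
  nvu : ¬ C v u
  c1u : C w1 u
  c1v : C w1 v
  c2u : C w2 u
  c2v : C w2 v
  cov : ∀ q < m, C p q ↔ (q = u ∨ q = v ∨ q = w1 ∨ q = w2)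

theorem two_pow_ne {i j : ℕ} (h : (2:ℕ) ^ i ≠ 2 ^ j) : i ≠ j := fun e => h (by rw [e])

theorem full_testBit (m q : ℕ) : (2 ^ m - 1).testBit q = decide (q < m) := Nat.testBit_two_pow_sub_one m q

theorem good1_spec {C A B : ℕ → ℕ → Prop} {m : ℕ} {rows : List CRow} {k : CRow → CRow → CRow → CRow → Bool}
    (hr : ∀ r ∈ rows, ∃ i, IsRow C A B m i r) (h : good1 (2 ^ m - 1) rows k = true) :
    ∃ x z y1 y2 : CRow, ∃ ix iz i1 i2, IsRow C A B m ix x ∧ IsRow C A B m iz z ∧ IsRow C A B m i1 y1 ∧ IsRow C A B m i2 y2 ∧ 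
     Good C A B m ix iz i1 i2 ∧ k x z y1 y2 = true := by
  unfold good1 at h
  rw [anyR_iff] at h
  obtain ⟨x, hx, h⟩ := h
  rw [anyR_iff] at h
  obtain ⟨z, hz, h⟩ := h
  unfold goodXZ at h
  simp only [iteB_eq, Bool.false_eq_true, and_false, false_or] at h
  obtain ⟨_, _, _, _, h⟩ := h
  generalize hl : filterR _ rows = l at h
  have hsub : ∀ y ∈ l, y ∈ rows := by
    intro y hy; rw [← hl] at hy; exact filterR_sub _ _ _ hy
  match l, h, hsub with
  | [], h, _ => exact absurd h (by simp [sel2])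
  | [y], h, _ => exact absurd h (by simp [sel2])
  | _ :: _ :: _ :: _, h, _ => exact absurd h (by simp [sel2])
  | [y1, y2], h, hsub =>
    have h' : andB (andB (fin4 (2^m-1) x z y1 y2) (dist4 x.bit z.bit y1.bit y2.bit)) (k x z y1 y2) = true := h
    rw [andB_eq, andB_eq] at h'
    obtain ⟨⟨hf, hd⟩, hk⟩ := h'
    obtain ⟨ix, rx⟩ := hr x hx
    obtain ⟨iz, rz⟩ := hr z hz
    obtain ⟨i1, r1⟩ := hr y1 (hsub _ (by simp))
    obtain ⟨i2, r2⟩ := hr y2 (hsub _ (by simp))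
    refine ⟨x, z, y1, y2, ix, iz, i1, i2, rx, rz, r1, r2, ?_, hk⟩
    unfold dist4 at hd
    simp only [andB_eq, notB_eq, beq_false, rx.bit, rz.bit, r1.bit, r2.bit] at hd
    obtain ⟨⟨d1, d2⟩, ⟨d3, d4⟩, d5, d6⟩ := hd
    refine ⟨rx.lt, rz.lt, r1.lt, r2.lt, two_pow_ne d1, two_pow_ne d2, two_pow_ne d3, two_pow_ne d4, two_pow_ne d5, two_pow_ne d6, ?_⟩
    intro q hq
    unfold fin4 at hf
    rw [beq_iff] at hf
    have hf' : ((x.c ||| z.b) ||| (y1.a ||| y2.a)) = (2^m-1) ^^^ ((x.bit ||| z.bit) ||| (y1.bit ||| y2.bit)) := hf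
    have := congrArg (fun M => M.testBit q) hf'
    simp only [Nat.testBit_or, Nat.testBit_xor, rx.c, rz.b, r1.a, r2.a, rx.bit, rz.bit, r1.bit, r2.bit, full_testBit, Nat.testBit_two_pow, hq, decide_true, Bool.true_bne] at this
    rw [Bool.eq_iff_iff] at this
    simp only [Bool.or_eq_true, testBit_maskOf, Bool.not_eq_true', hq, true_and, Bool.or_eq_false_iff, decide_eq_false_iff_not] at this
    constructor
    · intro h
      have := this.1 (by tauto)
      exact ⟨Ne.symm this.1.1, Ne.symm this.1.2, Ne.symm this.2.1, Ne.symm this.2.2⟩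
    · rintro ⟨h1, h2, h3, h4⟩
      have := this.2 ⟨⟨Ne.symm h1, Ne.symm h2⟩, Ne.symm h3, Ne.symm h4⟩
      tauto

theorem pat1_spec {C A B : ℕ → ℕ → Prop} {m : ℕ} {rows : List CRow} 
    (hr : ∀ r ∈ rows, ∃ i, IsRow C A B m i r) (h : pat1 rows = true) :
    ∃ p u v w1 w2, Pat C m p u v w1 w2 := by
  unfold pat1 at h
  simp only [List.any_eq_true, Bool.and_eq_true] at h
  obtain ⟨p, hp, u, hu, hup, v, hv, ⟨⟨⟨hvp, h1⟩, h2⟩, h3⟩, w1, hw1, ⟨⟨h4, h5⟩, h6⟩, w2, hw2, ⟨⟨h7, h8⟩, h9⟩, h10⟩ := h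
  obtain ⟨ip, rp⟩ := hr p hp
  obtain ⟨iu, ru⟩ := hr u hu
  obtain ⟨iv, rv⟩ := hr v hv
  obtain ⟨i1, r1⟩ := hr w1 hw1
  obtain ⟨i2, r2⟩ := hr w2 hw2
  simp only [Bool.not_eq_true', ru.bit, rv.bit, r1.bit, r2.bit, rp.c, ru.c, rv.c, r1.c, r2.c,
    hit_two_pow, testBit_maskOf, ← Bool.not_eq_true] at *
  rw [Nat.beq_eq] at h3 h7
  refine ⟨ip, iu, iv, i1, i2, rp.lt, ru.lt, rv.lt, r1.lt, r2.lt, two_pow_ne h3, two_pow_ne h7, ?_, ?_, h5.2, h6.2, h8.2, h9.2, ?_⟩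
  · intro h; exact h2 ⟨rv.lt, h⟩
  · intro h; exact h1 ⟨ru.lt, h⟩
  intro q hq
  rw [Nat.beq_eq] at h10
  have := congrArg (fun M => M.testBit q) h10
  change _ = ((2 ^ iu ||| 2 ^ iv) ||| (2 ^ i1 ||| 2 ^ i2)).testBit q at this
  simp only [Nat.testBit_or, Nat.testBit_two_pow] at this
  rw [Bool.eq_iff_iff] at this
  simp only [testBit_maskOf, Bool.or_eq_true, decide_eq_true_eq, hq, true_and] at this
  rw [this]
  simp only [eq_comm (a := q)]
  tauto

theorem Pat.extend {C : ℕ → ℕ → Prop} {m n : ℕ} (hmn : m ≤ n) {p u v w1 w2 : ℕ} (h : Pat C m p u v w1 w2)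
    (h4 : cnt n (C p) ≤ 4) (irr : ∀ i, ¬ C i i) : Pat C n p u v w1 w2 := by
  classical
  refine ⟨by have := h.hp; omega, by have := h.hu; omega, by have := h.hv; omega, by have := h.hw1; omega,
    by have := h.hw2; omega, h.uv, h.ww, h.nuv, h.nvu, h.c1u, h.c1v, h.c2u, h.c2v, ?_⟩
  have key : ({u, v, w1, w2} : Finset ℕ) = (Finset.range n).filter (C p) := by
    apply Finset.eq_of_subset_of_card_le
    · intro q hq
      have hq' : q = u ∨ q = v ∨ q = w1 ∨ q = w2 := by simpa using hq
      have hqm : q < m := by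
        rcases hq' with rfl | rfl | rfl | rfl
        exacts [h.hu, h.hv, h.hw1, h.hw2]
      simp only [Finset.mem_filter, Finset.mem_range]
      exact ⟨by omega, (h.cov q hqm).2 hq'⟩
    · have : ({u, v, w1, w2} : Finset ℕ).card = 4 := by
        have e1 : u ≠ w1 := fun e => irr u (by have := h.c1u; rwa [← e] at this)
        have e2 : u ≠ w2 := fun e => irr u (by have := h.c2u; rwa [← e] at this)
        have e3 : v ≠ w1 := fun e => irr v (by have := h.c1v; rwa [← e] at this)
        have e4 : v ≠ w2 := fun e => irr v (by have := h.c2v; rwa [← e] at this)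
        rw [Finset.card_insert_of_notMem, Finset.card_insert_of_notMem, Finset.card_insert_of_notMem, Finset.card_singleton]
        · simp [h.ww]
        · simp [e3, e4]
        · simp [h.uv, e1, e2]
      rw [this]
      unfold cnt at h4
      convert h4
  intro q hq
  have : q ∈ ({u, v, w1, w2} : Finset ℕ) ↔ q ∈ (Finset.range n).filter (C p) := by rw [key]
  simp only [Finset.mem_insert, Finset.mem_singleton, Finset.mem_filter, Finset.mem_range, hq, true_and] at this
  exact this.symm

end PT
namespace PT
open Finset

def RC (b : ℕ → ℝ) (p q : ℕ) : Prop := q < p ∧ b q < b p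
def RA (b g : ℕ → ℝ) (p q : ℕ) : Prop := b p < b q ∧ g p < g q
def RB (g : ℕ → ℝ) (p q : ℕ) : Prop := p < q ∧ g q < g p

structure Cfg (n : ℕ) (b g : ℕ → ℝ) : Prop where
  bi : ∀ i < n, ∀ j < n, i ≠ j → b i ≠ b j
  gi : ∀ i < n, ∀ j < n, i ≠ j → g i ≠ g j
  cons : ∀ i j, i < j → j < n → g i < g j → b i < b j
  tC : ∀ p < n, cnt n (RC b p) ≤ 4
  tA : ∀ p < n, cnt n (RA b g p) ≤ 4
  tB : ∀ p < n, cnt n (RB g p) ≤ 4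

def GoodPQ (b g : ℕ → ℝ) (m P Q : ℕ) : Prop :=
  (∃ x z y1 y2, Good (RC b) (RA b g) (RB g) m x z y1 y2 ∧ P = 2 ^ y1 ||| 2 ^ y2 ∧ Q = 2 ^ z) ∨
  (∃ x z y1 y2, Good (RA b g) (RB g) (RC b) m x z y1 y2 ∧ P = 2 ^ x ∧ Q = 2 ^ y1 ||| 2 ^ y2) ∨
  (∃ x z y1 y2, Good (RB g) (RC b) (RA b g) m x z y1 y2 ∧ P = 2 ^ z ∧ Q = 2 ^ x)

def Concl (b g : ℕ → ℝ) (n : ℕ) : Prop :=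
  (∃ x z y1 y2, Good (RC b) (RA b g) (RB g) n x z y1 y2) ∨
  (∃ x z y1 y2, Good (RA b g) (RB g) (RC b) n x z y1 y2) ∨
  (∃ x z y1 y2, Good (RB g) (RC b) (RA b g) n x z y1 y2) ∨
  (∃ p u v w1 w2, Pat (RC b) n p u v w1 w2) ∨
  (∃ p u v w1 w2, Pat (RA b g) n p u v w1 w2) ∨
  (∃ p u v w1 w2, Pat (RB g) n p u v w1 w2)

theorem GoodPQ.concl {b g : ℕ → ℝ} {m P Q : ℕ} (h : GoodPQ b g m P Q) : Concl b g m := by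
  rcases h with ⟨x, z, y1, y2, h, _⟩ | ⟨x, z, y1, y2, h, _⟩ | ⟨x, z, y1, y2, h, _⟩
  · exact Or.inl ⟨x, z, y1, y2, h⟩
  · exact Or.inr (Or.inl ⟨x, z, y1, y2, h⟩)
  · exact Or.inr (Or.inr (Or.inl ⟨x, z, y1, y2, h⟩))

theorem Good.ext {C A B : ℕ → ℕ → Prop} {m x z y1 y2 : ℕ} (h : Good C A B m x z y1 y2)
    (hm : C x m ∨ B z m ∨ A y1 m ∨ A y2 m) : Good C A B (m+1) x z y1 y2 := by
  have h1 := h.hx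
  have h2 := h.hz
  have h3 := h.hy1
  have h4 := h.hy2
  refine ⟨by omega, by omega, by omega, by omega, h.xz, h.xy1, h.xy2, h.zy1, h.zy2, h.yy, ?_⟩
  intro q hq
  rcases Nat.lt_succ_iff_lt_or_eq.1 hq with hq | rfl
  · exact h.cov q hq
  · exact ⟨fun _ => ⟨by omega, by omega, by omega, by omega⟩, fun _ => hm⟩

theorem GoodPQ.keep {n : ℕ} {b g : ℕ → ℝ} (hc : Cfg n b g) {m P Q : ℕ} (hm : m < n) (h : GoodPQ b g m P Q)
    (hk : hit P (maskOf m (fun r => g r < g m)) = true ∨ hit Q (maskOf m (fun r => ¬ g r < g m)) = true) :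
    GoodPQ b g (m+1) P Q := by
  have hA : ∀ y < m, g y < g m → RA b g y m := fun y hy h => ⟨hc.cons y m hy hm h, h⟩
  have hB : ∀ y < m, ¬ g y < g m → RB g y m := fun y hy h => 
    ⟨hy, lt_of_le_of_ne (not_lt.1 h) (hc.gi _ hm _ (by omega) (by omega))⟩
  rcases h with ⟨x, z, y1, y2, h, rfl, rfl⟩ | ⟨x, z, y1, y2, h, rfl, rfl⟩ | ⟨x, z, y1, y2, h, rfl, rfl⟩
  · refine Or.inl ⟨x, z, y1, y2, h.ext ?_, rfl, rfl⟩
    simp only [hit_or, hit_two_pow, testBit_maskOf] at hk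
    rcases hk with (⟨h1, h2⟩ | ⟨h1, h2⟩) | ⟨h1, h2⟩
    · exact Or.inr (Or.inr (Or.inl (hA _ h1 h2)))
    · exact Or.inr (Or.inr (Or.inr (hA _ h1 h2)))
    · exact Or.inr (Or.inl (hB _ h1 h2))
  · refine Or.inr (Or.inl ⟨x, z, y1, y2, h.ext ?_, rfl, rfl⟩)
    simp only [hit_or, hit_two_pow, testBit_maskOf] at hk
    rcases hk with ⟨h1, h2⟩ | ⟨h1, h2⟩ | ⟨h1, h2⟩
    · exact Or.inl (hA _ h1 h2)
    · exact Or.inr (Or.inr (Or.inl (hB _ h1 h2)))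
    · exact Or.inr (Or.inr (Or.inr (hB _ h1 h2)))
  · refine Or.inr (Or.inr ⟨x, z, y1, y2, h.ext ?_, rfl, rfl⟩)
    simp only [hit_two_pow, testBit_maskOf] at hk
    rcases hk with ⟨h1, h2⟩ | ⟨h1, h2⟩
    · exact Or.inr (Or.inl (hA _ h1 h2))
    · exact Or.inl (hB _ h1 h2)

def rowOf (b g : ℕ → ℝ) (m i : ℕ) : CRow :=
  ⟨2 ^ i, maskOf m (RC b i), maskOf m (RA b g i), maskOf m (RB g i), cnt m (RA b g i), cnt m (RB g i)⟩

theorem rowOf_isRow {b g : ℕ → ℝ} {m i : ℕ} (h : i < m) : IsRow (RC b) (RA b g) (RB g) m i (rowOf b g m i) :=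
  ⟨h, rfl, rfl, rfl, rfl⟩

def expandF (f m : ℕ) (LB : List ℕ) (LG : List CRow) (P Q : ℕ) : Bool :=
  loopB (2 ^ m) (fun lo n2 LB' => 
       iteB (andB (Nat.ble n2 4) (Nat.ble (Nat.sub m n2) 4))
         (loopG lo (2 ^ m) ⟨2 ^ m, lo, Nat.sub (2 ^ m - 1) lo, 0, n2, 0⟩ (fun lg LG' => 
           search f (Nat.add m 1) LB' LG' P Q (orB (hit P lg) (hit Q (Nat.sub (2 ^ m - 1) lg)))) LG [] 0)
        true) LB [] 0

theorem search_succ (f m : ℕ) (LB : List ℕ) (LG : List CRow) (P Q : ℕ) (kept : Bool) :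
    search (f+1) m LB LG P Q kept = iteB kept (expandF f m LB LG P Q) (
      iteB (Nat.ble m 3) (expandF f m LB LG 0 0) (
      orB (good (2 ^ m - 1) LG (expandF f m LB LG)) (orB (pat LG) (andB (Nat.ble m 4) (expandF f m LB LG 0 0))))) := rfl

theorem split_sorted (f : ℕ → ℝ) (v : ℝ) : ∀ l : List ℕ, l.Pairwise (fun i j => f i < f j) → (∀ i ∈ l, f i ≠ v) →
    ∃ s1 s2, l = s1 ++ s2 ∧ (∀ i ∈ s1, f i < v) ∧ (∀ i ∈ s2, v < f i) := by
  intro l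
  induction l with
  | nil => intro _ _; exact ⟨[], [], rfl, by simp, by simp⟩
  | cons a l ih =>
    intro hp hv
    rw [List.pairwise_cons] at hp
    rcases lt_or_gt_of_ne (hv a (by simp)) with h | h
    · obtain ⟨s1, s2, rfl, h1, h2⟩ := ih hp.2 (fun i hi => hv i (by simp [hi]))
      refine ⟨a :: s1, s2, rfl, ?_, h2⟩
      intro i hi
      rcases List.mem_cons.1 hi with rfl | hi
      · exact h
      · exact h1 i hi
    · refine ⟨[], a :: l, rfl, by simp, ?_⟩
      intro i hi
      rcases List.mem_cons.1 hi with rfl | hi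
      · exact h
      · exact h.trans (hp.1 i hi)

structure Srt (f : ℕ → ℝ) (m : ℕ) (l : List ℕ) : Prop where
  pw : l.Pairwise (fun i j => f i < f j)
  mem : ∀ i, i ∈ l ↔ i < m

theorem Srt.step {f : ℕ → ℝ} {n m : ℕ} {l : List ℕ} (h : Srt f m l) (hm : m < n)
    (hi : ∀ i < n, ∀ j < n, i ≠ j → f i ≠ f j) :
    ∃ s1 s2, l = s1 ++ s2 ∧ Srt f (m+1) (s1 ++ m :: s2) ∧ s1.Nodup ∧ s2.Nodup ∧
      (∀ i, i ∈ s1 ↔ i < m ∧ f i < f m) ∧ (∀ i, i ∈ s2 ↔ i < m ∧ ¬ f i < f m) := by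
  obtain ⟨s1, s2, rfl, h1, h2⟩ := split_sorted f (f m) l h.pw (fun i hi' => by
    have := (h.mem i).1 hi'
    exact hi i (by omega) m hm (by omega))
  have hpw := h.pw
  rw [List.pairwise_append] at hpw
  have nd : ∀ s : List ℕ, s.Pairwise (fun i j => f i < f j) → s.Nodup := by
    intro s hs
    exact hs.imp (fun hab e => by rw [e] at hab; exact lt_irrefl _ hab)
  refine ⟨s1, s2, rfl, ⟨?_, ?_⟩, nd _ hpw.1, nd _ hpw.2.1, ?_, ?_⟩
  · rw [List.pairwise_append, List.pairwise_cons]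
    refine ⟨hpw.1, ⟨fun i hi => h2 i hi, hpw.2.1⟩, ?_⟩
    intro a ha c hc
    rcases List.mem_cons.1 hc with rfl | hc
    · exact h1 a ha
    · exact hpw.2.2 a ha c hc
  · intro i
    have := h.mem i
    simp only [List.mem_append, List.mem_cons] at this ⊢
    constructor
    · rintro (h | rfl | h)
      · have := this.1 (Or.inl h); omega
      · omega
      · have := this.1 (Or.inr h); omega
    · intro hi
      rcases Nat.lt_succ_iff_lt_or_eq.1 hi with hi | rfl
      · rcases this.2 hi with h | h
        · exact Or.inl h
        · exact Or.inr (Or.inr h)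
      · exact Or.inr (Or.inl rfl)
  · intro i
    constructor
    · intro hi; exact ⟨(h.mem i).1 (by simp [hi]), h1 i hi⟩
    · rintro ⟨hi, hf⟩
      rcases List.mem_append.1 ((h.mem i).2 hi) with h | h
      · exact h
      · exact absurd hf (not_lt.2 (h2 i h).le)
  · intro i
    constructor
    · intro hi; exact ⟨(h.mem i).1 (by simp [hi]), not_lt.2 (h2 i hi).le⟩
    · rintro ⟨hi, hf⟩
      rcases List.mem_append.1 ((h.mem i).2 hi) with h | h
      · exact absurd (h1 i h) hf
      · exact h

theorem sub_mask (m : ℕ) (P : ℕ → Prop) : Nat.sub (2 ^ m - 1) (maskOf m P) = maskOf m (fun r => ¬ P r) := by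
  have := maskOf_not m P
  change 2 ^ m - 1 - maskOf m P = _
  omega

theorem expand_spec {n : ℕ} {b g : ℕ → ℝ} (hc : Cfg n b g) {f m : ℕ} (hm : m < n) {lb lg : List ℕ}
    (hb : Srt b m lb) (hg : Srt g m lg) {P Q : ℕ} (hPQ : GoodPQ b g m P Q ∨ P = 0 ∧ Q = 0)
    (h : expandF f m (lb.map (2 ^ ·)) (lg.map (rowOf b g m)) P Q = true) :
    ∃ lb' lg' kept, Srt b (m+1) lb' ∧ Srt g (m+1) lg' ∧ (kept = true → GoodPQ b g (m+1) P Q) ∧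
      search f (m+1) (lb'.map (2 ^ ·)) (lg'.map (rowOf b g (m+1))) P Q kept = true := by
  obtain ⟨s1, s2, rfl, hb', nd1, nd2, m1, m2⟩ := hb.step hm hc.bi
  obtain ⟨t1, t2, rfl, hg', nt1, nt2, k1, k2⟩ := hg.step hm hc.gi
  have h1 := loopB_spec _ _ _ _ _ h (s1.map (2 ^ ·)) (s2.map (2 ^ ·)) (by rw [List.map_append])
  rw [list_mask nd1 m1, zero_add, List.length_map, list_cnt nd2 m2, List.nil_append] at h1
  -- identify masks
  have cC : cnt m (RC b m) = cnt m (fun r => b r < b m) := cnt_congr (fun r hr => by simp [RC, hr])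
  have hAm : ∀ r < m, RA b g m r ↔ ¬ b r < b m := by
    intro r hr
    constructor
    · intro h; exact not_lt.2 h.1.le
    · intro h
      have hne := hc.bi r (by omega) m hm (by omega)
      have hne' := hc.gi r (by omega) m hm (by omega)
      refine ⟨lt_of_le_of_ne (not_lt.1 h) (Ne.symm hne), ?_⟩
      by_contra hcon
      exact h (hc.cons r m hr hm (lt_of_le_of_ne (not_lt.1 hcon) hne'))
  have cA : cnt m (RA b g m) = cnt m (fun r => ¬ b r < b m) := cnt_congr hAm
  have l1 : cnt m (fun r => b r < b m) ≤ 4 := by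
    rw [← cC]; exact (cnt_mono (by omega) _).trans (hc.tC m hm)
  have l2 : cnt m (fun r => ¬ b r < b m) ≤ 4 := by
    rw [← cA]; exact (cnt_mono (by omega) _).trans (hc.tA m hm)
  have l12 := cnt_not m (fun r => b r < b m)
  have hcond : andB (Nat.ble (cnt m (fun r => ¬ b r < b m)) 4) (Nat.ble (Nat.sub m (cnt m (fun r => ¬ b r < b m))) 4) = true := by
    rw [andB_eq, ble_iff, ble_iff]
    refine ⟨l2, ?_⟩
    change m - _ ≤ 4
    omega
  rw [iteB_eq] at h1
  replace h1 := (h1.resolve_right (fun h => by rw [hcond] at h; exact absurd h.1 (by decide))).2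
  have h2 := loopG_spec _ _ _ _ _ _ _ h1 (t1.map (rowOf b g m)) (t2.map (rowOf b g m)) (by rw [List.map_append]) ?_ ?_
  rotate_left
  · intro r hr
    obtain ⟨i, hi, rfl⟩ := List.mem_map.1 hr
    obtain ⟨him, hig⟩ := (k1 i).1 hi
    have hbi := hc.cons i m him hm hig
    constructor
    · have := (cnt_mono (by omega : m + 1 ≤ n) (RA b g i)).trans (hc.tA i (by omega))
      classical
      rw [cnt_succ, if_pos (show RA b g i m from ⟨hbi, hig⟩)] at this
      change cnt m (RA b g i) ≤ 3
      omega
    · change hit (2 ^ i) _ = true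
      rw [hit_two_pow, testBit_maskOf]
      exact ⟨him, hbi⟩
  · intro r hr
    obtain ⟨i, hi, rfl⟩ := List.mem_map.1 hr
    obtain ⟨him, hig⟩ := (k2 i).1 hi
    have hB : RB g i m := ⟨him, lt_of_le_of_ne (not_lt.1 hig) (hc.gi m hm i (by omega) (by omega))⟩
    have := (cnt_mono (by omega : m + 1 ≤ n) (RB g i)).trans (hc.tB i (by omega))
    classical
    rw [cnt_succ, if_pos hB] at this
    change cnt m (RB g i) ≤ 3
    omega
  rw [zero_add, List.nil_append] at h2
  have e1 : (List.map CRow.bit (List.map (rowOf b g m) t1)).sum = maskOf m (fun r => g r < g m) := by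
    rw [List.map_map]; exact list_mask nt1 k1
  rw [e1, sub_mask, sub_mask] at h2
  refine ⟨s1 ++ m :: s2, t1 ++ m :: t2,
    orB (hit P (maskOf m fun r => g r < g m)) (hit Q (maskOf m fun r => ¬ g r < g m)), hb', hg', ?_, ?_⟩
  rotate_left
  · rw [List.map_append, List.map_cons, List.map_append, List.map_cons]
    have e2 : t1.map (rowOf b g (m+1)) = (t1.map (rowOf b g m)).map (addA (2 ^ m)) := by
      rw [List.map_map]
      apply List.map_congr_left
      intro i hi
      obtain ⟨him, hig⟩ := (k1 i).1 hi
      have hbi := hc.cons i m him hm hig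
      have hA : RA b g i m := ⟨hbi, hig⟩
      have hB : ¬ RB g i m := fun h => lt_asymm h.2 hig
      have hC : ¬ RC b i m := fun h => by have := h.1; omega
      classical
      simp [rowOf, addA, maskOf_succ, cnt_succ, hA, hB, hC]
    have e3 : t2.map (rowOf b g (m+1)) = (t2.map (rowOf b g m)).map (addB (2 ^ m)) := by
      rw [List.map_map]
      apply List.map_congr_left
      intro i hi
      obtain ⟨him, hig⟩ := (k2 i).1 hi
      have hA : ¬ RA b g i m := fun h => hig h.2
      have hB : RB g i m := ⟨him, lt_of_le_of_ne (not_lt.1 hig) (hc.gi m hm i (by omega) (by omega))⟩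
      have hC : ¬ RC b i m := fun h => by have := h.1; omega
      classical
      simp [rowOf, addB, maskOf_succ, cnt_succ, hA, hB, hC]
    have e4 : rowOf b g (m+1) m = ⟨2 ^ m, maskOf m (fun r => b r < b m), maskOf m (fun r => ¬ b r < b m), 0, cnt m (fun r => ¬ b r < b m), 0⟩ := by
      have hA : ¬ RA b g m m := fun h => lt_irrefl _ h.1
      have hB : ∀ r ≤ m, ¬ RB g m r := fun r hr h => by have := h.1; omega
      have hC : ¬ RC b m m := fun h => by have := h.1; omega
      have z1 : maskOf m (RB g m) = 0 := by
        unfold maskOf; apply Finset.sum_eq_zero; intro r hr; rw [if_neg (hB r (Finset.mem_range.1 hr).le)]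
      have z2 : cnt m (RB g m) = 0 := by
        classical
        unfold cnt; rw [Finset.card_eq_zero, Finset.filter_eq_empty_iff]; intro r hr; exact hB r (Finset.mem_range.1 hr).le
      have z3 : maskOf m (RC b m) = maskOf m (fun r => b r < b m) := maskOf_congr (fun r hr => by simp [RC, hr])
      have z4 : maskOf m (RA b g m) = maskOf m (fun r => ¬ b r < b m) := maskOf_congr hAm
      classical
      simp only [rowOf, maskOf_succ, cnt_succ, hA, hB m le_rfl, hC, if_false, add_zero, z1, z2, z3, z4, cA]
    rw [e2, e3, e4]
    exact h2
  · intro hk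
    rw [orB_eq] at hk
    rcases hPQ with hPQ | ⟨rfl, rfl⟩
    · exact hPQ.keep hc hm hk
    · simp [hit_zero] at hk

theorem pat_concl {n : ℕ} {b g : ℕ → ℝ} (hc : Cfg n b g) {m : ℕ} (hm : m ≤ n) {rows : List CRow}
    (hr : ∀ r ∈ rows, ∃ i, IsRow (RC b) (RA b g) (RB g) m i r) (h : pat rows = true) : Concl b g n := by
  unfold pat at h
  have hr1 : ∀ r ∈ rows.map CRow.rot, ∃ i, IsRow (RA b g) (RB g) (RC b) m i r := by
    intro r hr'
    obtain ⟨s, hs, rfl⟩ := List.mem_map.1 hr'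
    obtain ⟨i, hi⟩ := hr s hs
    exact ⟨i, hi.rot⟩
  have hr2 : ∀ r ∈ (rows.map CRow.rot).map CRow.rot, ∃ i, IsRow (RB g) (RC b) (RA b g) m i r := by
    intro r hr'
    obtain ⟨s, hs, rfl⟩ := List.mem_map.1 hr'
    obtain ⟨i, hi⟩ := hr1 s hs
    exact ⟨i, hi.rot⟩
  rw [Bool.or_eq_true, Bool.or_eq_true] at h
  unfold Concl
  rcases h with h | h | h
  · obtain ⟨p, u, v, w1, w2, h⟩ := pat1_spec hr h
    exact Or.inr (Or.inr (Or.inr (Or.inl ⟨p, u, v, w1, w2, h.extend hm (hc.tC p (lt_of_lt_of_le h.hp hm)) (fun i h => lt_irrefl _ h.1)⟩)))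
  · obtain ⟨p, u, v, w1, w2, h⟩ := pat1_spec hr1 h
    exact Or.inr (Or.inr (Or.inr (Or.inr (Or.inl ⟨p, u, v, w1, w2, h.extend hm (hc.tA p (lt_of_lt_of_le h.hp hm)) (fun i h => lt_irrefl _ h.1)⟩))))
  · obtain ⟨p, u, v, w1, w2, h⟩ := pat1_spec hr2 h
    exact Or.inr (Or.inr (Or.inr (Or.inr (Or.inr ⟨p, u, v, w1, w2, h.extend hm (hc.tB p (lt_of_lt_of_le h.hp hm)) (fun i h => lt_irrefl _ h.1)⟩))))

theorem good_spec {b g : ℕ → ℝ} {m : ℕ} {rows : List CRow} {k : ℕ → ℕ → Bool}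
    (hr : ∀ r ∈ rows, ∃ i, IsRow (RC b) (RA b g) (RB g) m i r) (h : good (2 ^ m - 1) rows k = true) :
    ∃ P Q, GoodPQ b g m P Q ∧ k P Q = true := by
  unfold good at h
  rw [mapR_eq, mapR_eq] at h
  have hr1 : ∀ r ∈ rows.map CRow.rot, ∃ i, IsRow (RA b g) (RB g) (RC b) m i r := by
    intro r hr'
    obtain ⟨s, hs, rfl⟩ := List.mem_map.1 hr'
    obtain ⟨i, hi⟩ := hr s hs
    exact ⟨i, hi.rot⟩
  have hr2 : ∀ r ∈ (rows.map CRow.rot).map CRow.rot, ∃ i, IsRow (RB g) (RC b) (RA b g) m i r := by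
    intro r hr'
    obtain ⟨s, hs, rfl⟩ := List.mem_map.1 hr'
    obtain ⟨i, hi⟩ := hr1 s hs
    exact ⟨i, hi.rot⟩
  rw [orB_eq, orB_eq] at h
  rcases h with h | h | h
  · obtain ⟨x, z, y1, y2, ix, iz, i1, i2, hx, hz, h1, h2, hg, hk⟩ := good1_spec hr h
    refine ⟨_, _, Or.inl ⟨ix, iz, i1, i2, hg, rfl, rfl⟩, ?_⟩
    rw [hz.bit, h1.bit, h2.bit] at hk
    exact hk
  · obtain ⟨x, z, y1, y2, ix, iz, i1, i2, hx, hz, h1, h2, hg, hk⟩ := good1_spec hr1 h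
    refine ⟨_, _, Or.inr (Or.inl ⟨ix, iz, i1, i2, hg, rfl, rfl⟩), ?_⟩
    rw [hx.bit, h1.bit, h2.bit] at hk
    exact hk
  · obtain ⟨x, z, y1, y2, ix, iz, i1, i2, hx, hz, h1, h2, hg, hk⟩ := good1_spec hr2 h
    refine ⟨_, _, Or.inr (Or.inr ⟨ix, iz, i1, i2, hg, rfl, rfl⟩), ?_⟩
    rw [hz.bit, hx.bit] at hk
    exact hk

theorem search_spec {n : ℕ} {b g : ℕ → ℝ} (hc : Cfg n b g) (hn : 5 ≤ n) : ∀ (f m : ℕ), n + 1 ≤ m + f → m ≤ n →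
    ∀ (lb lg : List ℕ) (P Q : ℕ) (kept : Bool), Srt b m lb → Srt g m lg → (kept = true → GoodPQ b g m P Q) →
    search f m (lb.map (2 ^ ·)) (lg.map (rowOf b g m)) P Q kept = true → Concl b g n := by
  intro f
  induction f with
  | zero => intro m h1 h2; omega
  | succ f ih =>
    intro m h1 h2 lb lg P Q kept hb hg hk h
    rw [search_succ] at h
    have hrow : ∀ r ∈ lg.map (rowOf b g m), ∃ i, IsRow (RC b) (RA b g) (RB g) m i r := by
      intro r hr
      obtain ⟨i, hi, rfl⟩ := List.mem_map.1 hr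
      exact ⟨i, rowOf_isRow ((hg.mem i).1 hi)⟩
    have main : ∀ P Q, (GoodPQ b g m P Q ∨ (P = 0 ∧ Q = 0 ∧ m ≤ 4)) → 
        expandF f m (lb.map (2 ^ ·)) (lg.map (rowOf b g m)) P Q = true → Concl b g n := by
      intro P Q hPQ hexp
      rcases Nat.lt_or_ge m n with hmn | hmn
      · obtain ⟨lb', lg', kept, hb', hg', hk', hs⟩ := expand_spec hc hmn hb hg (by tauto) hexp
        exact ih (m+1) (by omega) (by omega) lb' lg' P Q kept hb' hg' hk' hs
      · have : m = n := by omega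
        subst this
        rcases hPQ with h | ⟨_, _, h⟩
        · exact h.concl
        · omega
    rw [iteB_eq] at h
    rcases h with ⟨hkk, h⟩ | ⟨_, h⟩
    · exact main P Q (Or.inl (hk hkk)) h
    rw [iteB_eq] at h
    rcases h with ⟨hkk, h⟩ | ⟨_, h⟩
    · rw [ble_iff] at hkk
      exact main 0 0 (Or.inr ⟨rfl, rfl, by omega⟩) h
    rw [orB_eq, orB_eq, andB_eq, ble_iff] at h
    rcases h with h | h | ⟨h4, h⟩
    · obtain ⟨P, Q, hPQ, hk⟩ := good_spec hrow h
      exact main P Q (Or.inl hPQ) hk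
    · exact pat_concl hc h2 hrow h
    · exact main 0 0 (Or.inr ⟨rfl, rfl, h4⟩) h

theorem Cfg.le_nine {n : ℕ} {b g : ℕ → ℝ} (hc : Cfg n b g) : n ≤ 9 := by
  rcases Nat.eq_zero_or_pos n with h | h
  · omega
  have hm : n - 1 < n := by omega
  have l12 := cnt_not (n-1) (fun r => b r < b (n-1))
  have cC : cnt (n-1) (RC b (n-1)) = cnt (n-1) (fun r => b r < b (n-1)) := cnt_congr (fun r hr => by simp [RC, hr])
  have cA : cnt (n-1) (RA b g (n-1)) = cnt (n-1) (fun r => ¬ b r < b (n-1)) := by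
    apply cnt_congr
    intro r hr
    constructor
    · intro h; exact not_lt.2 h.1.le
    · intro h
      have hne := hc.bi r (by omega) (n-1) hm (by omega)
      have hne' := hc.gi r (by omega) (n-1) hm (by omega)
      refine ⟨lt_of_le_of_ne (not_lt.1 h) (Ne.symm hne), ?_⟩
      by_contra hcon
      exact h (hc.cons r _ hr hm (lt_of_le_of_ne (not_lt.1 hcon) hne'))
  have l1 := (cnt_mono (by omega : n - 1 ≤ n) _).trans (hc.tC _ hm)
  have l2 := (cnt_mono (by omega : n - 1 ≤ n) _).trans (hc.tA _ hm)
  omega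

theorem comb {n : ℕ} {b g : ℕ → ℝ} (hc : Cfg n b g) (hn : 5 ≤ n) : Concl b g n := by
  have := hc.le_nine
  exact search_spec hc hn 10 0 (by omega) (by omega) [] [] 0 0 false ⟨by simp, by simp⟩ ⟨by simp, by simp⟩ (by simp) search_true

end PT
namespace PT

/-- orientation of a triple of points -/
def o (a b c : Pt) : ℝ := (b.1 - a.1) * (c.2 - a.2) - (b.2 - a.2) * (c.1 - a.1)

theorem o_rot (a b c : Pt) : o b c a = o a b c := by unfold o; ring
theorem o_rot2 (a b c : Pt) : o c a b = o a b c := by unfold o; ring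
theorem o_swap (a b c : Pt) : o b a c = - o a b c := by unfold o; ring
theorem o_swap' (a b c : Pt) : o a c b = - o a b c := by unfold o; ring
theorem o_self1 (a b : Pt) : o a b a = 0 := by unfold o; ring
theorem o_self2 (a b : Pt) : o a b b = 0 := by unfold o; ring
theorem o_self3 (a b : Pt) : o a a b = 0 := by unfold o; ring
theorem o_sum (a b c p : Pt) : o a b p + o b c p + o c a p = o a b c := by unfold o; ring
theorem o_plu (A B C p q : Pt) : o A p q * o A B C = o C A p * o A B q - o A B p * o C A q := by unfold o; ring

theorem o_comb (a b p q : Pt) (s t : ℝ) (h : s + t = 1) : o a b (s • p + t • q) = s * o a b p + t * o a b q := by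
  have : s = 1 - t := by linarith
  subst this
  simp only [o, Prod.fst_add, Prod.snd_add, Prod.smul_fst, Prod.smul_snd, smul_eq_mul]; ring

theorem o_ray (a b p d : Pt) (t : ℝ) : o a b (p + t • d) = o a b p + t * (o a b (p + d) - o a b p) := by
  simp only [o, Prod.fst_add, Prod.snd_add, Prod.smul_fst, Prod.smul_snd, smul_eq_mul]; ring

theorem notMem_seg {a b p q r : Pt} (hp : o a b p ≤ 0) (hq : o a b q ≤ 0) (hr : 0 < o a b r) : r ∉ segment ℝ p q := by
  rintro ⟨s, t, hs, ht, hst, rfl⟩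
  rw [o_comb _ _ _ _ _ _ hst] at hr
  nlinarith

theorem seg_pos {a b p q r : Pt} (hp : 0 < o a b p) (hq : 0 < o a b q) (h : r ∈ segment ℝ p q) : 0 < o a b r := by
  obtain ⟨s, t, hs, ht, hst, rfl⟩ := h
  rw [o_comb _ _ _ _ _ _ hst]
  rcases hs.lt_or_eq with h | h
  · have := mul_pos h hp
    have := mul_nonneg ht hq.le
    linarith
  · have : t = 1 := by linarith
    subst this; rw [← h]; linarith

theorem seg_disj {a b p q r s : Pt} (hp : 0 < o a b p) (hq : 0 < o a b q) (hr : o a b r ≤ 0) (hs : o a b s ≤ 0) :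
    segment ℝ p q ∩ segment ℝ r s = ∅ := by
  rw [Set.eq_empty_iff_forall_notMem]
  rintro w ⟨h1, h2⟩
  exact notMem_seg hr hs (seg_pos hp hq h1) h2

theorem seg_disj' {a b p q r s : Pt} (hp : o a b p < 0) (hq : o a b q < 0) (hr : 0 ≤ o a b r) (hs : 0 ≤ o a b s) :
    segment ℝ p q ∩ segment ℝ r s = ∅ := by
  apply seg_disj (a := b) (b := a) <;> rw [o_swap] <;> linarith

theorem seg_adj {p q r : Pt} (h : o p q r ≠ 0) : segment ℝ p q ∩ segment ℝ q r = {q} := by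
  apply Set.Subset.antisymm
  · rintro w ⟨⟨s, t, hs, ht, hst, rfl⟩, ⟨s', t', hs', ht', hst', e⟩⟩
    have e1 : o p q (s • p + t • q) = 0 := by rw [o_comb _ _ _ _ _ _ hst, o_self1, o_self2]; ring
    rw [← e, o_comb _ _ _ _ _ _ hst', o_self2] at e1
    have : t' = 0 := by
      have : t' * o p q r = 0 := by linarith
      exact (mul_eq_zero.1 this).resolve_right h
    subst this
    have : s' = 1 := by linarith
    subst this
    rw [← e]; simp
  · rintro w rfl
    exact ⟨right_mem_segment ℝ _ _, left_mem_segment ℝ _ _⟩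

theorem escape {n : ℕ} {v : ZMod n → Pt} {s d : Pt} (hd : d ≠ 0)
    (h : ∀ t : ℝ, 0 ≤ t → s + t • d ∉ polyBoundary n v) : s ∉ polyInterior n v := by
  rintro ⟨_, hb⟩
  set R : Set Pt := (fun t : ℝ => s + t • d) '' Set.Ici 0 with hR
  have hpre : IsPreconnected R := by
    apply IsPreconnected.image (convex_Ici (0:ℝ)).isPreconnected
    fun_prop
  have hs : s ∈ R := ⟨0, by simp, by simp⟩
  have hsub : R ⊆ (polyBoundary n v)ᶜ := by
    rintro _ ⟨t, ht, rfl⟩; exact h t ht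
  have h2 := hb.subset (hpre.subset_connectedComponentIn hs hsub)
  obtain ⟨M, hM⟩ := h2.exists_norm_le
  have hdn : 0 < ‖d‖ := norm_pos_iff.2 hd
  have hM0 : 0 ≤ M := (norm_nonneg _).trans (hM s hs)
  set t : ℝ := (M + ‖s‖ + 1) / ‖d‖ with ht
  have ht0 : 0 ≤ t := by positivity
  have h3 := hM _ ⟨t, ht0, rfl⟩
  have h4 : ‖t • d‖ = M + ‖s‖ + 1 := by
    rw [norm_smul, Real.norm_of_nonneg ht0, ht]; field_simp
  have h5 : ‖t • d‖ ≤ ‖s + t • d‖ + ‖s‖ := by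
    have := norm_sub_le (s + t • d) s
    simpa using this
  simp only at h3
  linarith

theorem area_core {a b c u v w : ℝ} (ha : 0 < a) (hb : 0 < b) (hc : 0 < c)
    (i1 : 0 < (b - u) * (c + v) - c * b) (i2 : 0 < (c - w) * (a + u) - a * c) (i3 : 0 < (a - v) * (b + w) - b * a)
    (p1 : 0 < c + v) (p2 : 0 < a + u) (p3 : 0 < b + w) : False := by
  have j1 : 0 < b * v - u * (c + v) := by
    have e : (b - u) * (c + v) - c * b = b * v - u * (c + v) := by ring
    rwa [e] at i1
  have j2 : 0 < c * u - w * (a + u) := by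
    have e : (c - w) * (a + u) - a * c = c * u - w * (a + u) := by ring
    rwa [e] at i2
  have j3 : 0 < a * w - v * (b + w) := by
    have e : (a - v) * (b + w) - b * a = a * w - v * (b + w) := by ring
    rwa [e] at i3
  have hs : (b * v - u * (c + v)) + (c * u - w * (a + u)) + (a * w - v * (b + w)) = - (u * v + u * w + v * w) := by ring
  rcases le_or_gt 0 u with hu0 | hu0
  · have hv0 : 0 < v := by
      have := mul_nonneg hu0 p1.le
      have : 0 < b * v := by linarith
      exact (mul_pos_iff_of_pos_left hb).1 this
    have hw0 : 0 < w := by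
      have := mul_pos hv0 p3
      have : 0 < a * w := by linarith
      exact (mul_pos_iff_of_pos_left ha).1 this
    have := mul_nonneg hu0 hv0.le
    have := mul_nonneg hu0 hw0.le
    have := mul_pos hv0 hw0
    linarith
  · have hw0 : w < 0 := by
      by_contra hcw
      push Not at hcw
      have := mul_nonneg hcw p2.le
      have := mul_neg_of_pos_of_neg hc hu0
      linarith
    have hv0 : v < 0 := by
      by_contra hcw
      push Not at hcw
      have := mul_nonneg hcw p3.le
      have := mul_neg_of_pos_of_neg ha hw0
      linarith
    have := mul_pos_of_neg_of_neg hu0 hv0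
    have := mul_pos_of_neg_of_neg hu0 hw0
    have := mul_pos_of_neg_of_neg hv0 hw0
    linarith

theorem area_ineq {xa xb xc za zb zc ya yb yc wa wb wc : ℝ}
    (hxa : 0 < xa) (hxb : 0 < xb) (hxc : 0 < xc) (hza : 0 < za) (hzb : 0 < zb) (hzc : 0 < zc)
    (hya : 0 < ya) (hyb : 0 < yb) (hyc : 0 < yc) (hwa : 0 < wa) (hwb : 0 < wb) (hwc : 0 < wc)
    (sx : xa + xb + xc = 1) (sz : za + zb + zc = 1) (sy : ya + yb + yc = 1) (sw : wa + wb + wc = 1)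
    (h1 : 0 < xb * zc - xc * zb) (h2 : 0 < wc * xa - wa * xc) (h3 : 0 < za * yb - zb * ya)
    (h4 : 0 < yc * wa - ya * wc) (h5 : 0 < ya * wb - yb * wa) :
    xc + zb + ya + (yc * wa - ya * wc) < 1 := by
  by_contra hcon
  push Not at hcon
  set δ := yc * wa - ya * wc with hδ
  set a := ya + δ with ha
  have ha0 : 0 < a := by linarith
  have haw : 0 < a - wa := by
    have : a - wa = ya * wb - yb * wa := by
      rw [ha, hδ]
      have e1 : wc = 1 - wa - wb := by linarith
      have e2 : yc = 1 - ya - yb := by linarith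
      rw [e1, e2]; ring
    linarith
  set Yc := a * wc / wa with hYc
  have hYcw : Yc * wa = a * wc := by rw [hYc]; field_simp
  have hYc0 : 0 < Yc := by positivity
  set Yb := 1 - a - Yc with hYb
  -- gamma of Y exceeds that of y
  have k1 : 0 < Yb * ya - yb * a := by
    have e : (Yb * ya - yb * a) * wa = δ * (a - wa) := by
      have e2 : yb = 1 - ya - yc := by linarith
      have : (Yb * ya - yb * a) * wa = ((1 - a) * wa - Yc * wa) * ya - yb * a * wa := by rw [hYb]; ring
      rw [this, hYcw, e2, ha, hδ]
      ring
    have : 0 < (Yb * ya - yb * a) * wa := by rw [e]; exact mul_pos h4 haw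
    exact (mul_pos_iff_of_pos_right hwa).1 this
  have k3 : 0 < za * Yb - zb * a := by
    have : 0 < (za * Yb - zb * a) * ya := by
      have e : (za * Yb - zb * a) * ya = za * (Yb * ya - yb * a) + a * (za * yb - zb * ya) := by ring
      rw [e]; exact add_pos (mul_pos hza k1) (mul_pos ha0 h3)
    exact (mul_pos_iff_of_pos_right hya).1 this
  have k2 : 0 < Yc * xa - a * xc := by
    have : 0 < (Yc * xa - a * xc) * wa := by
      have : (Yc * xa - a * xc) * wa = a * (wc * xa - wa * xc) := by
        have : (Yc * xa - a * xc) * wa = (Yc * wa) * xa - a * xc * wa := by ring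
        rw [this, hYcw]; ring
      rw [this]; exact mul_pos ha0 h2
    exact (mul_pos_iff_of_pos_right hwa).1 this
  have hYb0 : 0 < Yb := by
    have := mul_pos hzb ha0
    have : 0 < za * Yb := by linarith
    exact (mul_pos_iff_of_pos_left hza).1 this
  set b := zb with hb
  set c := xc with hc
  obtain ⟨u, hu⟩ : ∃ u, xb = b - u := ⟨b - xb, by ring⟩
  obtain ⟨v, hv⟩ : ∃ v, za = a - v := ⟨a - za, by ring⟩
  obtain ⟨w, hw⟩ : ∃ w, Yc = c - w := ⟨c - Yc, by ring⟩
  have b1 : xa ≤ a + u := by linarith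
  have b2 : zc ≤ c + v := by linarith
  have b3 : Yb ≤ b + w := by linarith
  have i1 : 0 < (b - u) * (c + v) - c * b := by
    have := mul_le_mul_of_nonneg_left b2 hxb.le
    rw [hu] at this h1; linarith
  have i2 : 0 < (c - w) * (a + u) - a * c := by
    have := mul_le_mul_of_nonneg_left b1 hYc0.le
    rw [hw] at this k2; linarith
  have i3 : 0 < (a - v) * (b + w) - b * a := by
    have := mul_le_mul_of_nonneg_left b3 hza.le
    rw [hv] at this k3; linarith
  exact area_core ha0 hzb hxc i1 i2 i3 (by linarith) (by linarith) (by linarith)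

/-- strictly inside a ccw triangle -/
structure Ins (A B C p : Pt) : Prop where
  c : 0 < o A B p
  a : 0 < o B C p
  b : 0 < o C A p

/-- good tuple, geometric form -/
structure GT (A B C x y1 y2 z : Pt) : Prop where
  D : 0 < o A B C
  ix : Ins A B C x
  i1 : Ins A B C y1
  i2 : Ins A B C y2
  iz : Ins A B C z
  axz : 0 < o A x z
  b1x : 0 < o B y1 x
  b2x : 0 < o B y2 x
  b21 : 0 < o B y2 y1
  cz1 : 0 < o C z y1
  cz2 : 0 < o C z y2
  c21 : 0 < o C y2 y1

theorem o_pluA (A B C p q : Pt) : o A p q * o A B C = o C A p * o A B q - o A B p * o C A q := by unfold o; ring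
theorem o_pluB (A B C p q : Pt) : o B p q * o A B C = o A B p * o B C q - o B C p * o A B q := by unfold o; ring
theorem o_pluC (A B C p q : Pt) : o C p q * o A B C = o B C p * o C A q - o C A p * o B C q := by unfold o; ring

theorem GT.area {A B C x y1 y2 z : Pt} (h : GT A B C x y1 y2 z) :
    o A B x + o C A z + o B C y2 + o B y2 y1 < o A B C := by
  have hD := h.D
  set D := o A B C with hDd
  have key := area_ineq (xa := o B C x / D) (xb := o C A x / D) (xc := o A B x / D)
    (za := o B C z / D) (zb := o C A z / D) (zc := o A B z / D)
    (ya := o B C y2 / D) (yb := o C A y2 / D) (yc := o A B y2 / D)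
    (wa := o B C y1 / D) (wb := o C A y1 / D) (wc := o A B y1 / D)
    (div_pos h.ix.a hD) (div_pos h.ix.b hD) (div_pos h.ix.c hD)
    (div_pos h.iz.a hD) (div_pos h.iz.b hD) (div_pos h.iz.c hD)
    (div_pos h.i2.a hD) (div_pos h.i2.b hD) (div_pos h.i2.c hD)
    (div_pos h.i1.a hD) (div_pos h.i1.b hD) (div_pos h.i1.c hD)
    (by have := o_sum A B C x; field_simp; linarith) (by have := o_sum A B C z; field_simp; linarith)
    (by have := o_sum A B C y2; field_simp; linarith) (by have := o_sum A B C y1; field_simp; linarith)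
    (by have := o_pluA A B C x z; rw [div_mul_div_comm, div_mul_div_comm, ← sub_div]
        apply div_pos _ (mul_pos hD hD); rw [← this]; exact mul_pos h.axz hD)
    (by have := o_pluB A B C y1 x; rw [div_mul_div_comm, div_mul_div_comm, ← sub_div]
        apply div_pos _ (mul_pos hD hD); rw [← this]; exact mul_pos h.b1x hD)
    (by have := o_pluC A B C z y2; rw [div_mul_div_comm, div_mul_div_comm, ← sub_div]
        apply div_pos _ (mul_pos hD hD); rw [← this]; exact mul_pos h.cz2 hD)
    (by have := o_pluB A B C y2 y1; rw [div_mul_div_comm, div_mul_div_comm, ← sub_div]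
        apply div_pos _ (mul_pos hD hD); rw [← this]; exact mul_pos h.b21 hD)
    (by have := o_pluC A B C y2 y1; rw [div_mul_div_comm, div_mul_div_comm, ← sub_div]
        apply div_pos _ (mul_pos hD hD); rw [← this]; exact mul_pos h.c21 hD)
  have e : o A B y2 / D * (o B C y1 / D) - o B C y2 / D * (o A B y1 / D) = o B y2 y1 / D := by
    rw [div_mul_div_comm, div_mul_div_comm, ← sub_div, ← o_pluB A B C y2 y1]
    rw [← hDd]; field_simp
  rw [e, ← add_div, ← add_div, ← add_div, div_lt_one hD] at key
  exact key

end PT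
namespace PT

theorem pr {a b c : Pt} (h : 0 < o a b c) : 0 < o b c a := by rw [o_rot]; exact h
theorem pr2 {a b c : Pt} (h : 0 < o a b c) : 0 < o c a b := by rw [o_rot2]; exact h
theorem ns {a b c : Pt} (h : 0 < o a b c) : o b a c < 0 := by rw [o_swap]; linarith
theorem ns' {a b c : Pt} (h : 0 < o a b c) : o a c b < 0 := by rw [o_swap']; linarith
theorem ns3 {a b c : Pt} (h : 0 < o a b c) : o c b a < 0 := ns (pr h)
theorem z1 (a b : Pt) : o a b a ≤ 0 := (o_self1 a b).le
theorem z2 (a b : Pt) : o a b b ≤ 0 := (o_self2 a b).le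

theorem forall7 {P : ZMod 7 → Prop} (h0 : P 0) (h1 : P 1) (h2 : P 2) (h3 : P 3) (h4 : P 4) (h5 : P 5) (h6 : P 6) :
    ∀ i, P i := by
  intro i
  fin_cases i
  exacts [h0, h1, h2, h3, h4, h5, h6]

/-- the seven vertices -/
def pv (A x B y1 y2 C z : Pt) : ZMod 7 → Pt := fun i => (![A, x, B, y1, y2, C, z] : Fin 7 → Pt) i

theorem cross_o (a b c : Pt) : cross2 (b - a) (c - b) = o a b c := by
  simp only [cross2, o, Prod.fst_sub, Prod.snd_sub]; ring

theorem ne_of_o1 {a b c : Pt} (h : 0 < o a b c) : a ≠ b := by rintro rfl; rw [o_self3] at h; exact lt_irrefl _ h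
theorem ne_of_o2 {a b c : Pt} (h : 0 < o a b c) : b ≠ c := ne_of_o1 (pr h)
theorem ne_of_o3 {a b c : Pt} (h : 0 < o a b c) : a ≠ c := (ne_of_o1 (pr2 h)).symm

theorem GT.simple {A B C x y1 y2 z : Pt} (h : GT A B C x y1 y2 z) :
    IsSimplePolygon 7 (pv A x B y1 y2 C z) := by
  obtain ⟨D, ⟨xc, xa, xb⟩, ⟨c1, a1, b1⟩, ⟨c2, a2, b2⟩, ⟨zc, za, zb⟩, axz, b1x, b2x, b21, cz1, cz2, c21⟩ := h
  have nAx := ne_of_o3 (pr xc)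
  refine ⟨by norm_num, ?_, ?_, ?_⟩
  · have e : Function.Injective (![A, x, B, y1, y2, C, z] : Fin 7 → Pt) := by
      have h1 : A ≠ x := ne_of_o3 xc
      have h2 : A ≠ B := ne_of_o1 xc
      have h3 : A ≠ y1 := ne_of_o3 c1
      have h4 : A ≠ y2 := ne_of_o3 c2
      have h5 : A ≠ C := (ne_of_o1 xb).symm
      have h6 : A ≠ z := ne_of_o3 zc
      have h7 : x ≠ B := (ne_of_o2 xc).symm
      have h8 : x ≠ y1 := (ne_of_o2 b1x).symm
      have h9 : x ≠ y2 := (ne_of_o2 b2x).symm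
      have h10 : x ≠ C := (ne_of_o2 xa).symm
      have h11 : x ≠ z := ne_of_o2 axz
      have h12 : B ≠ y1 := ne_of_o2 c1
      have h13 : B ≠ y2 := ne_of_o2 c2
      have h14 : B ≠ C := ne_of_o1 xa
      have h15 : B ≠ z := ne_of_o2 zc
      have h16 : y1 ≠ y2 := (ne_of_o2 b21).symm
      have h17 : y1 ≠ C := (ne_of_o2 a1).symm
      have h18 : y1 ≠ z := (ne_of_o2 cz1).symm
      have h19 : y2 ≠ C := (ne_of_o2 a2).symm
      have h20 : y2 ≠ z := (ne_of_o2 cz2).symm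
      have h21 : C ≠ z := ne_of_o2 za
      rw [← List.nodup_ofFn]
      simp [*]
    exact e
  · have d02 : segment ℝ A x ∩ segment ℝ B y1 = ∅ := seg_disj (a := B) (b := y1) (pr c1) b1x (z1 _ _) (z2 _ _)
    have d03 : segment ℝ A x ∩ segment ℝ y1 y2 = ∅ := seg_disj (a := B) (b := y1) (pr c1) b1x (z2 _ _) (ns' b21).le
    have d04 : segment ℝ A x ∩ segment ℝ y2 C = ∅ := seg_disj (a := B) (b := y2) (pr c2) b2x (z2 _ _) (ns' a2).le
    have d05 : segment ℝ C z ∩ segment ℝ A x = ∅ := seg_disj (a := A) (b := x) (pr xb) axz (z1 _ _) (z2 _ _)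
    have d13 : segment ℝ y1 y2 ∩ segment ℝ x B = ∅ :=
      seg_disj (a := x) (b := B) (pr2 b1x) (pr2 b2x) (z1 _ _) (z2 _ _)
    have d14 : segment ℝ y2 C ∩ segment ℝ x B = ∅ :=
      seg_disj (a := x) (b := B) (pr2 b2x) (pr2 xa) (z1 _ _) (z2 _ _)
    have d15 : segment ℝ C z ∩ segment ℝ x B = ∅ := seg_disj (a := A) (b := x) (pr xb) axz (z2 _ _) (ns' xc).le
    have d16 : segment ℝ x B ∩ segment ℝ z A = ∅ := seg_disj (a := z) (b := A) (pr2 axz) (pr2 zc) (z1 _ _) (z2 _ _)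
    have d24 : segment ℝ y2 C ∩ segment ℝ B y1 = ∅ := seg_disj (a := y1) (b := B) (pr2 b21) (pr2 a1) (z2 _ _) (z1 _ _)
    have d25 : segment ℝ B y1 ∩ segment ℝ C z = ∅ := seg_disj (a := C) (b := z) (pr za) cz1 (z1 _ _) (z2 _ _)
    have d26 : segment ℝ B y1 ∩ segment ℝ z A = ∅ := seg_disj (a := C) (b := z) (pr za) cz1 (z2 _ _) (ns' zb).le
    have d35 : segment ℝ y1 y2 ∩ segment ℝ C z = ∅ := seg_disj (a := C) (b := z) cz1 cz2 (z1 _ _) (z2 _ _)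
    have d36 : segment ℝ y1 y2 ∩ segment ℝ z A = ∅ := seg_disj (a := C) (b := z) cz1 cz2 (z2 _ _) (ns' zb).le
    have d46 : segment ℝ z A ∩ segment ℝ y2 C = ∅ := seg_disj (a := y2) (b := C) (pr2 cz2) (pr2 b2) (z1 _ _) (z2 _ _)
    have sy : ∀ {s t : Set Pt}, s ∩ t = ∅ → t ∩ s = ∅ := fun h => by rwa [Set.inter_comm]
    apply forall7
    · exact forall7 (fun h => absurd rfl h) (fun _ _ h => absurd rfl h) (fun _ _ _ => d02) (fun _ _ _ => d03)
        (fun _ _ _ => d04) (fun _ _ _ => sy d05) (fun _ h => absurd rfl h)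
    · exact forall7 (fun _ h => absurd rfl h) (fun h => absurd rfl h) (fun _ _ h => absurd rfl h) (fun _ _ _ => sy d13)
        (fun _ _ _ => sy d14) (fun _ _ _ => sy d15) (fun _ _ _ => d16)
    · exact forall7 (fun _ _ _ => sy d02) (fun _ h => absurd rfl h) (fun h => absurd rfl h) (fun _ _ h => absurd rfl h)
        (fun _ _ _ => sy d24) (fun _ _ _ => d25) (fun _ _ _ => d26)
    · exact forall7 (fun _ _ _ => sy d03) (fun _ _ _ => d13) (fun _ h => absurd rfl h) (fun h => absurd rfl h)
        (fun _ _ h => absurd rfl h) (fun _ _ _ => d35) (fun _ _ _ => d36)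
    · exact forall7 (fun _ _ _ => sy d04) (fun _ _ _ => d14) (fun _ _ _ => d24) (fun _ h => absurd rfl h)
        (fun h => absurd rfl h) (fun _ _ h => absurd rfl h) (fun _ _ _ => sy d46)
    · exact forall7 (fun _ _ _ => d05) (fun _ _ _ => d15) (fun _ _ _ => sy d25) (fun _ _ _ => sy d35)
        (fun _ h => absurd rfl h) (fun h => absurd rfl h) (fun _ _ h => absurd rfl h)
    · exact forall7 (fun _ _ h => absurd rfl h) (fun _ _ _ => sy d16) (fun _ _ _ => sy d26) (fun _ _ _ => sy d36)
        (fun _ _ _ => d46) (fun _ h => absurd rfl h) (fun h => absurd rfl h)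
  · apply forall7
    · exact seg_adj (p := A) (q := x) (r := B) (ns' xc).ne
    · exact seg_adj (p := x) (q := B) (r := y1) (pr2 b1x).ne'
    · exact seg_adj (p := B) (q := y1) (r := y2) (ns' b21).ne
    · exact seg_adj (p := y1) (q := y2) (r := C) (ns3 c21).ne
    · exact seg_adj (p := y2) (q := C) (r := z) (pr2 cz2).ne'
    · exact seg_adj (p := C) (q := z) (r := A) (ns' zb).ne
    · exact seg_adj (p := z) (q := A) (r := x) (pr2 axz).ne'

theorem GT.sarea {A B C x y1 y2 z : Pt} (h : GT A B C x y1 y2 z) : 0 < signedArea 7 (pv A x B y1 y2 C z) := by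
  have e : signedArea 7 (pv A x B y1 y2 C z) = o A B C - (o A B x + o C A z + o B C y2 + o B y2 y1) := by
    unfold signedArea
    rw [dif_neg (by norm_num)]
    have : (∑ i : ZMod 7, cross2 (pv A x B y1 y2 C z i) (pv A x B y1 y2 C z (i + 1))) =
      cross2 A x + cross2 x B + cross2 B y1 + cross2 y1 y2 + cross2 y2 C + cross2 C z + cross2 z A :=
      Fin.sum_univ_seven (fun i : ZMod 7 => cross2 (pv A x B y1 y2 C z i) (pv A x B y1 y2 C z (i + 1)) : Fin 7 → ℝ)
    refine Eq.trans ?_ (this.trans ?_)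
    · congr!
    · simp only [cross2, o]; ring
  rw [e]
  have := h.area
  linarith

theorem GT.pseudo {A B C x y1 y2 z : Pt} (h : GT A B C x y1 y2 z) :
    IsPseudoTriangle 7 (pv A x B y1 y2 C z) := by
  have hs := h.sarea
  refine ⟨h.simple, ?_⟩
  obtain ⟨D, ⟨xc, xa, xb⟩, ⟨c1, a1, b1⟩, ⟨c2, a2, b2⟩, ⟨zc, za, zb⟩, axz, b1x, b2x, b21, cz1, cz2, c21⟩ := h
  set v := pv A x B y1 y2 C z with hv
  have t0 : 0 < vtxCross 7 v 0 := (pr2 axz).trans_eq (cross_o z A x).symm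
  have t1 : vtxCross 7 v 1 < 0 := (cross_o A x B).trans_lt (ns' xc)
  have t2 : 0 < vtxCross 7 v 2 := (pr2 b1x).trans_eq (cross_o x B y1).symm
  have t3 : vtxCross 7 v 3 < 0 := (cross_o B y1 y2).trans_lt (ns' b21)
  have t4 : vtxCross 7 v 4 < 0 := (cross_o y1 y2 C).trans_lt (ns3 c21)
  have t5 : 0 < vtxCross 7 v 5 := (pr2 cz2).trans_eq (cross_o y2 C z).symm
  have t6 : vtxCross 7 v 6 < 0 := (cross_o C z A).trans_lt (ns' zb)
  have neg : ∀ i, vtxCross 7 v i < 0 → ¬ IsConvexVtx 7 v i := fun i hi hc =>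
    absurd (mul_neg_of_neg_of_pos hi hs) (not_lt.2 (le_of_lt hc))
  refine ⟨forall7 t0.ne' t1.ne t2.ne' t3.ne t4.ne t5.ne' t6.ne, ?_⟩
  have : {i : ZMod 7 | IsConvexVtx 7 v i} = (({0, 2, 5} : Finset (ZMod 7)) : Set (ZMod 7)) := by
    ext i
    revert i
    have pos : ∀ i, 0 < vtxCross 7 v i → i ∈ ({0, 2, 5} : Finset (ZMod 7)) →
        (i ∈ {i : ZMod 7 | IsConvexVtx 7 v i} ↔ i ∈ (({0, 2, 5} : Finset (ZMod 7)) : Set (ZMod 7))) :=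
      fun i hi hm => ⟨fun _ => hm, fun _ => mul_pos hi hs⟩
    have neg : ∀ i, vtxCross 7 v i < 0 → i ∉ ({0, 2, 5} : Finset (ZMod 7)) →
        (i ∈ {i : ZMod 7 | IsConvexVtx 7 v i} ↔ i ∈ (({0, 2, 5} : Finset (ZMod 7)) : Set (ZMod 7))) :=
      fun i hi hm => ⟨fun h => absurd h (neg i hi), fun h => absurd h hm⟩
    exact forall7 (pos 0 t0 (by decide)) (neg 1 t1 (by decide)) (pos 2 t2 (by decide)) (neg 3 t3 (by decide))
      (neg 4 t4 (by decide)) (pos 5 t5 (by decide)) (neg 6 t6 (by decide))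
  rw [this, Set.ncard_coe_finset]
  decide

theorem esc_cone {v : ZMod 7 → Pt} {a1 b1 a2 b2 x q : Pt} (e1 : o a1 b1 x = 0) (e2 : o a2 b2 x = 0)
    (h1 : 0 < o a1 b1 q) (h2 : 0 < o a2 b2 q)
    (h : ∀ i, (o a1 b1 (v i) ≤ 0 ∧ o a1 b1 (v (i + 1)) ≤ 0) ∨ (o a2 b2 (v i) ≤ 0 ∧ o a2 b2 (v (i + 1)) ≤ 0)) :
    q ∉ polyInterior 7 v := by
  have hd : q - x ≠ 0 := by
    intro e
    rw [sub_eq_zero.1 e, e1] at h1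
    exact lt_irrefl _ h1
  apply escape hd
  intro t ht hm
  have key : ∀ a b, o a b x = 0 → 0 < o a b q → 0 < o a b (q + t • (q - x)) := by
    intro a b e hq
    have : o a b (q + t • (q - x)) = (1 + t) * o a b q - t * o a b x := by
      simp only [o, Prod.fst_add, Prod.snd_add, Prod.smul_fst, Prod.smul_snd, smul_eq_mul, Prod.fst_sub, Prod.snd_sub]
      ring
    rw [this, e]
    have := mul_pos (by linarith : 0 < 1 + t) hq
    linarith
  obtain ⟨i, hi⟩ := Set.mem_iUnion.1 hm
  rcases h i with ⟨k1, k2⟩ | ⟨k1, k2⟩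
  · exact notMem_seg k1 k2 (key _ _ e1 h1) hi
  · exact notMem_seg k1 k2 (key _ _ e2 h2) hi

theorem esc_out {v : ZMod 7 → Pt} {a b q : Pt} (h1 : 0 < o a b q) (h : ∀ i, o a b (v i) ≤ 0) :
    q ∉ polyInterior 7 v := by
  have hd : b - a ≠ 0 := sub_ne_zero.2 (ne_of_o1 h1).symm
  apply escape hd
  intro t ht hm
  obtain ⟨i, hi⟩ := Set.mem_iUnion.1 hm
  refine notMem_seg (h i) (h (i + 1)) ?_ hi
  have : o a b (q + t • (b - a)) = o a b q := by
    simp only [o, Prod.fst_add, Prod.snd_add, Prod.smul_fst, Prod.smul_snd, smul_eq_mul, Prod.fst_sub, Prod.snd_sub]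
    ring
  rwa [this]

theorem esc_vtx {v : ZMod 7 → Pt} (i : ZMod 7) : v i ∉ polyInterior 7 v := fun h =>
  h.1 (Set.mem_iUnion.2 ⟨i, left_mem_segment ℝ _ _⟩)

theorem genpos_o {S : Set Pt} (hg : GenPos S) {p q r : Pt} (hp : p ∈ S) (hq : q ∈ S) (hr : r ∈ S)
    (h1 : p ≠ q) (h2 : p ≠ r) (h3 : q ≠ r) : o p q r ≠ 0 := by
  intro e
  apply hg p hp q hq r hr h1 h2 h3
  rw [collinear_iff_of_mem (p₀ := p) (by simp)]
  refine ⟨q - p, ?_⟩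
  intro w hw
  have hw' : w = p ∨ w = q ∨ w = r := by simpa using hw
  rcases hw' with rfl | rfl | rfl
  · exact ⟨0, by simp⟩
  · exact ⟨1, by simp⟩
  · by_cases hx : q.1 - p.1 = 0
    · have hy : q.2 - p.2 ≠ 0 := by
        intro hy
        exact h1 (Prod.ext (by linarith) (by linarith))
      refine ⟨(w.2 - p.2) / (q.2 - p.2), ?_⟩
      unfold o at e
      rw [hx] at e
      have e' : (q.2 - p.2) * (w.1 - p.1) = 0 := by linarith
      have e'' := (mul_eq_zero.1 e').resolve_left hy
      ext
      · simp [hx]; linarith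
      · simp; field_simp; ring
    · refine ⟨(w.1 - p.1) / (q.1 - p.1), ?_⟩
      unfold o at e
      ext
      · simp; field_simp; ring
      · simp; field_simp; linarith

theorem GT.main {S : Set Pt} (hg : GenPos S) {A B C x y1 y2 z : Pt} (h : GT A B C x y1 y2 z)
    (hA : A ∈ S) (hB : B ∈ S) (hC : C ∈ S) (hx : x ∈ S) (hy1 : y1 ∈ S) (hy2 : y2 ∈ S) (hz : z ∈ S)
    (cov : ∀ q ∈ S, Ins A B C q → (q = x ∨ q = y1 ∨ q = y2 ∨ q = z) ∨ (0 < o B x q ∧ 0 < o x A q) ∨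
      (0 < o A z q ∧ 0 < o z C q) ∨ (0 < o C y1 q ∧ 0 < o y1 B q) ∨ (0 < o C y2 q ∧ 0 < o y2 B q)) :
    HasEmptyPseudoTriangle 7 S := by
  refine ⟨pv A x B y1 y2 C z, ?_, h.pseudo, ?_⟩
  · rintro _ ⟨i, rfl⟩
    revert i
    exact forall7 hA hx hB hy1 hy2 hC hz
  obtain ⟨D, ⟨xc, xa, xb⟩, ⟨c1, a1, b1⟩, ⟨c2, a2, b2⟩, ⟨zc, za, zb⟩, axz, b1x, b2x, b21, cz1, cz2, c21⟩ := h
  set v := pv A x B y1 y2 C z with hv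
  unfold EmptyIn
  rw [Set.eq_empty_iff_forall_notMem]
  rintro q ⟨hq, hqS⟩
  revert hq
  have vt : ∀ i, q = v i → q ∉ polyInterior 7 v := fun i e => e ▸ esc_vtx i
  by_cases qA : q = A
  · exact vt 0 qA
  by_cases qB : q = B
  · exact vt 2 qB
  by_cases qC : q = C
  · exact vt 5 qC
  have nAB := ne_of_o1 D
  have nBC := ne_of_o2 D
  have nAC := ne_of_o3 D
  rcases lt_or_gt_of_ne (genpos_o hg hA hB hqS nAB (Ne.symm qA) (Ne.symm qB)) with hc | hc
  · apply esc_out (a := B) (b := A) (by rw [o_swap]; linarith)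
    exact forall7 (z2 _ _) (ns xc).le (z1 _ _) (ns c1).le (ns c2).le (ns D).le (ns zc).le
  rcases lt_or_gt_of_ne (genpos_o hg hB hC hqS nBC (Ne.symm qB) (Ne.symm qC)) with ha | ha
  · apply esc_out (a := C) (b := B) (by rw [o_swap]; linarith)
    exact forall7 (ns3 D).le (ns xa).le (z2 _ _) (ns a1).le (ns a2).le (z1 _ _) (ns za).le
  rcases lt_or_gt_of_ne (genpos_o hg hC hA hqS nAC.symm (Ne.symm qC) (Ne.symm qA)) with hb | hb
  · apply esc_out (a := A) (b := C) (by rw [o_swap]; linarith)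
    exact forall7 (z1 _ _) (ns xb).le (ns' D).le (ns b1).le (ns b2).le (z2 _ _) (ns zb).le
  rcases cov q hqS ⟨hc, ha, hb⟩ with hq | hq | hq | hq | hq
  · rcases hq with hq | hq | hq | hq
    exacts [vt 1 hq, vt 3 hq, vt 4 hq, vt 6 hq]
  · exact esc_cone (a1 := x) (b1 := A) (a2 := B) (b2 := x) (o_self1 _ _) (o_self2 _ _) hq.2 hq.1
      (forall7 (.inl ⟨z2 _ _, z1 _ _⟩) (.inr ⟨z2 _ _, z1 _ _⟩) (.inr ⟨z1 _ _, (ns' b1x).le⟩)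
        (.inr ⟨(ns' b1x).le, (ns' b2x).le⟩) (.inr ⟨(ns' b2x).le, (ns' xa).le⟩)
        (.inl ⟨(ns3 xb).le, (ns axz).le⟩) (.inl ⟨(ns axz).le, z2 _ _⟩))
  · exact esc_cone (a1 := A) (b1 := z) (a2 := z) (b2 := C) (o_self2 _ _) (o_self1 _ _) hq.1 hq.2
      (forall7 (.inl ⟨z1 _ _, (ns' axz).le⟩) (.inl ⟨(ns' axz).le, (ns' zc).le⟩) (.inr ⟨(ns3 za).le, (ns cz1).le⟩)
        (.inr ⟨(ns cz1).le, (ns cz2).le⟩) (.inr ⟨(ns cz2).le, z2 _ _⟩)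
        (.inr ⟨z2 _ _, z1 _ _⟩) (.inl ⟨z2 _ _, z1 _ _⟩))
  · exact esc_cone (a1 := y1) (b1 := B) (a2 := C) (b2 := y1) (o_self1 _ _) (o_self2 _ _) hq.2 hq.1
      (forall7 (.inl ⟨(ns3 c1).le, (ns b1x).le⟩) (.inl ⟨(ns b1x).le, z2 _ _⟩) (.inl ⟨z2 _ _, z1 _ _⟩)
        (.inr ⟨z2 _ _, (ns' c21).le⟩) (.inr ⟨(ns' c21).le, z1 _ _⟩)
        (.inr ⟨z1 _ _, (ns' cz1).le⟩) (.inr ⟨(ns' cz1).le, (ns' b1).le⟩))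
  · exact esc_cone (a1 := y2) (b1 := B) (a2 := C) (b2 := y2) (o_self1 _ _) (o_self2 _ _) hq.2 hq.1
      (forall7 (.inl ⟨(ns3 c2).le, (ns b2x).le⟩) (.inl ⟨(ns b2x).le, z2 _ _⟩) (.inl ⟨z2 _ _, (ns b21).le⟩)
        (.inl ⟨(ns b21).le, z1 _ _⟩) (.inr ⟨z2 _ _, z1 _ _⟩)
        (.inr ⟨z1 _ _, (ns' cz2).le⟩) (.inr ⟨(ns' cz2).le, (ns' b2).le⟩))

end PT
namespace PT

/-- `q` lies in the cone at `p` spanned towards the side `A B` -/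
def K (A B p q : Pt) : Prop := 0 < o B p q ∧ 0 < o p A q

theorem Ins.rot {A B C p : Pt} (h : Ins A B C p) : Ins B C A p := ⟨h.a, h.b, h.c⟩

theorem o_bary (A B C p q : Pt) : o B C p * o A p q + o C A p * o B p q + o A B p * o C p q = 0 := by
  unfold o; ring

theorem sign_pos {A B C p q : Pt} (hp : Ins A B C p)
    (hA : o A p q ≠ 0) (hB : o B p q ≠ 0) (hC : o C p q ≠ 0) (h1 : ¬ K C A q p) (h2 : ¬ K A B p q) : 0 < o A p q := by
  by_contra h
  have hA' : o A p q < 0 := lt_of_le_of_ne (not_lt.1 h) hA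
  have e1 : 0 < o A q p := by rw [o_swap']; linarith
  have e2 : 0 < o p A q := by rw [o_swap]; linarith
  have hB' : o B p q < 0 := lt_of_le_of_ne (not_lt.1 fun hb => h2 ⟨hb, e2⟩) hB
  have hC' : o C p q < 0 := lt_of_le_of_ne (not_lt.1 fun hb => h1 ⟨e1, pr2 hb⟩) hC
  have := o_bary A B C p q
  have := mul_neg_of_pos_of_neg hp.a hA'
  have := mul_neg_of_pos_of_neg hp.b hB'
  have := mul_neg_of_pos_of_neg hp.c hC'
  linarith

theorem Ins.neA {A B C p : Pt} (h : Ins A B C p) : A ≠ p := ne_of_o3 h.c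

theorem goodG {S : Set Pt} (hg : GenPos S) {A B C x y1 y2 z : Pt} (hD : 0 < o A B C)
    (hA : A ∈ S) (hB : B ∈ S) (hC : C ∈ S) (hx : x ∈ S) (hy1 : y1 ∈ S) (hy2 : y2 ∈ S) (hz : z ∈ S)
    (ix : Ins A B C x) (i1 : Ins A B C y1) (i2 : Ins A B C y2) (iz : Ins A B C z)
    (xz : x ≠ z) (xy1 : x ≠ y1) (xy2 : x ≠ y2) (zy1 : z ≠ y1) (zy2 : z ≠ y2) (yy : y1 ≠ y2)
    (cov : ∀ q ∈ S, Ins A B C q → ((K A B x q ∨ K C A z q ∨ K B C y1 q ∨ K B C y2 q) ↔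
      (q ≠ x ∧ q ≠ z ∧ q ≠ y1 ∧ q ≠ y2))) :
    HasEmptyPseudoTriangle 7 S := by
  have nx : ¬ (K A B x x ∨ K C A z x ∨ K B C y1 x ∨ K B C y2 x) := fun h => ((cov x hx ix).1 h).1 rfl
  have nz : ¬ (K A B x z ∨ K C A z z ∨ K B C y1 z ∨ K B C y2 z) := fun h => ((cov z hz iz).1 h).2.1 rfl
  have n1 : ¬ (K A B x y1 ∨ K C A z y1 ∨ K B C y1 y1 ∨ K B C y2 y1) := fun h => ((cov y1 hy1 i1).1 h).2.2.1 rfl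
  have n2 : ¬ (K A B x y2 ∨ K C A z y2 ∨ K B C y1 y2 ∨ K B C y2 y2) := fun h => ((cov y2 hy2 i2).1 h).2.2.2 rfl
  push Not at nx nz n1 n2
  have gp : ∀ {P p q : Pt}, P ∈ S → p ∈ S → q ∈ S → P ≠ p → P ≠ q → p ≠ q → o P p q ≠ 0 :=
    fun a b c d e f => genpos_o hg a b c d e f
  have oA : ∀ {p q}, p ∈ S → q ∈ S → Ins A B C p → Ins A B C q → p ≠ q → o A p q ≠ 0 :=
    fun hp hq ip iq hn => gp hA hp hq ip.neA iq.neA hn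
  have oB : ∀ {p q}, p ∈ S → q ∈ S → Ins A B C p → Ins A B C q → p ≠ q → o B p q ≠ 0 :=
    fun hp hq ip iq hn => gp hB hp hq ip.rot.neA iq.rot.neA hn
  have oC : ∀ {p q}, p ∈ S → q ∈ S → Ins A B C p → Ins A B C q → p ≠ q → o C p q ≠ 0 :=
    fun hp hq ip iq hn => gp hC hp hq ip.rot.rot.neA iq.rot.rot.neA hn
  have axz : 0 < o A x z := sign_pos ix (oA hx hz ix iz xz) (oB hx hz ix iz xz) (oC hx hz ix iz xz) nx.2.1 nz.1
  have b1x : 0 < o B y1 x := sign_pos i1.rot (oB hy1 hx i1 ix xy1.symm) (oC hy1 hx i1 ix xy1.symm)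
    (oA hy1 hx i1 ix xy1.symm) n1.1 nx.2.2.1
  have b2x : 0 < o B y2 x := sign_pos i2.rot (oB hy2 hx i2 ix xy2.symm) (oC hy2 hx i2 ix xy2.symm)
    (oA hy2 hx i2 ix xy2.symm) n2.1 nx.2.2.2
  have cz1 : 0 < o C z y1 := sign_pos iz.rot.rot (oC hz hy1 iz i1 zy1) (oA hz hy1 iz i1 zy1)
    (oB hz hy1 iz i1 zy1) nz.2.2.1 n1.2.1
  have cz2 : 0 < o C z y2 := sign_pos iz.rot.rot (oC hz hy2 iz i2 zy2) (oA hz hy2 iz i2 zy2)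
    (oB hz hy2 iz i2 zy2) nz.2.2.2 n2.2.1
  have dec : ∀ q ∈ S, Ins A B C q → (q = x ∨ q = y1 ∨ q = y2 ∨ q = z) ∨ K A B x q ∨ K C A z q ∨ K B C y1 q ∨ K B C y2 q := by
    intro q hq iq
    by_cases h : q = x ∨ q = y1 ∨ q = y2 ∨ q = z
    · exact .inl h
    · push Not at h
      exact .inr ((cov q hq iq).2 ⟨h.1, h.2.2.2, h.2.1, h.2.2.1⟩)
  rcases lt_or_gt_of_ne (oB hy2 hy1 i2 i1 yy.symm) with hb | hb
  · have hc : o C y2 y1 < 0 := by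
      refine lt_of_le_of_ne (not_lt.1 fun h => ?_) (oC hy2 hy1 i2 i1 yy.symm)
      exact n1.2.2.2 ⟨h, by rw [o_swap]; linarith⟩
    refine GT.main hg (A := A) (B := B) (C := C) (x := x) (y1 := y2) (y2 := y1) (z := z)
      ⟨hD, ix, i2, i1, iz, axz, b2x, b1x, by rw [o_swap']; linarith, cz2, cz1, by rw [o_swap']; linarith⟩
      hA hB hC hx hy2 hy1 hz ?_
    intro q hq iq
    rcases dec q hq iq with (h | h | h | h) | h | h | h | h
    exacts [.inl (.inl h), .inl (.inr (.inr (.inl h))), .inl (.inr (.inl h)), .inl (.inr (.inr (.inr h))), .inr (.inl h),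
      .inr (.inr (.inl h)), .inr (.inr (.inr (.inr h))), .inr (.inr (.inr (.inl h)))]
  · have hc : 0 < o C y2 y1 := by
      by_contra h
      have h' : o C y2 y1 < 0 := lt_of_le_of_ne (not_lt.1 h) (oC hy2 hy1 i2 i1 yy.symm)
      exact n2.2.2.1 ⟨by rw [o_swap']; linarith, by rw [← o_rot2, ← o_rot2]; exact hb⟩
    exact GT.main hg ⟨hD, ix, i1, i2, iz, axz, b1x, b2x, hb, cz1, cz2, hc⟩ hA hB hC hx hy1 hy2 hz dec

theorem ins_sub {A B C p q : Pt} (hD : 0 < o A B C) (hp : Ins A B C p) (hq : Ins A B p q) : Ins A B C q := by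
  obtain ⟨pc, pa, pb⟩ := hp
  obtain ⟨qc, qa, qb⟩ := hq
  refine ⟨qc, ?_, ?_⟩
  · have e : o B C q * o A B p = o B p q * o A B C + o A B q * o B C p := by unfold o; ring
    have : 0 < o B C q * o A B p := by rw [e]; exact add_pos (mul_pos qa hD) (mul_pos qc pa)
    exact (mul_pos_iff_of_pos_right pc).1 this
  · have e : o C A q * o A B p = o p A q * o A B C + o A B q * o C A p := by unfold o; ring
    have : 0 < o C A q * o A B p := by rw [e]; exact add_pos (mul_pos qb hD) (mul_pos qc pb)
    exact (mul_pos_iff_of_pos_right pc).1 this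

theorem patG' {S : Set Pt} (hg : GenPos S) {A B p y1 y2 x z : Pt} (hD : 0 < o A B p)
    (hA : A ∈ S) (hB : B ∈ S) (hp : p ∈ S) (hx : x ∈ S) (hy1 : y1 ∈ S) (hy2 : y2 ∈ S) (hz : z ∈ S)
    (ix : Ins A B p x) (i1 : Ins A B p y1) (i2 : Ins A B p y2) (iz : Ins A B p z)
    (pxz : 0 < o p x z) (a21 : 0 < o A y2 y1) (b21 : 0 < o B y2 y1)
    (x1 : K A B x y1) (x2 : K A B x y2) (w1 : K A B z y1) (w2 : K A B z y2)
    (cov : ∀ q ∈ S, Ins A B p q → (q = x ∨ q = y1 ∨ q = y2 ∨ q = z)) :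
    HasEmptyPseudoTriangle 7 S := by
  refine GT.main hg (A := p) (B := A) (C := B) (x := x) (y1 := y1) (y2 := y2) (z := z)
    ⟨pr2 hD, ix.rot.rot, i1.rot.rot, i2.rot.rot, iz.rot.rot, pxz, pr x1.2, pr x2.2, a21, w1.1, w2.1, b21⟩
    hp hA hB hx hy1 hy2 hz ?_
  intro q hq iq
  exact .inl (cov q hq iq.rot)

theorem patG {S : Set Pt} (hg : GenPos S) {A B p y1 y2 x z : Pt} (hD : 0 < o A B p)
    (hA : A ∈ S) (hB : B ∈ S) (hp : p ∈ S) (hx : x ∈ S) (hy1 : y1 ∈ S) (hy2 : y2 ∈ S) (hz : z ∈ S)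
    (ix : Ins A B p x) (i1 : Ins A B p y1) (i2 : Ins A B p y2) (iz : Ins A B p z)
    (xz : x ≠ z) (yy : y1 ≠ y2) (n12 : ¬ K A B y1 y2) (n21 : ¬ K A B y2 y1)
    (x1 : K A B x y1) (x2 : K A B x y2) (w1 : K A B z y1) (w2 : K A B z y2)
    (cov : ∀ q ∈ S, Ins A B p q → (q = x ∨ q = y1 ∨ q = y2 ∨ q = z)) :
    HasEmptyPseudoTriangle 7 S := by
  wlog pxz : 0 < o p x z generalizing x z
  · have hne := genpos_o hg hp hx hz ix.rot.rot.neA iz.rot.rot.neA xz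
    refine this hz hx iz ix xz.symm w1 w2 x1 x2 (fun q hq iq => ?_) (by rw [o_swap']; linarith [lt_of_le_of_ne (not_lt.1 pxz) hne])
    rcases cov q hq iq with h | h | h | h
    exacts [.inr (.inr (.inr h)), .inr (.inl h), .inr (.inr (.inl h)), .inl h]
  have hAy := genpos_o hg hA hy2 hy1 i2.neA i1.neA yy.symm
  have hBy := genpos_o hg hB hy2 hy1 i2.rot.neA i1.rot.neA yy.symm
  rcases lt_or_gt_of_ne hAy with ha | ha
  · have hb : o B y2 y1 < 0 := by
      refine lt_of_le_of_ne (not_lt.1 fun h => ?_) hBy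
      exact n21 ⟨h, by rw [o_swap]; linarith⟩
    refine patG' hg hD hA hB hp hx hy2 hy1 hz ix i2 i1 iz pxz (by rw [o_swap']; linarith) (by rw [o_swap']; linarith)
      x2 x1 w2 w1 (fun q hq iq => ?_)
    rcases cov q hq iq with h | h | h | h
    exacts [.inl h, .inr (.inr (.inl h)), .inr (.inl h), .inr (.inr (.inr h))]
  · have hb : 0 < o B y2 y1 := by
      by_contra h
      have h' : o B y2 y1 < 0 := lt_of_le_of_ne (not_lt.1 h) hBy
      exact n12 ⟨by rw [o_swap']; linarith, by rw [← o_rot2, ← o_rot2]; exact ha⟩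
    exact patG' hg hD hA hB hp hx hy1 hy2 hz ix i1 i2 iz pxz ha hb x1 x2 w1 w2 cov

end PT
namespace PT

/-- interior points of `S` in the triangle -/
def IP (S : Set Pt) (A B C : Pt) : Set Pt := {q | q ∈ S ∧ Ins A B C q}

theorem IP.rot (S : Set Pt) (A B C : Pt) : IP S B C A = IP S A B C := by
  ext q
  exact ⟨fun h => ⟨h.1, h.2.rot.rot⟩, fun h => ⟨h.1, h.2.rot⟩⟩

theorem IP.lt {S : Set Pt} (hfin : S.Finite) {A B C p : Pt} (hD : 0 < o A B C) (hp : p ∈ IP S A B C) :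
    (IP S A B p).ncard < (IP S A B C).ncard := by
  apply Set.ncard_lt_ncard _ (hfin.subset fun q hq => hq.1)
  refine ⟨fun q hq => ⟨hq.1, ins_sub hD hp.2 hq.2⟩, fun h => ?_⟩
  exact (ne_of_o2 (h hp).2.a) rfl

def al (A B C p : Pt) : ℝ := o A B p / o C A p
def be (A B C p : Pt) : ℝ := o A B p / o B C p
def ga (A B C p : Pt) : ℝ := o C A p / o B C p

theorem div_lt_div_iff'' {a b c d D e : ℝ} (hb : 0 < b) (hd : 0 < d) (hD : 0 < D) (h : e * D = b * c - a * d) :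
    a / b < c / d ↔ 0 < e := by
  rw [div_lt_div_iff₀ hb hd, ← mul_pos_iff_of_pos_right hD, h]
  constructor <;> intro h <;> linarith

theorem al_lt {A B C p q : Pt} (hD : 0 < o A B C) (hp : Ins A B C p) (hq : Ins A B C q) :
    al A B C p < al A B C q ↔ 0 < o A p q :=
  div_lt_div_iff'' hp.b hq.b hD (o_pluA A B C p q)

theorem be_lt {A B C p q : Pt} (hD : 0 < o A B C) (hp : Ins A B C p) (hq : Ins A B C q) :
    be A B C p < be A B C q ↔ 0 < o B q p :=
  div_lt_div_iff'' hp.a hq.a hD (by rw [o_pluB A B C q p]; ring)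

theorem ga_lt {A B C p q : Pt} (hD : 0 < o A B C) (hp : Ins A B C p) (hq : Ins A B C q) :
    ga A B C p < ga A B C q ↔ 0 < o C p q :=
  div_lt_div_iff'' hp.a hq.a hD (o_pluC A B C p q)

theorem be_eq {A B C p : Pt} (hp : Ins A B C p) : be A B C p = al A B C p * ga A B C p := by
  have := hp.a.ne'
  have := hp.b.ne'
  unfold be al ga
  field_simp

theorem exists_enum (I : Set Pt) (hI : I.Finite) (f : Pt → ℝ) (hf : Set.InjOn f I) :
    ∃ e : ℕ → Pt, (∀ i < I.ncard, e i ∈ I) ∧ (∀ i j, i < j → j < I.ncard → f (e i) < f (e j)) ∧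
      ∀ p ∈ I, ∃ i < I.ncard, e i = p := by
  classical
  set F := hI.toFinset with hF
  have hmem : ∀ p, p ∈ F ↔ p ∈ I := fun p => by simp [hF]
  have hcard : (F.image f).card = I.ncard := by
    rw [Finset.card_image_of_injOn (by intro a ha b hb; exact hf ((hmem a).1 ha) ((hmem b).1 hb)),
      Set.ncard_eq_toFinset_card I hI]
  set E := (F.image f).orderEmbOfFin hcard with hE
  have hex : ∀ i : Fin I.ncard, ∃ p ∈ I, f p = E i := by
    intro i
    have := Finset.orderEmbOfFin_mem (F.image f) hcard i
    obtain ⟨p, hp, he⟩ := Finset.mem_image.1 this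
    exact ⟨p, (hmem p).1 hp, he⟩
  choose e he1 he2 using hex
  refine ⟨fun i => if h : i < I.ncard then e ⟨i, h⟩ else 0, ?_, ?_, ?_⟩
  · intro i hi
    simp only [hi, dif_pos]
    exact he1 _
  · intro i j hij hj
    have hi := hij.trans hj
    simp only [hi, hj, dif_pos, he2]
    exact E.strictMono hij
  · intro p hp
    have : f p ∈ Set.range E := by
      rw [hE, Finset.range_orderEmbOfFin]
      exact Finset.mem_coe.2 (Finset.mem_image_of_mem f ((hmem p).2 hp))
    obtain ⟨i, hi⟩ := this
    refine ⟨i, i.2, ?_⟩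
    simp only [i.2, dif_pos]
    exact hf (he1 _) hp (by rw [he2]; exact hi)

/-- enumeration of interior points together with cone relations -/
structure Enum (S : Set Pt) (A B C : Pt) (n : ℕ) (e : ℕ → Pt) (R1 R2 R3 : ℕ → ℕ → Prop) : Prop where
  D : 0 < o A B C
  hA : A ∈ S
  hB : B ∈ S
  hC : C ∈ S
  mem : ∀ i < n, e i ∈ IP S A B C
  inj : ∀ i < n, ∀ j < n, i ≠ j → e i ≠ e j
  surj : ∀ p ∈ IP S A B C, ∃ i < n, e i = p
  r1 : ∀ p < n, ∀ q < n, R1 p q ↔ K A B (e p) (e q)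
  r2 : ∀ p < n, ∀ q < n, R2 p q ↔ K B C (e p) (e q)
  r3 : ∀ p < n, ∀ q < n, R3 p q ↔ K C A (e p) (e q)

theorem Enum.rot {S A B C n e R1 R2 R3} (h : Enum S A B C n e R1 R2 R3) : Enum S B C A n e R2 R3 R1 :=
  ⟨pr h.D, h.hB, h.hC, h.hA, by rw [IP.rot]; exact h.mem, h.inj, by rw [IP.rot]; exact h.surj, h.r2, h.r3, h.r1⟩

theorem Enum.good {S A B C n e R1 R2 R3} (hg : GenPos S) (h : Enum S A B C n e R1 R2 R3) {x z y1 y2 : ℕ}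
    (g : Good R1 R2 R3 n x z y1 y2) : HasEmptyPseudoTriangle 7 S := by
  have mx := h.mem x g.hx
  have mz := h.mem z g.hz
  have m1 := h.mem y1 g.hy1
  have m2 := h.mem y2 g.hy2
  refine goodG hg h.D h.hA h.hB h.hC mx.1 m1.1 m2.1 mz.1 mx.2 m1.2 m2.2 mz.2
    (h.inj _ g.hx _ g.hz g.xz) (h.inj _ g.hx _ g.hy1 g.xy1) (h.inj _ g.hx _ g.hy2 g.xy2)
    (h.inj _ g.hz _ g.hy1 g.zy1) (h.inj _ g.hz _ g.hy2 g.zy2) (h.inj _ g.hy1 _ g.hy2 g.yy) ?_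
  intro q hq iq
  obtain ⟨i, hi, rfl⟩ := h.surj q ⟨hq, iq⟩
  have ne : ∀ j < n, (e i ≠ e j ↔ i ≠ j) := fun j hj => ⟨fun h e => h (by rw [e]), fun hh => h.inj i hi j hj hh⟩
  rw [← h.r1 x g.hx i hi, ← h.r3 z g.hz i hi, ← h.r2 y1 g.hy1 i hi, ← h.r2 y2 g.hy2 i hi, ne x g.hx, ne z g.hz,
    ne y1 g.hy1, ne y2 g.hy2]
  exact g.cov i hi

theorem Enum.insK {S A B C n e R1 R2 R3} (h : Enum S A B C n e R1 R2 R3) {p : ℕ} (hp : p < n) {q : Pt} :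
    q ∈ IP S A B (e p) ↔ ∃ i < n, e i = q ∧ R1 p i := by
  constructor
  · intro hq
    obtain ⟨i, hi, rfl⟩ := h.surj q ⟨hq.1, ins_sub h.D (h.mem p hp).2 hq.2⟩
    exact ⟨i, hi, rfl, (h.r1 p hp i hi).2 ⟨hq.2.a, hq.2.b⟩⟩
  · rintro ⟨i, hi, rfl, hr⟩
    have := (h.r1 p hp i hi).1 hr
    exact ⟨(h.mem i hi).1, (h.mem i hi).2.c, this.1, this.2⟩

theorem Enum.pat {S A B C n e R1 R2 R3} (hg : GenPos S) (h : Enum S A B C n e R1 R2 R3) {p u v w1 w2 : ℕ}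
    (g : Pat R1 n p u v w1 w2) : HasEmptyPseudoTriangle 7 S := by
  have mp := h.mem p g.hp
  have mu := (h.insK g.hp (q := e u)).2 ⟨u, g.hu, rfl, (g.cov u g.hu).2 (by simp)⟩
  have mv := (h.insK g.hp (q := e v)).2 ⟨v, g.hv, rfl, (g.cov v g.hv).2 (by simp)⟩
  have mw1 := (h.insK g.hp (q := e w1)).2 ⟨w1, g.hw1, rfl, (g.cov w1 g.hw1).2 (by simp)⟩
  have mw2 := (h.insK g.hp (q := e w2)).2 ⟨w2, g.hw2, rfl, (g.cov w2 g.hw2).2 (by simp)⟩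
  refine patG hg (A := A) (B := B) (p := e p) (y1 := e u) (y2 := e v) (x := e w1) (z := e w2)
    mp.2.c h.hA h.hB mp.1 mw1.1 mu.1 mv.1 mw2.1 mw1.2 mu.2 mv.2 mw2.2
    (h.inj _ g.hw1 _ g.hw2 g.ww) (h.inj _ g.hu _ g.hv g.uv) ?_ ?_ ?_ ?_ ?_ ?_ ?_
  · rw [← h.r1 u g.hu v g.hv]; exact g.nuv
  · rw [← h.r1 v g.hv u g.hu]; exact g.nvu
  · rw [← h.r1 w1 g.hw1 u g.hu]; exact g.c1u
  · rw [← h.r1 w1 g.hw1 v g.hv]; exact g.c1v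
  · rw [← h.r1 w2 g.hw2 u g.hu]; exact g.c2u
  · rw [← h.r1 w2 g.hw2 v g.hv]; exact g.c2v
  · intro q hq iq
    obtain ⟨i, hi, rfl, hr⟩ := (h.insK g.hp (q := q)).1 ⟨hq, iq⟩
    rcases (g.cov i hi).1 hr with rfl | rfl | rfl | rfl <;> simp

theorem Enum.cnt_le {S A B C n e R1 R2 R3} (hfin : S.Finite) (h : Enum S A B C n e R1 R2 R3) {p : ℕ} (hp : p < n)
    (h4 : (IP S A B (e p)).ncard ≤ 4) : cnt n (R1 p) ≤ 4 := by
  classical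
  refine le_trans ?_ h4
  have hf : (IP S A B (e p)).Finite := hfin.subset fun q hq => hq.1
  rw [Set.ncard_eq_toFinset_card _ hf]
  unfold cnt
  apply Finset.card_le_card_of_injOn e
  · intro i hi
    have hi' := Finset.mem_filter.1 (Finset.mem_coe.1 hi)
    simp only [Set.Finite.coe_toFinset]
    exact (h.insK hp).2 ⟨i, Finset.mem_range.1 hi'.1, rfl, hi'.2⟩
  · intro i hi j hj hij
    have hi' := Finset.mem_filter.1 (Finset.mem_coe.1 hi)
    have hj' := Finset.mem_filter.1 (Finset.mem_coe.1 hj)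
    by_contra hne
    exact h.inj i (Finset.mem_range.1 hi'.1) j (Finset.mem_range.1 hj'.1) hne hij

theorem tri {S : Set Pt} (hfin : S.Finite) (hg : GenPos S) : ∀ (n : ℕ) (A B C : Pt), A ∈ S → B ∈ S → C ∈ S →
    0 < o A B C → (IP S A B C).ncard = n → 5 ≤ n → HasEmptyPseudoTriangle 7 S := by
  intro n
  induction n using Nat.strong_induction_on with
  | _ n ih =>
  intro A B C hA hB hC hD hn h5
  by_cases hs1 : ∃ p ∈ IP S A B C, 5 ≤ (IP S A B p).ncard
  · obtain ⟨p, hp, h5p⟩ := hs1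
    exact ih _ (hn ▸ IP.lt hfin hD hp) A B p hA hB hp.1 hp.2.c rfl h5p
  by_cases hs2 : ∃ p ∈ IP S A B C, 5 ≤ (IP S B C p).ncard
  · obtain ⟨p, hp, h5p⟩ := hs2
    have := IP.lt hfin (pr hD) (p := p) (by rw [IP.rot]; exact hp)
    rw [IP.rot S A B C, hn] at this
    exact ih _ this B C p hB hC hp.1 hp.2.a rfl h5p
  by_cases hs3 : ∃ p ∈ IP S A B C, 5 ≤ (IP S C A p).ncard
  · obtain ⟨p, hp, h5p⟩ := hs3
    have := IP.lt hfin (pr2 hD) (p := p) (by rw [IP.rot, IP.rot]; exact hp)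
    rw [IP.rot S B C A, IP.rot S A B C, hn] at this
    exact ih _ this C A p hC hA hp.1 hp.2.b rfl h5p
  push Not at hs1 hs2 hs3
  have oA : ∀ {p q}, p ∈ IP S A B C → q ∈ IP S A B C → p ≠ q → o A p q ≠ 0 :=
    fun hp hq hn => genpos_o hg hA hp.1 hq.1 hp.2.neA hq.2.neA hn
  have oB : ∀ {p q}, p ∈ IP S A B C → q ∈ IP S A B C → p ≠ q → o B p q ≠ 0 :=
    fun hp hq hn => genpos_o hg hB hp.1 hq.1 hp.2.rot.neA hq.2.rot.neA hn
  have oC : ∀ {p q}, p ∈ IP S A B C → q ∈ IP S A B C → p ≠ q → o C p q ≠ 0 :=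
    fun hp hq hn => genpos_o hg hC hp.1 hq.1 hp.2.rot.rot.neA hq.2.rot.rot.neA hn
  obtain ⟨e, em, elt, es⟩ := exists_enum (IP S A B C) (hfin.subset fun q hq => hq.1) (al A B C) (by
    intro p hp q hq hpq
    by_contra hne
    rcases lt_or_gt_of_ne (oA hp hq hne) with h | h
    · have : al A B C q < al A B C p := (al_lt hD hq.2 hp.2).2 (by rw [o_swap']; linarith)
      exact this.ne' hpq
    · exact ((al_lt hD hp.2 hq.2).2 h).ne hpq)
  rw [hn] at em elt es
  have ei : ∀ i < n, ∀ j < n, i ≠ j → e i ≠ e j := by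
    intro i hi j hj hij he
    rcases lt_or_gt_of_ne hij with h | h
    · exact (elt i j h hj).ne (by rw [he])
    · exact (elt j i h hi).ne (by rw [he])
  have lt_iff : ∀ i < n, ∀ j < n, (i < j ↔ 0 < o A (e i) (e j)) := by
    intro i hi j hj
    rw [← al_lt hD (em i hi).2 (em j hj).2]
    refine ⟨fun h => elt i j h hj, fun h => ?_⟩
    by_contra hc
    rcases (not_lt.1 hc).lt_or_eq with h' | h'
    · exact lt_asymm h (elt j i h' hi)
    · rw [h'] at h; exact lt_irrefl _ h
  set b : ℕ → ℝ := fun i => be A B C (e i) with hb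
  set g : ℕ → ℝ := fun i => ga A B C (e i) with hgg
  have en : Enum S A B C n e (RC b) (RA b g) (RB g) := by
    refine ⟨hD, hA, hB, hC, em, ei, es, ?_, ?_, ?_⟩
    · intro p hp q hq
      unfold RC K
      rw [lt_iff q hq p hp, hb, be_lt hD (em q hq).2 (em p hp).2, o_rot2 A (e q) (e p), and_comm]
    · intro p hp q hq
      unfold RA K
      rw [hb, hgg, be_lt hD (em p hp).2 (em q hq).2, ga_lt hD (em p hp).2 (em q hq).2, o_rot2 B (e q) (e p), and_comm]
    · intro p hp q hq
      unfold RB K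
      rw [lt_iff p hp q hq, hgg, ga_lt hD (em q hq).2 (em p hp).2, o_rot2 C (e q) (e p)]
  have cfg : Cfg n b g := by
    refine ⟨?_, ?_, ?_, ?_, ?_, ?_⟩
    · intro i hi j hj hij
      rcases lt_or_gt_of_ne (oB (em i hi) (em j hj) (ei i hi j hj hij)) with h | h
      · exact ((be_lt hD (em i hi).2 (em j hj).2).2 (by rw [o_swap']; linarith)).ne
      · exact ((be_lt hD (em j hj).2 (em i hi).2).2 h).ne'
    · intro i hi j hj hij
      rcases lt_or_gt_of_ne (oC (em i hi) (em j hj) (ei i hi j hj hij)) with h | h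
      · exact ((ga_lt hD (em j hj).2 (em i hi).2).2 (by rw [o_swap']; linarith)).ne'
      · exact ((ga_lt hD (em i hi).2 (em j hj).2).2 h).ne
    · intro i j hij hj hlt
      have hi := hij.trans hj
      have ii := (em i hi).2
      have ij := (em j hj).2
      show be A B C (e i) < be A B C (e j)
      rw [be_eq ii, be_eq ij]
      exact mul_lt_mul'' (elt i j hij hj) hlt (div_pos ii.c ii.b).le (div_pos ii.b ii.a).le
    · intro p hp
      exact en.cnt_le hfin hp (Nat.lt_succ_iff.1 (hs1 _ (em p hp)))
    · intro p hp
      exact en.rot.cnt_le hfin hp (Nat.lt_succ_iff.1 (hs2 _ (em p hp)))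
    · intro p hp
      exact en.rot.rot.cnt_le hfin hp (Nat.lt_succ_iff.1 (hs3 _ (em p hp)))
  rcases comb cfg h5 with ⟨x, z, y1, y2, h⟩ | ⟨x, z, y1, y2, h⟩ | ⟨x, z, y1, y2, h⟩ | ⟨p, u, v, w1, w2, h⟩ |
    ⟨p, u, v, w1, w2, h⟩ | ⟨p, u, v, w1, w2, h⟩
  · exact en.good hg h
  · exact en.rot.good hg h
  · exact en.rot.rot.good hg h
  · exact en.pat hg h
  · exact en.rot.pat hg h
  · exact en.rot.rot.pat hg h

theorem hull_sub {S : Set Pt} (hfin : S.Finite) : convexHull ℝ S ⊆ convexHull ℝ (hullVertices S) := by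
  have hsub : (convexHull ℝ S).extremePoints ℝ ⊆ hullVertices S := by
    intro p hp
    have hpS : p ∈ S := extremePoints_convexHull_subset hp
    refine ⟨hpS, fun hc => ?_⟩
    have hcv := ((convex_convexHull ℝ S).mem_extremePoints_iff_convex_sdiff.1 hp).2
    have : convexHull ℝ (S \ {p}) ⊆ convexHull ℝ S \ {p} :=
      convexHull_min (fun q hq => ⟨subset_convexHull ℝ S hq.1, hq.2⟩) hcv
    exact (this hc).2 rfl
  have hcomp : IsCompact (convexHull ℝ S) := hfin.isCompact_convexHull ℝ
  have hf : (hullVertices S).Finite := hfin.subset fun q hq => hq.1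
  rw [← closure_convexHull_extremePoints hcomp (convex_convexHull ℝ S)]
  exact closure_minimal (convexHull_mono hsub) (hf.isClosed_convexHull ℝ)

theorem int_pos {S : Set Pt} {A B C p : Pt} (hD : 0 < o A B C) (hsub : convexHull ℝ S ⊆ convexHull ℝ {A, B, C})
    (hp : p ∈ interior (convexHull ℝ S)) : 0 < o A B p := by
  have hhalf : convexHull ℝ {A, B, C} ⊆ {w | 0 ≤ o A B w} := by
    apply convexHull_min
    · intro w hw
      rcases hw with rfl | rfl | rfl
      · exact (o_self1 _ _).ge
      · exact (o_self2 _ _).ge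
      · exact hD.le
    · intro u hu v hv s t hs ht hst
      show 0 ≤ o A B (s • u + t • v)
      rw [o_comb _ _ _ _ _ _ hst]
      exact add_nonneg (mul_nonneg hs hu) (mul_nonneg ht hv)
  have hc : Filter.Tendsto (fun t : ℝ => p + t • (A - C)) (nhdsWithin 0 (Set.Ioi 0)) (nhds p) := by
    have : Continuous (fun t : ℝ => p + t • (A - C)) := by fun_prop
    have := this.tendsto 0
    simp only [zero_smul, add_zero] at this
    exact this.mono_left nhdsWithin_le_nhds
  have hev := hc.eventually (isOpen_interior.mem_nhds hp)
  obtain ⟨t, ht, ht0⟩ := (hev.and self_mem_nhdsWithin).exists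
  have h1 : 0 ≤ o A B (p + t • (A - C)) := hhalf (hsub (interior_subset ht))
  have e : o A B (p + t • (A - C)) = o A B p - t * o A B C := by
    simp only [o, Prod.fst_add, Prod.snd_add, Prod.smul_fst, Prod.smul_snd, smul_eq_mul, Prod.fst_sub, Prod.snd_sub]
    ring
  have := mul_pos ht0 hD
  linarith

theorem final {S : Set Pt} (hfin : S.Finite) (hg : GenPos S) (hint : 5 ≤ (interiorPts S).ncard) {A B C : Pt}
    (hA : A ∈ S) (hB : B ∈ S) (hC : C ∈ S) (hD : 0 < o A B C) (hsub : convexHull ℝ S ⊆ convexHull ℝ {A, B, C}) :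
    HasEmptyPseudoTriangle 7 S := by
  refine tri hfin hg _ A B C hA hB hC hD rfl (hint.trans ?_)
  apply Set.ncard_le_ncard _ (hfin.subset fun q hq => hq.1)
  intro p hp
  have s2 : ({B, C, A} : Set Pt) = {A, B, C} := by ext; simp; tauto
  have s3 : ({C, A, B} : Set Pt) = {A, B, C} := by ext; simp; tauto
  exact ⟨hp.1, int_pos hD hsub hp.2, int_pos (pr hD) (s2 ▸ hsub) hp.2, int_pos (pr2 hD) (s3 ▸ hsub) hp.2⟩

end PT

/-- a set in general position with triangular convex hull and at least
5 interior points contains an empty 7-pseudo-triangle. -/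
theorem statement_5 (S : Set Pt) (hfin : S.Finite) (hgp : GenPos S)
    (hhull : (hullVertices S).ncard = 3) (hint : 5 ≤ (interiorPts S).ncard) :
    HasEmptyPseudoTriangle 7 S := by
  obtain ⟨A, B, C, hAB, hAC, hBC, hV⟩ := Set.ncard_eq_three.1 hhull
  have hm : ∀ p ∈ ({A, B, C} : Set Pt), p ∈ S := fun p hp => (hV ▸ hp : p ∈ hullVertices S).1
  have hA := hm A (by simp)
  have hB := hm B (by simp)
  have hC := hm C (by simp)
  have hsub := PT.hull_sub hfin
  rw [hV] at hsub
  rcases lt_or_gt_of_ne (PT.genpos_o hgp hA hB hC hAB hAC hBC) with h | h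
  · refine PT.final hfin hgp hint hB hA hC (by rw [PT.o_swap]; linarith) ?_
    have : ({B, A, C} : Set Pt) = {A, B, C} := Set.insert_comm _ _ _
    rwa [this]
  · exact PT.final hfin hgp hint hA hB hC h hsub
end
end

section
/- Every set of 9 points in the plane in general position contains a 5-hole or an empty 6-pseudo-triangle. -/
open Set

noncomputable section

/-! ### Orientation -/

/-- Orientation determinant. -/
def ori (p q r : Pt) : ℝ := (q.1 - p.1) * (r.2 - p.2) - (q.2 - p.2) * (r.1 - p.1)

lemma ori_rot (p q r : Pt) : ori q r p = ori p q r := by unfold ori; ring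

lemma ori_swap (p q r : Pt) : ori q p r = - ori p q r := by unfold ori; ring

lemma ori_self_left (p q : Pt) : ori p p q = 0 := by unfold ori; ring

lemma ori_self_right (p q : Pt) : ori p q q = 0 := by unfold ori; ring

lemma ori_self_mid (p q : Pt) : ori p q p = 0 := by unfold ori; ring

lemma ori_combo (p q x y : Pt) (a b : ℝ) (h : a + b = 1) :
    ori p q (a • x + b • y) = a * ori p q x + b * ori p q y := by
  obtain rfl : b = 1 - a := by linarith
  simp only [ori, Prod.fst_add, Prod.snd_add, Prod.smul_fst, Prod.smul_snd, smul_eq_mul]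
  ring

lemma convex_ori_nonneg (p q : Pt) : Convex ℝ {x : Pt | 0 ≤ ori p q x} := by
  intro x hx y hy a b ha hb hab
  simp only [mem_ofPred_eq] at *
  rw [ori_combo _ _ _ _ _ _ hab]
  positivity

lemma convex_far (o q : Pt) : Convex ℝ {x : Pt | 0 < ori o x q ∨ x = o} := by
  have key : ∀ x, ori o x q = ori q o x := fun x => by unfold ori; ring
  intro x hx y hy a b ha hb hab
  simp only [mem_ofPred_eq, key] at *
  rw [ori_combo _ _ _ _ _ _ hab]
  have h0 : ori q o o = 0 := ori_self_right _ _
  rcases hx with hx | rfl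
  · rcases hy with hy | rfl
    · left
      rcases ha.lt_or_eq with h | h
      · have : 0 < a * ori q o x := mul_pos h hx
        have : 0 ≤ b * ori q o y := mul_nonneg hb hy.le
        linarith
      · obtain rfl : b = 1 := by linarith
        rw [← h]; linarith
    · rcases ha.lt_or_eq with h | h
      · left; rw [h0]; have := mul_pos h hx; linarith
      · right
        obtain rfl : b = 1 := by linarith
        rw [← h]; simp
  · rcases hy with hy | rfl
    · rcases hb.lt_or_eq with h | h
      · left; rw [h0]; have := mul_pos h hy; linarith
      · right
        obtain rfl : a = 1 := by linarith
        rw [← h]; simp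
    · right
      rw [← add_smul, hab, one_smul]

lemma ori_ne_of_not_collinear {p q r : Pt} (hpq : p ≠ q)
    (h : ¬ Collinear ℝ ({p, q, r} : Set Pt)) : ori p q r ≠ 0 := by
  intro h0
  apply h
  rw [collinear_iff_of_mem (p₀ := p) (by simp)]
  refine ⟨q - p, ?_⟩
  intro x hx
  simp only [mem_insert_iff, mem_singleton_iff] at hx
  rcases hx with rfl | rfl | rfl
  · exact ⟨0, by simp⟩
  · exact ⟨1, by simp⟩
  · unfold ori at h0
    by_cases h1 : q.1 - p.1 = 0
    · have h2 : q.2 - p.2 ≠ 0 := by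
        intro h2
        exact hpq (Prod.ext (by linarith) (by linarith))
      refine ⟨(x.2 - p.2) / (q.2 - p.2), ?_⟩
      rw [h1] at h0
      have h3 : x.1 - p.1 = 0 := by
        have : (q.2 - p.2) * (x.1 - p.1) = 0 := by linarith
        exact (mul_eq_zero.1 this).resolve_left h2
      apply Prod.ext
      · simp [h1]; linarith
      · simp; field_simp; ring
    · refine ⟨(x.1 - p.1) / (q.1 - p.1), ?_⟩
      apply Prod.ext
      · simp; field_simp; ring
      · simp; field_simp; linarith

/-! ### Pentagonal holes -/

/-- `x` is separated from all points of the hull by a line through `o`. -/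
def Far (V : Set Pt) (x : Pt) : Prop := ∃ o, x ≠ o ∧ ∀ w ∈ V, 0 < ori o w x ∨ w = o

lemma not_mem_hull_of_ori {V : Set Pt} {p q x : Pt} (h : ∀ w ∈ V, 0 ≤ ori p q w)
    (hx : ori p q x < 0) : x ∉ convexHull ℝ V := by
  intro hm
  have : x ∈ {x : Pt | 0 ≤ ori p q x} :=
    convexHull_min (fun w hw => h w hw) (convex_ori_nonneg p q) hm
  exact absurd hx (not_lt.2 this)

lemma not_mem_hull_of_far {V : Set Pt} {x : Pt} (h : Far V x) : x ∉ convexHull ℝ V := by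
  obtain ⟨o, ho, h⟩ := h
  intro hm
  have : x ∈ {w : Pt | 0 < ori o w x ∨ w = o} :=
    convexHull_min (fun w hw => h w hw) (convex_far o x) hm
  rcases this with h1 | h1
  · rw [ori_self_right] at h1; exact lt_irrefl _ h1
  · exact ho h1

lemma ne_of_ori {p q r : Pt} (h : 0 < ori p q r) : p ≠ q ∧ p ≠ r ∧ q ≠ r := by
  refine ⟨?_, ?_, ?_⟩ <;> rintro rfl <;>
    simp [ori_self_left, ori_self_right, ori_self_mid] at h

lemma hole_geom {S : Set Pt} {a b c d e : Pt}
    (ha : a ∈ S) (hb : b ∈ S) (hc : c ∈ S) (hd : d ∈ S) (he : e ∈ S)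
    (abc : 0 < ori a b c) (abd : 0 < ori a b d) (abe : 0 < ori a b e)
    (acd : 0 < ori a c d) (ace : 0 < ori a c e) (ade : 0 < ori a d e)
    (bcd : 0 < ori b c d) (bce : 0 < ori b c e) (bde : 0 < ori b d e) (cde : 0 < ori c d e)
    (hq : ∀ x ∈ S, x ∈ ({a, b, c, d, e} : Set Pt) ∨ Far {a, b, c, d, e} x ∨
      ori a b x < 0 ∨ ori b c x < 0 ∨ ori c d x < 0 ∨ ori d e x < 0 ∨ ori e a x < 0) :
    HasHole 5 S := by
  obtain ⟨nab, nac, nbc⟩ := ne_of_ori abc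
  obtain ⟨nad, nae, nde⟩ := ne_of_ori ade
  obtain ⟨nbd, nbe, -⟩ := ne_of_ori bde
  obtain ⟨ncd, nce, -⟩ := ne_of_ori cde
  have hull : ∀ x y : Pt, ori x y a ≥ 0 → ori x y b ≥ 0 → ori x y c ≥ 0 → ori x y d ≥ 0 →
      ori x y e ≥ 0 → ∀ w ∈ ({a, b, c, d, e} : Set Pt), 0 ≤ ori x y w := by
    intro x y h1 h2 h3 h4 h5 w hw
    simp only [mem_insert_iff, mem_singleton_iff] at hw
    rcases hw with rfl | rfl | rfl | rfl | rfl <;> assumption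
  refine ⟨{a, b, c, d, e}, ?_, ?_, ?_, ?_⟩
  · intro x hx
    simp only [mem_insert_iff, mem_singleton_iff] at hx
    rcases hx with rfl | rfl | rfl | rfl | rfl <;> assumption
  · rw [ncard_eq_toFinset_card', show ({a, b, c, d, e} : Set Pt).toFinset = {a, b, c, d, e} by
      ext; simp]
    rw [Finset.card_insert_of_notMem, Finset.card_insert_of_notMem, Finset.card_insert_of_notMem,
      Finset.card_insert_of_notMem, Finset.card_singleton] <;> simp <;> tauto
  · intro x hx
    have key : ∀ p q : Pt, ori p q x < 0 → (∀ w ∈ ({a, b, c, d, e} : Set Pt), w ≠ x → 0 ≤ ori p q w) →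
        x ∉ convexHull ℝ (({a, b, c, d, e} : Set Pt) \ {x}) := by
      intro p q h1 h2
      exact not_mem_hull_of_ori (fun w hw => h2 w hw.1 (fun h => hw.2 h)) h1
    simp only [mem_insert_iff, mem_singleton_iff] at hx
    have fin : ∀ p q : Pt, ori p q x < 0 → (a ≠ x → 0 ≤ ori p q a) → (b ≠ x → 0 ≤ ori p q b) →
        (c ≠ x → 0 ≤ ori p q c) → (d ≠ x → 0 ≤ ori p q d) → (e ≠ x → 0 ≤ ori p q e) →
        x ∉ convexHull ℝ (({a, b, c, d, e} : Set Pt) \ {x}) := by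
      intro p q h0 h1 h2 h3 h4 h5
      refine key p q h0 ?_
      intro w hw
      simp only [mem_insert_iff, mem_singleton_iff] at hw
      rcases hw with rfl | rfl | rfl | rfl | rfl <;> assumption
    clear key hull hq
    rcases hx with rfl | rfl | rfl | rfl | rfl
    · apply fin e b <;> intros <;> first | contradiction | (unfold ori at *; linarith)
    · apply fin a c <;> intros <;> first | contradiction | (unfold ori at *; linarith)
    · apply fin b d <;> intros <;> first | contradiction | (unfold ori at *; linarith)
    · apply fin c e <;> intros <;> first | contradiction | (unfold ori at *; linarith)
    · apply fin d a <;> intros <;> first | contradiction | (unfold ori at *; linarith)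
  · intro x hx hxi
    have hxh := interior_subset hxi
    by_contra hn
    rcases hq x hx with h | h | h | h | h | h | h
    · exact hn h
    · exact not_mem_hull_of_far h hxh
    all_goals
      refine not_mem_hull_of_ori (hull _ _ ?_ ?_ ?_ ?_ ?_) h hxh <;> clear hull hq h <;>
        unfold ori at * <;> linarith

/-! ### Pseudo-triangles -/

lemma unbounded_of_ray {K : Set Pt} {q d : Pt} (hd : d ≠ 0)
    (h : ∀ t : ℝ, 0 ≤ t → q + t • d ∉ K) :
    ¬ Bornology.IsBounded (connectedComponentIn Kᶜ q) := by
  intro hb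
  have hc : IsPreconnected ((fun t : ℝ => q + t • d) '' Ici 0) :=
    isPreconnected_Ici.image _ (by fun_prop)
  have hsub : (fun t : ℝ => q + t • d) '' Ici 0 ⊆ connectedComponentIn Kᶜ q := by
    apply hc.subset_connectedComponentIn
    · exact ⟨0, by simp, by simp⟩
    · rintro _ ⟨t, ht, rfl⟩
      exact h t ht
  obtain ⟨R, hR⟩ := (isBounded_iff_forall_norm_le.1 (hb.subset hsub))
  have hdp : 0 < ‖d‖ := norm_pos_iff.2 hd
  have hR0 : 0 ≤ R := le_trans (norm_nonneg _) (hR _ ⟨0, by simp, rfl⟩)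
  have h1 := hR _ ⟨(R + ‖q‖ + 1) / ‖d‖, by simp only [mem_Ici]; positivity, rfl⟩
  have h2 : ‖((R + ‖q‖ + 1) / ‖d‖) • d‖ = R + ‖q‖ + 1 := by
    rw [norm_smul, Real.norm_of_nonneg (by positivity)]
    field_simp
  have h3 := norm_sub_le (q + ((R + ‖q‖ + 1) / ‖d‖) • d) q
  rw [add_sub_cancel_left, h2] at h3
  simp only at h1
  linarith

lemma ori_ray (p q x c : Pt) (t : ℝ) :
    ori p q (x + t • (x - c)) = (1 + t) * ori p q x - t * ori p q c := by
  simp only [ori, Prod.fst_add, Prod.snd_add, Prod.smul_fst, Prod.smul_snd, smul_eq_mul,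
    Prod.fst_sub, Prod.snd_sub]
  ring

lemma unbounded_of_lines {K : Set Pt} {p q r s c x : Pt}
    (hK : ∀ y ∈ K, 0 ≤ ori p q y ∨ 0 ≤ ori r s y)
    (h1 : ori p q x < 0) (h2 : ori r s x < 0) (h3 : 0 < ori p q c) (h4 : 0 < ori r s c) :
    ¬ Bornology.IsBounded (connectedComponentIn Kᶜ x) := by
  apply unbounded_of_ray (d := x - c)
  · rw [sub_ne_zero]; rintro rfl; linarith
  · intro t ht hm
    have := hK _ hm
    rw [ori_ray, ori_ray] at this
    rcases this with h | h
    · nlinarith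
    · nlinarith

lemma unbounded_of_far {K : Set Pt} {o x : Pt} (ho : x ≠ o)
    (hK : ∀ y ∈ K, 0 < ori o y x ∨ y = o) :
    ¬ Bornology.IsBounded (connectedComponentIn Kᶜ x) := by
  apply unbounded_of_ray (d := x - o) (sub_ne_zero.2 ho)
  intro t ht hm
  rcases hK _ hm with h | h
  · have : ori o (x + t • (x - o)) x = 0 := by
      simp only [ori, Prod.fst_add, Prod.snd_add, Prod.smul_fst, Prod.smul_snd, smul_eq_mul,
        Prod.fst_sub, Prod.snd_sub]
      ring
    linarith
  · have h' : (1 + t) • (x - o) = 0 := by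
      rw [add_smul, one_smul, sub_add_eq_add_sub, h, sub_self]
    rcases smul_eq_zero.1 h' with h | h
    · linarith
    · exact ho (sub_eq_zero.1 h)

lemma seg_disj_strict {p q a b c d : Pt} (h1 : ori p q a ≤ 0) (h2 : ori p q b ≤ 0)
    (h3 : 0 < ori p q c) (h4 : 0 < ori p q d) :
    segment ℝ a b ∩ segment ℝ c d = ∅ := by
  ext x
  simp only [mem_inter_iff, mem_empty_iff_false, iff_false, not_and]
  rintro ⟨s, t, hs, ht, hst, rfl⟩ ⟨s', t', hs', ht', hst', h⟩
  have e := congrArg (ori p q) h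
  rw [ori_combo _ _ _ _ _ _ hst, ori_combo _ _ _ _ _ _ hst'] at e
  have e1 : s * ori p q a + t * ori p q b ≤ 0 := by nlinarith
  have e2 : 0 < s' * ori p q c + t' * ori p q d := by
    rcases hs'.lt_or_eq with h0 | h0
    · have := mul_pos h0 h3
      have := mul_nonneg ht' h4.le
      linarith
    · obtain rfl : t' = 1 := by linarith
      rw [← h0]; linarith
  linarith

lemma seg_disj_touch {p q a b c d : Pt} (h1 : ori p q a = 0) (h2 : ori p q b < 0)
    (h3 : ori p q c = 0) (h4 : 0 < ori p q d) (hac : a ≠ c) :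
    segment ℝ a b ∩ segment ℝ c d = ∅ := by
  ext x
  simp only [mem_inter_iff, mem_empty_iff_false, iff_false, not_and]
  rintro ⟨s, t, hs, ht, hst, rfl⟩ ⟨s', t', hs', ht', hst', h⟩
  have e := congrArg (ori p q) h
  rw [ori_combo _ _ _ _ _ _ hst, ori_combo _ _ _ _ _ _ hst', h1, h3] at e
  have e1 : t * ori p q b ≤ 0 := by nlinarith
  have e2 : 0 ≤ t' * ori p q d := by positivity
  have e3 : t = 0 := by
    have : t * ori p q b = 0 := by linarith
    exact (mul_eq_zero.1 this).resolve_right h2.ne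
  have e4 : t' = 0 := by
    have : t' * ori p q d = 0 := by linarith
    exact (mul_eq_zero.1 this).resolve_right h4.ne'
  obtain rfl : s = 1 := by linarith
  obtain rfl : s' = 1 := by linarith
  rw [e3, e4] at h
  simp at h
  exact hac h.symm

lemma seg_adj {x y z : Pt} (h : ori x y z ≠ 0) : segment ℝ x y ∩ segment ℝ y z = {y} := by
  ext w
  simp only [mem_inter_iff, mem_singleton_iff]
  constructor
  · rintro ⟨⟨s, t, hs, ht, hst, rfl⟩, ⟨s', t', hs', ht', hst', h'⟩⟩
    have e := congrArg (ori x y) h'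
    rw [ori_combo _ _ _ _ _ _ hst, ori_combo _ _ _ _ _ _ hst', ori_self_mid, ori_self_right] at e
    have e4 : t' = 0 := by
      have : t' * ori x y z = 0 := by linarith
      exact (mul_eq_zero.1 this).resolve_right h
    obtain rfl : s' = 1 := by linarith
    rw [← h', e4]; simp
  · rintro rfl
    exact ⟨right_mem_segment _ _ _, left_mem_segment _ _ _⟩

/-- The orientations of the six points of a pseudo-triangle `A a B b C c`. -/
structure PTri (A a B b C c : Pt) : Prop where
  abc : 0 < ori A B C
  a1 : 0 < ori A B a
  a2 : 0 < ori B C a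
  a3 : 0 < ori C A a
  b1 : 0 < ori A B b
  b2 : 0 < ori B C b
  b3 : 0 < ori C A b
  c1 : 0 < ori A B c
  c2 : 0 < ori B C c
  c3 : 0 < ori C A c
  eA : 0 < ori c A a
  eB : 0 < ori a B b
  eC : 0 < ori b C c
  inn : 0 < ori a b c

lemma PTri.rot {A a B b C c : Pt} (h : PTri A a B b C c) : PTri B b C c A a := by
  obtain ⟨h1, h2, h3, h4, h5, h6, h7, h8, h9, h10, h11, h12, h13, h14⟩ := h
  constructor <;> first | assumption | (unfold ori at *; linarith)

lemma PTri.disj {A a B b C c : Pt} (h : PTri A a B b C c) :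
    segment ℝ A a ∩ segment ℝ B b = ∅ ∧ segment ℝ A a ∩ segment ℝ b C = ∅ ∧
    segment ℝ A a ∩ segment ℝ C c = ∅ ∧ segment ℝ a B ∩ segment ℝ b C = ∅ ∧
    segment ℝ a B ∩ segment ℝ C c = ∅ ∧ segment ℝ a B ∩ segment ℝ c A = ∅ := by
  obtain ⟨h1, h2, h3, h4, h5, h6, h7, h8, h9, h10, h11, h12, h13, h14⟩ := h
  obtain ⟨n1, n2, n3⟩ := ne_of_ori h2
  refine ⟨?_, ?_, ?_, ?_, ?_, ?_⟩
  · rw [segment_symm ℝ A a]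
    apply seg_disj_touch (p := a) (q := B) <;> first | exact n3.symm | (unfold ori at *; linarith)
  · apply seg_disj_strict (p := a) (q := B) <;> (unfold ori at *; linarith)
  · apply seg_disj_strict (p := A) (q := a) <;> (unfold ori at *; linarith)
  · apply seg_disj_strict (p := a) (q := B) <;> (unfold ori at *; linarith)
  · apply seg_disj_strict (p := A) (q := a) <;> (unfold ori at *; linarith)
  · rw [segment_symm ℝ c A]
    apply seg_disj_touch (p := A) (q := a) <;> first | exact n2.symm | (unfold ori at *; linarith)

/-- The six vertices as a cyclic sequence. -/
def hexa (A a B b C c : Pt) : ZMod 6 → Pt := (![A, a, B, b, C, c] : Fin 6 → Pt)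

/-- The union of the six edges. -/
def hexaB (A a B b C c : Pt) : Set Pt :=
  segment ℝ A a ∪ segment ℝ a B ∪ segment ℝ B b ∪ segment ℝ b C ∪ segment ℝ C c ∪ segment ℝ c A

lemma polyBoundary_hexa (A a B b C c : Pt) :
    polyBoundary 6 (hexa A a B b C c) = hexaB A a B b C c := by
  ext x
  simp only [polyBoundary, hexaB, mem_iUnion, mem_union]
  constructor
  · rintro ⟨i, hi⟩
    fin_cases i
    · exact Or.inl (Or.inl (Or.inl (Or.inl (Or.inl hi))))
    · exact Or.inl (Or.inl (Or.inl (Or.inl (Or.inr hi))))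
    · exact Or.inl (Or.inl (Or.inl (Or.inr hi)))
    · exact Or.inl (Or.inl (Or.inr hi))
    · exact Or.inl (Or.inr hi)
    · exact Or.inr hi
  · rintro (((((h | h) | h) | h) | h) | h)
    · exact ⟨(0 : Fin 6), h⟩
    · exact ⟨(1 : Fin 6), h⟩
    · exact ⟨(2 : Fin 6), h⟩
    · exact ⟨(3 : Fin 6), h⟩
    · exact ⟨(4 : Fin 6), h⟩
    · exact ⟨(5 : Fin 6), h⟩

lemma hexaB_rot (A a B b C c : Pt) : hexaB B b C c A a = hexaB A a B b C c := by
  ext x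
  simp only [hexaB, mem_union]
  tauto

/-- Being beyond the side chain `A a B`. -/
def Esc (A a B x : Pt) : Prop := ori A B x < 0 ∨ (ori A a x < 0 ∧ ori a B x < 0)

lemma PTri.esc {A a B b C c x : Pt} (h : PTri A a B b C c) (hx : Esc A a B x) :
    ¬ Bornology.IsBounded (connectedComponentIn (hexaB A a B b C c)ᶜ x) := by
  obtain ⟨h1, h2, h3, h4, h5, h6, h7, h8, h9, h10, h11, h12, h13, h14⟩ := h
  have seg : ∀ p q u v y : Pt, 0 ≤ ori p q u → 0 ≤ ori p q v → y ∈ segment ℝ u v →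
      0 ≤ ori p q y := fun p q u v y hu hv hy =>
    (convex_ori_nonneg p q).segment_subset hu hv hy
  rcases hx with hx | ⟨hx, hx'⟩
  · apply unbounded_of_lines (p := A) (q := B) (r := A) (s := B) (c := C) _ hx hx h1 h1
    intro y hy
    left
    simp only [hexaB, mem_union] at hy
    rcases hy with ((((hy | hy) | hy) | hy) | hy) | hy <;> refine seg _ _ _ _ _ ?_ ?_ hy <;>
      (clear seg; unfold ori at *; linarith)
  · apply unbounded_of_lines (p := A) (q := a) (r := a) (s := B) (c := C) _ hx hx'
    · unfold ori at *; linarith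
    · unfold ori at *; linarith
    · intro y hy
      simp only [hexaB, mem_union] at hy
      rcases hy with ((((hy | hy) | hy) | hy) | hy) | hy
      · left; refine seg _ _ _ _ _ ?_ ?_ hy <;> (clear seg; unfold ori at *; linarith)
      · right; refine seg _ _ _ _ _ ?_ ?_ hy <;> (clear seg; unfold ori at *; linarith)
      · right; refine seg _ _ _ _ _ ?_ ?_ hy <;> (clear seg; unfold ori at *; linarith)
      · right; refine seg _ _ _ _ _ ?_ ?_ hy <;> (clear seg; unfold ori at *; linarith)
      · left; refine seg _ _ _ _ _ ?_ ?_ hy <;> (clear seg; unfold ori at *; linarith)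
      · left; refine seg _ _ _ _ _ ?_ ?_ hy <;> (clear seg; unfold ori at *; linarith)

lemma vtxCross_eq (v : ZMod 6 → Pt) (i : ZMod 6) :
    vtxCross 6 v i = ori (v (i - 1)) (v i) (v (i + 1)) := by
  simp only [vtxCross, cross2, ori, Prod.fst_sub, Prod.snd_sub]
  ring

lemma signedArea_hexa (A a B b C c : Pt) :
    signedArea 6 (hexa A a B b C c) = ori c A a + ori a B b + ori b C c + ori a b c := by
  have h : signedArea 6 (hexa A a B b C c) = ∑ i : Fin 6,
      cross2 ((![A, a, B, b, C, c] : Fin 6 → Pt) i) ((![A, a, B, b, C, c] : Fin 6 → Pt) (i + 1)) :=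
    rfl
  have h' : signedArea 6 (hexa A a B b C c) =
      cross2 A a + cross2 a B + cross2 B b + cross2 b C + cross2 C c + cross2 c A := by
    rw [h, Fin.sum_univ_six]; rfl
  rw [h']
  simp only [cross2, ori]
  ring

lemma PTri.pseudo {A a B b C c : Pt} (h : PTri A a B b C c) :
    IsPseudoTriangle 6 (hexa A a B b C c) := by
  have hs : 0 < signedArea 6 (hexa A a B b C c) := by
    rw [signedArea_hexa]
    have := h.eA; have := h.eB; have := h.eC; have := h.inn
    linarith
  have t0 : vtxCross 6 (hexa A a B b C c) (0 : Fin 6) = ori c A a := vtxCross_eq _ _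
  have t1 : vtxCross 6 (hexa A a B b C c) (1 : Fin 6) = ori A a B := vtxCross_eq _ _
  have t2 : vtxCross 6 (hexa A a B b C c) (2 : Fin 6) = ori a B b := vtxCross_eq _ _
  have t3 : vtxCross 6 (hexa A a B b C c) (3 : Fin 6) = ori B b C := vtxCross_eq _ _
  have t4 : vtxCross 6 (hexa A a B b C c) (4 : Fin 6) = ori b C c := vtxCross_eq _ _
  have t5 : vtxCross 6 (hexa A a B b C c) (5 : Fin 6) = ori C c A := vtxCross_eq _ _
  have s0 : 0 < vtxCross 6 (hexa A a B b C c) (0 : Fin 6) := by rw [t0]; exact h.eA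
  have s2 : 0 < vtxCross 6 (hexa A a B b C c) (2 : Fin 6) := by rw [t2]; exact h.eB
  have s4 : 0 < vtxCross 6 (hexa A a B b C c) (4 : Fin 6) := by rw [t4]; exact h.eC
  have s1 : vtxCross 6 (hexa A a B b C c) (1 : Fin 6) < 0 := by
    rw [t1]; have := h.a1; unfold ori at *; linarith
  have s3 : vtxCross 6 (hexa A a B b C c) (3 : Fin 6) < 0 := by
    rw [t3]; have := h.b2; unfold ori at *; linarith
  have s5 : vtxCross 6 (hexa A a B b C c) (5 : Fin 6) < 0 := by
    rw [t5]; have := h.c3; unfold ori at *; linarith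
  have hne : ∀ i : ZMod 6, vtxCross 6 (hexa A a B b C c) i ≠ 0 := by
    intro i
    fin_cases i
    · exact s0.ne'
    · exact s1.ne
    · exact s2.ne'
    · exact s3.ne
    · exact s4.ne'
    · exact s5.ne
  refine ⟨⟨by norm_num, ?_, ?_, ?_⟩, hne, ?_⟩
  · obtain ⟨n1, n2, n3⟩ := ne_of_ori h.abc
    obtain ⟨-, n4, n5⟩ := ne_of_ori h.a1
    obtain ⟨-, n6, n7⟩ := ne_of_ori h.a2
    obtain ⟨-, n8, n9⟩ := ne_of_ori h.b1
    obtain ⟨-, n10, n11⟩ := ne_of_ori h.b2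
    obtain ⟨-, n12, n13⟩ := ne_of_ori h.c1
    obtain ⟨-, n14, n15⟩ := ne_of_ori h.c2
    obtain ⟨n16, n17, n18⟩ := ne_of_ori h.inn
    intro i j hij
    fin_cases i <;> fin_cases j <;> first | rfl | (exfalso; simp [hexa] at hij; tauto)
  · obtain ⟨d1, d2, d3, d4, d5, d6⟩ := h.disj
    obtain ⟨d7, d8, d9, d10, d11, d12⟩ := h.rot.disj
    obtain ⟨d13, d14, d15, d16, d17, d18⟩ := h.rot.rot.disj
    intro i j h1 h2 h3
    fin_cases i <;> fin_cases j <;>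
      first
      | exact absurd rfl h1
      | exact absurd rfl h2
      | exact absurd rfl h3
      | assumption
      | (rw [inter_comm]; assumption)
  · intro i
    have := hne (i + 1)
    rw [vtxCross_eq] at this
    have e1 : i + 1 - 1 = i := by ring
    have e2 : i + 1 + 1 = i + 2 := by ring
    rw [e1, e2] at this
    exact seg_adj this
  · have : {i : ZMod 6 | IsConvexVtx 6 (hexa A a B b C c) i} = {(0 : Fin 6), (2 : Fin 6), (4 : Fin 6)} := by
      ext i
      simp only [mem_ofPred_eq, IsConvexVtx]
      constructor
      · intro hi
        have hp := (mul_pos_iff_of_pos_right hs).1 hi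
        fin_cases i
        · exact Or.inl rfl
        · exact absurd hp s1.not_gt
        · exact Or.inr (Or.inl rfl)
        · exact absurd hp s3.not_gt
        · exact Or.inr (Or.inr rfl)
        · exact absurd hp s5.not_gt
      · rintro (rfl | rfl | rfl)
        · exact mul_pos s0 hs
        · exact mul_pos s2 hs
        · exact mul_pos s4 hs
    rw [this]
    have e : ({(0 : Fin 6), (2 : Fin 6), (4 : Fin 6)} : Set (Fin 6)).ncard = 3 := by
      rw [ncard_eq_toFinset_card']; decide
    exact e

lemma pt_geom {S : Set Pt} {A a B b C c : Pt} (h : PTri A a B b C c)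
    (hS : ∀ w ∈ ({A, a, B, b, C, c} : Set Pt), w ∈ S)
    (hq : ∀ x ∈ S, x ∈ ({A, a, B, b, C, c} : Set Pt) ∨ Far {A, a, B, b, C, c} x ∨
      Esc A a B x ∨ Esc B b C x ∨ Esc C c A x) :
    HasEmptyPseudoTriangle 6 S := by
  refine ⟨hexa A a B b C c, ?_, h.pseudo, ?_⟩
  · rintro _ ⟨i, rfl⟩
    apply hS
    fin_cases i <;> simp [hexa]
  · ext x
    simp only [mem_inter_iff, mem_empty_iff_false, iff_false, not_and, polyInterior, mem_ofPred_eq,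
      polyBoundary_hexa]
    rintro ⟨hxb, hbd⟩ hxS
    rcases hq x hxS with hx | ⟨o, ho, hx⟩ | hx | hx | hx
    · apply hxb
      simp only [mem_insert_iff, mem_singleton_iff] at hx
      simp only [hexaB, mem_union]
      rcases hx with rfl | rfl | rfl | rfl | rfl | rfl <;>
        simp [left_mem_segment, right_mem_segment]
    · refine unbounded_of_far ho ?_ hbd
      intro y hy
      have seg : ∀ u v : Pt, u ∈ ({A, a, B, b, C, c} : Set Pt) → v ∈ ({A, a, B, b, C, c} : Set Pt) →
          y ∈ segment ℝ u v → 0 < ori o y x ∨ y = o := fun u v hu hv hy =>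
        (convex_far o x).segment_subset (hx u hu) (hx v hv) hy
      simp only [hexaB, mem_union] at hy
      rcases hy with ((((hy | hy) | hy) | hy) | hy) | hy <;> refine seg _ _ ?_ ?_ hy <;> simp
    · exact h.esc hx hbd
    · rw [← hexaB_rot] at hbd
      exact h.rot.esc hx hbd
    · rw [← hexaB_rot, ← hexaB_rot] at hbd
      exact h.rot.rot.esc hx hbd

/-! ### The finite search -/

/-- Position of the ordered triple `(a,b,c)` in the bit table. -/
def tIdx (a b c : ℕ) : ℕ := Nat.add (Nat.mul a 81) (Nat.add (Nat.mul b 9) c)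

/-- Read a bit. -/
def rdBit (A n : ℕ) : Bool := Nat.beq (Nat.land (Nat.shiftRight A n) 1) 1

/-- The triple `(a,b,c)` is recorded as counterclockwise. -/
def ccw (A a b c : ℕ) : Bool := rdBit A (tIdx a b c)

/-- Bits recording that `(a,b,c)` is counterclockwise. -/
def posMask (a b c : ℕ) : ℕ :=
  Nat.lor (Nat.shiftLeft 1 (tIdx a b c))
    (Nat.lor (Nat.shiftLeft 1 (tIdx b c a)) (Nat.shiftLeft 1 (tIdx c a b)))

/-- Lazy conjunction. -/
def band (a b : Bool) : Bool := Bool.rec false b a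

/-- Lazy disjunction. -/
def bor (a b : Bool) : Bool := Bool.rec b true a

local notation:35 x:36 "⋏" y:35 => band x y
local notation:30 x:31 "⋎" y:30 => bor x y

/-- Violation of the signotope condition on `i<j<k<l`. -/
def bad4 (A i j k l : ℕ) : Bool :=
  (ccw A i j k ⋏ ((ccw A j i l ⋏ (ccw A i k l ⋎ ccw A j k l)) ⋎ (ccw A k i l ⋏ ccw A j k l))) ⋎
  (ccw A j i k ⋏ ((ccw A i j l ⋏ (ccw A k i l ⋎ ccw A k j l)) ⋎ (ccw A i k l ⋏ ccw A k j l)))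

/-- Some element of a list satisfies a Boolean predicate. -/
def anyL (f : ℕ → Bool) (L : List ℕ) : Bool :=
  List.rec false (fun x _ ih => Bool.rec ih true (f x)) L

/-- All elements of a list satisfy a Boolean predicate. -/
def allL (f : ℕ → Bool) (L : List ℕ) : Bool :=
  List.rec true (fun x _ ih => Bool.rec false ih (f x)) L

/-- The list of all numbers below `k`. -/
def below : ℕ → List ℕ
  | 0 => []
  | k + 1 => k :: below k

/-- `x` is outside of the convex pentagon `a b c d e`. -/
def outPent (A a b c d e x : ℕ) : Bool :=
  ccw A b a x ⋎ ccw A c b x ⋎ ccw A d c x ⋎ ccw A e d x ⋎ ccw A a e x ⋎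
  Nat.beq x b ⋎ Nat.beq x c ⋎ Nat.beq x d ⋎ Nat.beq x e

/-- A pentagonal hole with vertex `k` among the points `0..k`. -/
def findHole (A k : ℕ) (L : List ℕ) : Bool :=
  anyL (fun b => anyL (fun c => ccw A k b c ⋏ anyL (fun d =>
    ccw A k c d ⋏ (ccw A b c d ⋏ (ccw A k b d ⋏ anyL (fun e =>
      ccw A k d e ⋏ (ccw A c d e ⋏ (ccw A k b e ⋏ (ccw A k c e ⋏ (ccw A b c e ⋏ (ccw A b d e ⋏
        allL (outPent A k b c d e) L)))))) L))) L) L) L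

/-- `x` is outside of the pseudo-triangle `u a v b w c`. -/
def outPT (A u a v b w c x : ℕ) : Bool :=
  ccw A v u x ⋎ ccw A w v x ⋎ ccw A u w x ⋎
  (ccw A a u x ⋏ ccw A v a x) ⋎ (ccw A b v x ⋏ ccw A w b x) ⋎ (ccw A c w x ⋏ ccw A u c x) ⋎
  Nat.beq x a ⋎ Nat.beq x b ⋎ Nat.beq x c ⋎ Nat.beq x v ⋎ Nat.beq x w

/-- `x` is inside the triangle `u v w`. -/
def inTri (A u v w x : ℕ) : Bool := ccw A u v x ⋏ (ccw A v w x ⋏ ccw A w u x)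

/-- An empty pseudo-triangle with vertex `k` among the points `0..k`. -/
def findPT (A k : ℕ) (L : List ℕ) : Bool :=
  anyL (fun v => anyL (fun w => ccw A k v w ⋏ anyL (fun a => inTri A k v w a ⋏
    anyL (fun b => ccw A a v b ⋏ (inTri A k v w b ⋏ anyL (fun c =>
      ccw A a b c ⋏ (ccw A c k a ⋏ (ccw A b w c ⋏ (inTri A k v w c ⋏
        allL (outPT A k a v b w c) L)))) L)) L) L) L) L

/-- Steps of the search. -/
inductive Step : Type
  | br (i j k : ℕ) : Step
  | sg (i j k l : ℕ) : Step
  | ck (k : ℕ) : Step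

/-- The search: `true` means that no admissible completion of the table exists. -/
def runSearch (L : List Step) : ℕ → Bool :=
  List.rec (fun _ => false) (fun s _ ih A => Step.rec
    (fun i j k => ih (Nat.lor A (posMask i j k)) ⋏ ih (Nat.lor A (posMask j i k)))
    (fun i j k l => bad4 A i j k l ⋎ ih A)
    (fun k => findHole A k (below k) ⋎ (findPT A k (below k) ⋎ ih A)) s) L

/-- The schedule of the search. -/
def steps : List Step :=
  [3, 4, 5, 6, 7, 8].flatMap (fun k =>
    ((List.range k).flatMap (fun j => (List.range (j - 1)).flatMap (fun i' =>
      Step.br (j - 1 - i') j k ::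
        (List.range i').map (fun x => Step.sg (j - 1 - i') (j - 1 - x) j k)))) ++ [Step.ck k])

/-- The table containing the triples `(0,i,j)`. -/
def table0 : ℕ :=
  (below 9).foldr (fun j A => (below j).foldr (fun i A =>
    if i = 0 then A else Nat.lor A (posMask 0 i j)) A) 0

/-- The outcome of the search. -/
theorem runSearch_steps : runSearch steps table0 = true := by decide +kernel

/-! ### Soundness of the search -/

lemma rdBit_iff (A n : ℕ) : rdBit A n = true ↔ A.testBit n = true := by
  have h : Nat.land (Nat.shiftRight A n) 1 = (A >>> n) &&& 1 := rfl
  unfold rdBit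
  rw [h, Nat.beq_eq, Nat.and_one_is_mod, Nat.testBit_eq_decide_div_mod_eq,
    Nat.shiftRight_eq_div_pow, decide_eq_true_eq]

lemma rdBit_lor {A B n : ℕ} (h : rdBit (Nat.lor A B) n = true) :
    rdBit A n = true ∨ rdBit B n = true := by
  rw [rdBit_iff] at *
  rw [rdBit_iff]
  have : (Nat.lor A B) = A ||| B := rfl
  rw [this, Nat.testBit_or, Bool.or_eq_true] at h
  exact h

lemma rdBit_shift {m n : ℕ} (h : rdBit (Nat.shiftLeft 1 m) n = true) : m = n := by
  rw [rdBit_iff] at h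
  have : Nat.shiftLeft 1 m = 2 ^ m := by
    have : Nat.shiftLeft 1 m = 1 <<< m := rfl
    rw [this, Nat.one_shiftLeft]
  rw [this, Nat.testBit_two_pow] at h
  simpa using h

lemma tIdx_inj {a b c a' b' c' : ℕ} (ha : a < 9) (hb : b < 9) (hc : c < 9) (ha' : a' < 9)
    (hb' : b' < 9) (hc' : c' < 9) (h : tIdx a b c = tIdx a' b' c') :
    a = a' ∧ b = b' ∧ c = c' := by
  have h1 : tIdx a b c = a * 81 + (b * 9 + c) := rfl
  have h2 : tIdx a' b' c' = a' * 81 + (b' * 9 + c') := rfl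
  omega

/-- All recorded triples are counterclockwise. -/
def TabInv (p : ℕ → Pt) (A : ℕ) : Prop :=
  ∀ a b c, a < 9 → b < 9 → c < 9 → ccw A a b c = true → 0 < ori (p a) (p b) (p c)

lemma TabInv.add {p : ℕ → Pt} {A i j k : ℕ} (hA : TabInv p A) (hi : i < 9) (hj : j < 9) (hk : k < 9)
    (h : 0 < ori (p i) (p j) (p k)) : TabInv p (Nat.lor A (posMask i j k)) := by
  intro a b c ha hb hc hq
  rcases rdBit_lor hq with h1 | h1
  · exact hA a b c ha hb hc h1
  · rcases rdBit_lor h1 with h2 | h2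
    · obtain ⟨rfl, rfl, rfl⟩ := tIdx_inj hi hj hk ha hb hc (rdBit_shift h2)
      exact h
    · rcases rdBit_lor h2 with h3 | h3
      · obtain ⟨rfl, rfl, rfl⟩ := tIdx_inj hj hk hi ha hb hc (rdBit_shift h3)
        rw [ori_rot]; exact h
      · obtain ⟨rfl, rfl, rfl⟩ := tIdx_inj hk hi hj ha hb hc (rdBit_shift h3)
        rw [ori_rot, ori_rot]; exact h

lemma band_true {a b : Bool} : band a b = true ↔ a = true ∧ b = true := by
  cases a <;> simp [band]

lemma bor_true {a b : Bool} : bor a b = true ↔ a = true ∨ b = true := by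
  cases a <;> simp [bor]

lemma anyL_true {f : ℕ → Bool} {L : List ℕ} : anyL f L = true ↔ ∃ x ∈ L, f x = true := by
  induction L with
  | nil => simp [anyL]
  | cons x r ih =>
    have : anyL f (x :: r) = bor (f x) (anyL f r) := rfl
    rw [this, bor_true, ih]; simp

lemma allL_true {f : ℕ → Bool} {L : List ℕ} : allL f L = true ↔ ∀ x ∈ L, f x = true := by
  induction L with
  | nil => simp [allL]
  | cons x r ih =>
    have : allL f (x :: r) = band (f x) (allL f r) := rfl
    rw [this, band_true, ih]; simp

lemma mem_below {k x : ℕ} : x ∈ below k ↔ x < k := by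
  induction k with
  | zero => simp [below]
  | succ k ih => simp only [below, List.mem_cons, ih]; omega

/-- The geometric setting: `p` enumerates `S` by angle around `p 0`. -/
structure Setting (S : Set Pt) (p : ℕ → Pt) (m : ℕ) : Prop where
  le : 9 ≤ m
  mem : ∀ i, i < m → p i ∈ S
  surj : ∀ x ∈ S, ∃ i, i < m ∧ p i = x
  pos : ∀ i j, 0 < i → i < j → j < m → 0 < ori (p 0) (p i) (p j)
  ne : ∀ i j k, i < j → j < k → k < m → ori (p i) (p j) (p k) ≠ 0

lemma Setting.far {S : Set Pt} {p : ℕ → Pt} {m : ℕ} (h : Setting S p m) {k l : ℕ} (hkl : k < l)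
    (hk : 0 < k) (hl : l < m) {V : Set Pt} (hV : ∀ w ∈ V, ∃ i, i ≤ k ∧ p i = w) : Far V (p l) := by
  refine ⟨p 0, ?_, ?_⟩
  · exact (ne_of_ori (h.pos k l hk hkl hl)).2.1.symm
  · intro w hw
    obtain ⟨i, hi, rfl⟩ := hV w hw
    rcases Nat.eq_zero_or_pos i with rfl | h0
    · exact Or.inr rfl
    · exact Or.inl (h.pos i l h0 (by omega) hl)

lemma ori_neg_of {p q r : Pt} (h : 0 < ori q p r) : ori p q r < 0 := by
  rw [ori_swap] at h; linarith

lemma Setting.hole {S : Set Pt} {p : ℕ → Pt} {m : ℕ} (h : Setting S p m) {A k : ℕ} (hA : TabInv p A)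
    (hk : k < 9) (hk0 : 0 < k) (hf : findHole A k (below k) = true) : HasHole 5 S := by
  simp only [findHole, anyL_true, band_true, mem_below, allL_true] at hf
  obtain ⟨b, hb, c, hc, t1, d, hd, t2, t3, t4, e, he, t5, t6, t7, t8, t9, t10, hall⟩ := hf
  have hm := h.le
  have q : ∀ {x y z : ℕ}, x ≤ k → y ≤ k → z ≤ k → ccw A x y z = true → 0 < ori (p x) (p y) (p z) :=
    fun hx hy hz hq => hA _ _ _ (by omega) (by omega) (by omega) hq
  refine hole_geom (a := p k) (b := p b) (c := p c) (d := p d) (e := p e)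
    (h.mem _ (by omega)) (h.mem _ (by omega)) (h.mem _ (by omega)) (h.mem _ (by omega))
    (h.mem _ (by omega)) (q (by omega) (by omega) (by omega) t1)
    (q (by omega) (by omega) (by omega) t4) (q (by omega) (by omega) (by omega) t7)
    (q (by omega) (by omega) (by omega) t2) (q (by omega) (by omega) (by omega) t8)
    (q (by omega) (by omega) (by omega) t5) (q (by omega) (by omega) (by omega) t3)
    (q (by omega) (by omega) (by omega) t9) (q (by omega) (by omega) (by omega) t10)
    (q (by omega) (by omega) (by omega) t6) ?_
  intro x hx
  obtain ⟨l, hl, rfl⟩ := h.surj x hx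
  rcases lt_trichotomy l k with hlk | rfl | hlk
  · have h1 := hall l hlk
    simp only [outPent, bor_true, Nat.beq_eq] at h1
    rcases h1 with h1 | h1 | h1 | h1 | h1 | h1 | h1 | h1 | h1
    · have := ori_neg_of (q (by omega) (by omega) (by omega) h1); tauto
    · have := ori_neg_of (q (by omega) (by omega) (by omega) h1); tauto
    · have := ori_neg_of (q (by omega) (by omega) (by omega) h1); tauto
    · have := ori_neg_of (q (by omega) (by omega) (by omega) h1); tauto
    · have := ori_neg_of (q (by omega) (by omega) (by omega) h1); tauto
    all_goals subst h1; left; simp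
  · left; simp
  · right; left
    apply h.far hlk hk0 hl
    intro w hw
    simp only [mem_insert_iff, mem_singleton_iff] at hw
    rcases hw with rfl | rfl | rfl | rfl | rfl
    · exact ⟨k, le_rfl, rfl⟩
    · exact ⟨b, by omega, rfl⟩
    · exact ⟨c, by omega, rfl⟩
    · exact ⟨d, by omega, rfl⟩
    · exact ⟨e, by omega, rfl⟩

lemma Setting.pt {S : Set Pt} {p : ℕ → Pt} {m : ℕ} (h : Setting S p m) {A k : ℕ} (hA : TabInv p A)
    (hk : k < 9) (hk0 : 0 < k) (hf : findPT A k (below k) = true) : HasEmptyPseudoTriangle 6 S := by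
  simp only [findPT, anyL_true, band_true, mem_below, allL_true, inTri] at hf
  obtain ⟨v, hv, w, hw, t1, a, ha, ⟨a1, a2, a3⟩, b, hb, t2, ⟨b1, b2, b3⟩, c, hc, t3, t4, t5,
    ⟨c1, c2, c3⟩, hall⟩ := hf
  have hm := h.le
  have q : ∀ {x y z : ℕ}, x ≤ k → y ≤ k → z ≤ k → ccw A x y z = true → 0 < ori (p x) (p y) (p z) :=
    fun hx hy hz hq => hA _ _ _ (by omega) (by omega) (by omega) hq
  have hT : PTri (p k) (p a) (p v) (p b) (p w) (p c) := by
    constructor <;> refine q (by omega) (by omega) (by omega) ?_ <;> assumption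
  have hV : ∀ x ∈ ({p k, p a, p v, p b, p w, p c} : Set Pt), ∃ i, i ≤ k ∧ p i = x := by
    intro x hw
    simp only [mem_insert_iff, mem_singleton_iff] at hw
    rcases hw with rfl | rfl | rfl | rfl | rfl | rfl
    · exact ⟨k, le_rfl, rfl⟩
    · exact ⟨a, by omega, rfl⟩
    · exact ⟨v, by omega, rfl⟩
    · exact ⟨b, by omega, rfl⟩
    · exact ⟨w, by omega, rfl⟩
    · exact ⟨c, by omega, rfl⟩
  refine pt_geom hT ?_ ?_
  · intro x hx
    obtain ⟨i, hi, rfl⟩ := hV x hx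
    exact h.mem i (by omega)
  intro x hx
  obtain ⟨l, hl, rfl⟩ := h.surj x hx
  rcases lt_trichotomy l k with hlk | rfl | hlk
  · have h1 := hall l hlk
    simp only [outPT, bor_true, band_true, Nat.beq_eq] at h1
    have n : ∀ {x y z : ℕ}, x ≤ k → y ≤ k → z ≤ k → ccw A y x z = true →
        ori (p x) (p y) (p z) < 0 := fun hx hy hz hq => ori_neg_of (q hy hx hz hq)
    rcases h1 with h1 | h1 | h1 | h1 | h1 | h1 | h1 | h1 | h1 | h1 | h1
    · exact Or.inr (Or.inr (Or.inl (Or.inl (n (by omega) (by omega) (by omega) h1))))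
    · exact Or.inr (Or.inr (Or.inr (Or.inl (Or.inl (n (by omega) (by omega) (by omega) h1)))))
    · exact Or.inr (Or.inr (Or.inr (Or.inr (Or.inl (n (by omega) (by omega) (by omega) h1)))))
    · exact Or.inr (Or.inr (Or.inl (Or.inr ⟨n (by omega) (by omega) (by omega) h1.1,
        n (by omega) (by omega) (by omega) h1.2⟩)))
    · exact Or.inr (Or.inr (Or.inr (Or.inl (Or.inr ⟨n (by omega) (by omega) (by omega) h1.1,
        n (by omega) (by omega) (by omega) h1.2⟩))))
    · exact Or.inr (Or.inr (Or.inr (Or.inr (Or.inr ⟨n (by omega) (by omega) (by omega) h1.1,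
        n (by omega) (by omega) (by omega) h1.2⟩))))
    all_goals subst h1; left; simp
  · left; simp
  · right; left
    exact h.far hlk hk0 hl hV

/-- The three-term relations behind the signotope conditions. -/
lemma rel_ijk (o i j k l : Pt) :
    ori i j k * ori o i l + ori i k l * ori o i j = ori i j l * ori o i k := by
  unfold ori; ring

lemma rel_ijw (o i j k l : Pt) :
    ori i j k * ori o j l + ori j k l * ori o i j = ori i j l * ori o j k := by
  unfold ori; ring

lemma rel_ikw (o i j k l : Pt) :
    ori i j k * ori o k l + ori j k l * ori o i k = ori i k l * ori o j k := by
  unfold ori; ring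

lemma no_pmp {x y z a b c : ℝ} (h : x * a + z * b = y * c) (ha : 0 < a) (hb : 0 < b) (hc : 0 < c) :
    (0 < x → y < 0 → 0 < z → False) ∧ (x < 0 → 0 < y → z < 0 → False) := by
  constructor
  · intro h1 h2 h3
    have := mul_pos h1 ha
    have := mul_pos h3 hb
    have := mul_neg_of_neg_of_pos h2 hc
    linarith
  · intro h1 h2 h3
    have := mul_neg_of_neg_of_pos h1 ha
    have := mul_neg_of_neg_of_pos h3 hb
    have := mul_pos h2 hc
    linarith

lemma Setting.sig {S : Set Pt} {p : ℕ → Pt} {m : ℕ} (h : Setting S p m) {A i j k l : ℕ}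
    (hA : TabInv p A) (hi : 0 < i) (hij : i < j) (hjk : j < k) (hkl : k < l) (hl : l < 9)
    (hf : bad4 A i j k l = true) : False := by
  have hm := h.le
  have q : ∀ {x y z : ℕ}, x ≤ l → y ≤ l → z ≤ l → ccw A x y z = true → 0 < ori (p x) (p y) (p z) :=
    fun hx hy hz hq => hA _ _ _ (by omega) (by omega) (by omega) hq
  have n : ∀ {x y z : ℕ}, x ≤ l → y ≤ l → z ≤ l → ccw A y x z = true →
      ori (p x) (p y) (p z) < 0 := fun hx hy hz hq => ori_neg_of (q hy hx hz hq)
  have pij := h.pos i j hi hij (by omega)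
  have pik := h.pos i k hi (by omega) (by omega)
  have pil := h.pos i l hi (by omega) (by omega)
  have pjk := h.pos j k (by omega) (by omega) (by omega)
  have pjl := h.pos j l (by omega) (by omega) (by omega)
  have pkl := h.pos k l (by omega) (by omega) (by omega)
  obtain ⟨r1, r2⟩ := no_pmp (rel_ijk (p 0) (p i) (p j) (p k) (p l)) pil pij pik
  obtain ⟨r3, r4⟩ := no_pmp (rel_ijw (p 0) (p i) (p j) (p k) (p l)) pjl pij pjk
  obtain ⟨r5, r6⟩ := no_pmp (rel_ikw (p 0) (p i) (p j) (p k) (p l)) pkl pik pjk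
  simp only [bad4, bor_true, band_true] at hf
  rcases hf with ⟨x, ⟨y, z | w⟩ | ⟨z, w⟩⟩ | ⟨x, ⟨y, z | w⟩ | ⟨z, w⟩⟩
  · exact r1 (q (by omega) (by omega) (by omega) x) (n (by omega) (by omega) (by omega) y)
      (q (by omega) (by omega) (by omega) z)
  · exact r3 (q (by omega) (by omega) (by omega) x) (n (by omega) (by omega) (by omega) y)
      (q (by omega) (by omega) (by omega) w)
  · exact r5 (q (by omega) (by omega) (by omega) x) (n (by omega) (by omega) (by omega) z)
      (q (by omega) (by omega) (by omega) w)
  · exact r2 (n (by omega) (by omega) (by omega) x) (q (by omega) (by omega) (by omega) y)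
      (n (by omega) (by omega) (by omega) z)
  · exact r4 (n (by omega) (by omega) (by omega) x) (q (by omega) (by omega) (by omega) y)
      (n (by omega) (by omega) (by omega) w)
  · exact r6 (n (by omega) (by omega) (by omega) x) (q (by omega) (by omega) (by omega) z)
      (n (by omega) (by omega) (by omega) w)

/-- Index bounds of a step. -/
def Step.ok : Step → Bool
  | Step.br i j k => decide (i < j) && decide (j < k) && decide (k < 9)
  | Step.sg i j k l => decide (0 < i) && decide (i < j) && decide (j < k) && decide (k < l) && decide (l < 9)
  | Step.ck k => decide (0 < k) && decide (k < 9)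

lemma steps_ok : ∀ s ∈ steps, s.ok = true := by
  have : steps.all Step.ok = true := by decide +kernel
  exact List.all_eq_true.1 this

lemma Setting.sound {S : Set Pt} {p : ℕ → Pt} {m : ℕ} (h : Setting S p m)
    (hno : ¬ (HasHole 5 S ∨ HasEmptyPseudoTriangle 6 S)) (L : List Step) :
    (∀ s ∈ L, s.ok = true) → ∀ A, TabInv p A → runSearch L A = true → False := by
  have hm := h.le
  induction L with
  | nil => intro _ A _ hr; simp [runSearch] at hr
  | cons s r ih =>
    intro hL A hA hr
    have ih' := ih (fun s hs => hL s (List.mem_cons_of_mem _ hs))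
    have hs := hL s List.mem_cons_self
    cases s with
    | br i j k =>
      simp only [Step.ok, Bool.and_eq_true, decide_eq_true_eq] at hs
      have e : runSearch (Step.br i j k :: r) A = band (runSearch r (Nat.lor A (posMask i j k)))
        (runSearch r (Nat.lor A (posMask j i k))) := rfl
      rw [e, band_true] at hr
      rcases lt_or_gt_of_ne (h.ne i j k (by omega) (by omega) (by omega)) with h1 | h1
      · refine ih' _ (hA.add (by omega) (by omega) (by omega) ?_) hr.2
        rw [ori_swap]; linarith
      · exact ih' _ (hA.add (by omega) (by omega) (by omega) h1) hr.1
    | sg i j k l =>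
      simp only [Step.ok, Bool.and_eq_true, decide_eq_true_eq] at hs
      have e : runSearch (Step.sg i j k l :: r) A = bor (bad4 A i j k l) (runSearch r A) := rfl
      rw [e, bor_true] at hr
      rcases hr with hr | hr
      · exact h.sig hA (by omega) (by omega) (by omega) (by omega) (by omega) hr
      · exact ih' A hA hr
    | ck k =>
      simp only [Step.ok, Bool.and_eq_true, decide_eq_true_eq] at hs
      have e : runSearch (Step.ck k :: r) A = bor (findHole A k (below k))
        (bor (findPT A k (below k)) (runSearch r A)) := rfl
      rw [e, bor_true, bor_true] at hr
      rcases hr with hr | hr | hr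
      · exact hno (Or.inl (h.hole hA (by omega) (by omega) hr))
      · exact hno (Or.inr (h.pt hA (by omega) (by omega) hr))
      · exact ih' A hA hr

lemma Setting.inv0 {S : Set Pt} {p : ℕ → Pt} {m : ℕ} (h : Setting S p m) : TabInv p table0 := by
  have hm := h.le
  have inner : ∀ j, j < 9 → ∀ n, n ≤ j → ∀ A, TabInv p A → TabInv p ((below n).foldr (fun i A =>
      if i = 0 then A else Nat.lor A (posMask 0 i j)) A) := by
    intro j hj n
    induction n with
    | zero => intro _ A hA; exact hA
    | succ n ih =>
      intro hn A hA
      have := ih (by omega) A hA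
      simp only [below, List.foldr_cons]
      split_ifs with h0
      · exact this
      · exact this.add (by omega) (by omega) hj (h.pos n j (by omega) (by omega) (by omega))
  have outer : ∀ n, n ≤ 9 → TabInv p ((below n).foldr (fun j A => (below j).foldr (fun i A =>
      if i = 0 then A else Nat.lor A (posMask 0 i j)) A) 0) := by
    intro n
    induction n with
    | zero =>
      intro _ a b c _ _ _ hq
      have hq' : rdBit 0 (tIdx a b c) = true := hq
      rw [rdBit_iff] at hq'
      simp at hq'
    | succ n ih =>
      intro hn
      simp only [below, List.foldr_cons]
      exact inner n (by omega) n le_rfl _ (ih (by omega))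
  exact outer 9 le_rfl

/-! ### Sorting by angle -/

/-- Sorting key of a direction in the right half-plane. -/
def angKey (o x : Pt) : ℝ ×ₗ ℝ :=
  toLex ((if x.1 - o.1 = 0 then 1 else 0), (x.2 - o.2) / (x.1 - o.1))

lemma ori_pos_of_key {o x y : Pt} (hx : 0 < x.1 - o.1 ∨ (x.1 - o.1 = 0 ∧ 0 < x.2 - o.2))
    (hy : 0 < y.1 - o.1 ∨ (y.1 - o.1 = 0 ∧ 0 < y.2 - o.2))
    (hk : angKey o x ≤ angKey o y) (h0 : ori o x y ≠ 0) : 0 < ori o x y := by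
  refine lt_of_le_of_ne ?_ h0.symm
  simp only [angKey, Prod.Lex.le_iff, ofLex_toLex] at hk
  unfold ori
  rcases hx with hx | ⟨hx, hx'⟩
  · rcases hy with hy | ⟨hy, hy'⟩
    · simp only [hx.ne', hy.ne', if_false, lt_irrefl, true_and, false_or] at hk
      rw [div_le_div_iff₀ hx hy] at hk
      linarith
    · rw [hy]; have := mul_pos hx hy'; linarith
  · rcases hy with hy | ⟨hy, hy'⟩
    · simp only [hx, hy.ne', if_true, if_false] at hk
      norm_num at hk
    · rw [hx, hy]; simp

lemma exists_setting (S : Set Pt) (hfin : S.Finite) (hgp : GenPos S) (hcard : 9 ≤ S.ncard) :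
    ∃ p m, Setting S p m := by
  classical
  have hne : S.Nonempty := by
    rw [Set.nonempty_iff_ne_empty]; rintro rfl; simp at hcard
  obtain ⟨o, ho, hmin⟩ := Set.exists_min_image S (fun x : Pt => (toLex (x.1, x.2) : ℝ ×ₗ ℝ)) hfin hne
  have hright : ∀ x ∈ S, x ≠ o → 0 < x.1 - o.1 ∨ (x.1 - o.1 = 0 ∧ 0 < x.2 - o.2) := by
    intro x hx hxo
    have := hmin x hx
    simp only [Prod.Lex.le_iff, ofLex_toLex] at this
    rcases this with h | ⟨h, h'⟩
    · left; linarith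
    · right
      refine ⟨by linarith, ?_⟩
      rcases h'.lt_or_eq with h2 | h2
      · linarith
      · exact absurd (Prod.ext h h2).symm hxo
  let F : Finset Pt := hfin.toFinset.erase o
  let r : Pt → Pt → Prop := fun x y => angKey o x ≤ angKey o y
  haveI : Std.Total r := ⟨fun x y => le_total _ _⟩
  haveI : IsTrans Pt r := ⟨fun x y z h1 h2 => le_trans h1 h2⟩
  let l : List Pt := F.toList.insertionSort r
  have hperm : l.Perm F.toList := List.perm_insertionSort r _
  have hsort : l.Pairwise r := List.pairwise_insertionSort r _
  have hnd : l.Nodup := hperm.nodup_iff.2 F.nodup_toList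
  have hmem : ∀ x, x ∈ l ↔ x ∈ S ∧ x ≠ o := by
    intro x
    rw [hperm.mem_iff]
    simp [F, and_comm]
  have hlen : l.length + 1 = S.ncard := by
    rw [hperm.length_eq, Finset.length_toList, Set.ncard_eq_toFinset_card S hfin]
    exact Finset.card_erase_add_one (by simpa using ho)
  let L : List Pt := o :: l
  have hLnd : L.Nodup := by
    refine List.nodup_cons.2 ⟨?_, hnd⟩
    intro h; exact ((hmem o).1 h).2 rfl
  have hLlen : L.length = S.ncard := by rw [← hlen]; rfl
  have hLmem : ∀ x, x ∈ L ↔ x ∈ S := by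
    intro x
    simp only [L, List.mem_cons, hmem]
    constructor
    · rintro (rfl | h)
      · exact ho
      · exact h.1
    · intro h
      by_cases hx : x = o
      · exact Or.inl hx
      · exact Or.inr ⟨h, hx⟩
  have hget : ∀ i (hi : i < L.length), L.getD i o = L[i] := by
    intro i hi
    exact List.getD_eq_getElem _ _ hi
  have hmemS : ∀ i, i < L.length → L.getD i o ∈ S := by
    intro i hi
    rw [hget i hi, ← hLmem]; exact List.getElem_mem hi
  have hinj : ∀ i j, i < L.length → j < L.length → i ≠ j → L.getD i o ≠ L.getD j o := by
    intro i j hi hj hij h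
    rw [hget i hi, hget j hj] at h
    exact hij ((hLnd.getElem_inj_iff).1 h)
  have hnz : ∀ i j k, i < j → j < k → k < L.length →
      ori (L.getD i o) (L.getD j o) (L.getD k o) ≠ 0 := by
    intro i j k hij hjk hk
    have n1 := hinj i j (by omega) (by omega) (by omega)
    have n2 := hinj i k (by omega) (by omega) (by omega)
    have n3 := hinj j k (by omega) (by omega) (by omega)
    exact ori_ne_of_not_collinear n1 (hgp _ (hmemS i (by omega)) _ (hmemS j (by omega)) _
      (hmemS k hk) n1 n2 n3)
  refine ⟨fun i => L.getD i o, L.length, by omega, hmemS, ?_, ?_, hnz⟩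
  · intro x hx
    obtain ⟨i, hi, rfl⟩ := List.getElem_of_mem ((hLmem x).2 hx)
    exact ⟨i, hi, hget i hi⟩
  · intro i j hi hij hj
    have hz := hnz 0 i j hi hij hj
    have h0 : L.getD 0 o = o := rfl
    simp only [h0] at hz ⊢
    have n1 := hinj i 0 (by omega) (by omega) (by omega)
    have n2 := hinj j 0 (by omega) (by omega) (by omega)
    rw [h0] at n1 n2
    refine ori_pos_of_key (hright _ (hmemS i (by omega)) n1) (hright _ (hmemS j (by omega)) n2) ?_ hz
    rw [hget i (by omega), hget j (by omega)]
    obtain ⟨i, rfl⟩ : ∃ i', i = i' + 1 := ⟨i - 1, by omega⟩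
    obtain ⟨j, rfl⟩ : ∃ j', j = j' + 1 := ⟨j - 1, by omega⟩
    simp only [L, List.getElem_cons_succ]
    exact List.pairwise_iff_getElem.1 hsort i j _ _ (by omega)

/-- every set of 9 points in general position contains a 5-hole or an
empty 6-pseudo-triangle. -/
theorem statement_8 (S : Set Pt) (hfin : S.Finite) (hgp : GenPos S)
    (hcard : 9 ≤ S.ncard) :
    HasHole 5 S ∨ HasEmptyPseudoTriangle 6 S := by
  obtain ⟨p, m, h⟩ := exists_setting S hfin hgp hcard
  by_contra hno
  exact h.sound hno steps steps_ok table0 h.inv0 runSearch_steps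
end
end
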